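/- arXiv:math/9503230 — 2 statements merged into one kernel-verified Lean document; each statement's English description precedes it below -/
import Mathlib

section
/- Let p > 3 be a prime and let PΓ₀(p) = Γ₀(p)/{±I}. Then for every integer i ≥ 1: H^{2i}(PΓ₀(p), ℤ) ≅ ℤ/6 ⊕ ℤ/6 if p ≡ 1 (mod 12), ℤ/2 ⊕ ℤ/2 if p ≡ 5 (mod 12), ℤ/3 ⊕ ℤ/3 if p ≡ 7 (mod 12), and 0 if p ≡ 11 (mod 12); and H^{2i+1}(PΓ₀(p), ℤ) = 0. -/
open CongruenceSubgroup

/-- `-I` as an element of `Γ₀(p)`. -/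
def negIGamma0 (p : ℕ) : Gamma0 p :=
  ⟨-1, by rw [Gamma0_mem]; simp⟩

/-- The central subgroup `{±I}` of `Γ₀(p)`. -/
def pmOne (p : ℕ) : Subgroup (Gamma0 p) :=
  Subgroup.zpowers (negIGamma0 p)

instance pmOne_normal (p : ℕ) : (pmOne p).Normal := by
  have hc : ∀ g : Gamma0 p, negIGamma0 p * g = g * negIGamma0 p := by
    intro g; ext; simp [negIGamma0]
  refine ⟨fun x hx g => ?_⟩
  obtain ⟨n, rfl⟩ := Subgroup.mem_zpowers_iff.mp hx
  have hgm : Commute g (negIGamma0 p) := (hc g).symm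
  have h2 : g * negIGamma0 p ^ n * g⁻¹ = negIGamma0 p ^ n := by
    rw [(hgm.zpow_right n).eq, mul_assoc, mul_inv_cancel, mul_one]
  rw [h2]
  exact Subgroup.zpow_mem _ (Subgroup.mem_zpowers _) n

/-- The projective group `PΓ₀(p) = Γ₀(p)/{±I}`. -/
abbrev PGamma0 (p : ℕ) := Gamma0 p ⧸ pmOne p

namespace PG
open Finset

section opalg
variable {M : Type*} [AddCommGroup M]

/-- If `T u = u`, then the norm of `s u` is the averaged operator applied to `u`. -/
lemma norm_of_fixed (q : ℕ) (T s : Module.End ℤ M) (u : M) (hu : T u = u) :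
    (∑ j ∈ range q, T ^ j) (s u) = (∑ j ∈ range q, T ^ j * s * T ^ (q - j)) u := by
  have h : ∀ n : ℕ, (T ^ n) u = u := by
    intro n
    induction n with
    | zero => simp
    | succ n ih => rw [pow_succ, Module.End.mul_apply, hu, ih]
  simp [LinearMap.sum_apply, Module.End.mul_apply, h]

lemma diff_of_norm_zero (q : ℕ) (T s : Module.End ℤ M) (u : M)
    (hu : (∑ j ∈ range q, T ^ j) u = 0) :
    ∃ v, (T - 1) v = (∑ j ∈ range q, T ^ j * s * T ^ (q - j)) u := by
  have h0 : (∑ j ∈ range q, T ^ (q - j)) u = 0 := by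
    have : (∑ j ∈ range q, T ^ (q - j)) = T * ∑ j ∈ range q, T ^ j := by
      rw [← sum_range_reflect, mul_sum]
      refine sum_congr rfl fun j hj => ?_
      rw [mem_range] at hj
      rw [← pow_succ']
      congr 1; omega
    rw [this, Module.End.mul_apply, hu, map_zero]
  have h1 : (∑ j ∈ range q, T ^ j * s * T ^ (q - j)) =
      (∑ j ∈ range q, (T - 1) * ((∑ i ∈ range j, T ^ i) * s * T ^ (q - j))) +
        s * ∑ j ∈ range q, T ^ (q - j) := by
    rw [mul_sum, ← sum_add_distrib]
    refine sum_congr rfl fun j _ => ?_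
    rw [← mul_assoc, ← mul_assoc, mul_geom_sum, sub_mul, sub_mul, one_mul]
    abel
  refine ⟨(∑ j ∈ range q, ((∑ i ∈ range j, T ^ i) * s * T ^ (q - j))) u, ?_⟩
  rw [h1, LinearMap.add_apply, Module.End.mul_apply, h0, map_zero, add_zero, ← mul_sum,
    Module.End.mul_apply]

lemma norm_diff (q : ℕ) (T : Module.End ℤ M) (hT : T ^ q = 1) :
    (∑ j ∈ range q, T ^ j) * (T - 1) = 0 := by rw [geom_sum_mul, hT, sub_self]

lemma diff_norm (q : ℕ) (T : Module.End ℤ M) (hT : T ^ q = 1) :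
    (T - 1) * (∑ j ∈ range q, T ^ j) = 0 := by rw [mul_geom_sum, hT, sub_self]

end opalg

/-- A weight function that picks one point in every free orbit. -/
lemma exists_weight {Y : Type*} (q : ℕ) (hq : q.Prime) (σ : Equiv.Perm Y) (hσ : σ ^ q = 1) :
    ∃ c : Y → ℤ, ∀ y, σ y ≠ y → ∑ j ∈ range q, c ((σ ^ j) y) = 1 := by
  classical
  let r : Setoid Y := Equiv.Perm.SameCycle.setoid σ
  refine ⟨fun y => if y = (Quotient.mk r y).out then 1 else 0, fun y hy => ?_⟩
  have hcl : ∀ j : ℕ, Quotient.mk r ((σ ^ j) y) = Quotient.mk r y := by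
    intro j
    apply Quotient.sound
    change Equiv.Perm.SameCycle σ _ _
    simpa using Equiv.Perm.SameCycle.refl σ y
  simp only [hcl]
  obtain ⟨k, hk⟩ : Equiv.Perm.SameCycle σ y (Quotient.mk r y).out :=
    (Quotient.mk_out (s := r) y).symm
  have hq0 : (0 : ℤ) < q := by exact_mod_cast hq.pos
  have hinj : ∀ i : ℤ, (σ ^ i) y = y → (q : ℤ) ∣ i := by
    intro i hi
    by_contra hnd
    have hcop : IsCoprime (q : ℤ) i := by
      rw [Int.isCoprime_iff_gcd_eq_one]
      have : IsCoprime (q : ℤ) i := (Nat.prime_iff_prime_int.mp hq).irreducible.coprime_iff_not_dvd.2 hnd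
      exact Int.isCoprime_iff_gcd_eq_one.1 this
    obtain ⟨a, b, hab⟩ := hcop
    apply hy
    have : (σ ^ (a * q + b * i)) y = y := by
      rw [zpow_add, mul_comm a, zpow_mul, zpow_natCast, hσ, one_zpow, one_mul, mul_comm b, zpow_mul]
      have hf : Function.IsFixedPt (σ ^ i) y := hi
      exact hf.perm_zpow b
    rwa [hab, zpow_one] at this
  obtain ⟨j, hj⟩ := Int.eq_ofNat_of_zero_le (Int.emod_nonneg k hq0.ne')
  have hjq : j < q := by
    have := Int.emod_lt_of_pos k hq0
    omega
  have hkj : (σ ^ j) y = (Quotient.mk r y).out := by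
    rw [← hk, ← zpow_natCast, ← hj]
    conv_rhs => rw [← Int.emod_add_mul_ediv k q, zpow_add, zpow_mul, zpow_natCast σ q, hσ]
    simp
  rw [sum_eq_single j]
  · simp [hkj]
  · intro i hi hij
    rw [if_neg]
    intro h
    rw [← hkj] at h
    have h2 : (σ ^ ((i : ℤ) - j)) y = y := by
      rw [sub_eq_neg_add, zpow_add, Equiv.Perm.mul_apply, zpow_natCast, h, zpow_neg, zpow_natCast]
      simp
    have := hinj _ h2
    rw [mem_range] at hi
    obtain ⟨m, hm⟩ := this
    have : m = 0 := by nlinarith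
    subst this
    omega
  · intro h; simp [hjq] at h

section fin
variable {X : Type*}

/-- The operator on `ℤ[X]` induced by a permutation. -/
noncomputable def TX (a : Equiv.Perm X) : Module.End ℤ (X →₀ ℤ) := Finsupp.lmapDomain ℤ ℤ a

/-- The norm operator. -/
noncomputable def NX (q : ℕ) (a : Equiv.Perm X) : Module.End ℤ (X →₀ ℤ) := ∑ j ∈ range q, TX a ^ j

@[simp] lemma TX_single (a : Equiv.Perm X) (x : X) (r : ℤ) :
    TX a (Finsupp.single x r) = Finsupp.single (a x) r := by simp [TX]

@[simp] lemma TX_pow_single (a : Equiv.Perm X) (j : ℕ) (x : X) (r : ℤ) :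
    (TX a ^ j) (Finsupp.single x r) = Finsupp.single ((a ^ j) x) r := by
  induction j with
  | zero => simp
  | succ n ih => rw [pow_succ', Module.End.mul_apply, ih, TX_single, pow_succ', Equiv.Perm.mul_apply]

lemma TX_pow (q : ℕ) (a : Equiv.Perm X) (ha : a ^ q = 1) : TX a ^ q = 1 := by
  ext x : 2
  simp [ha]

lemma fin_exists (q : ℕ) (hq : q.Prime) (a : Equiv.Perm X) (ha : a ^ q = 1) (hf : ∀ x, a x ≠ x) :
    ∃ s : Module.End ℤ (X →₀ ℤ), ∑ j ∈ range q, TX a ^ j * s * TX a ^ (q - j) = 1 := by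
  obtain ⟨c, hc⟩ := exists_weight q hq a ha
  refine ⟨Finsupp.lsum ℤ fun x => c x • Finsupp.lsingle x, ?_⟩
  apply Finsupp.lhom_ext'
  intro x
  apply LinearMap.ext_ring
  have h1 : ∑ j ∈ range q, c ((a ^ (q - j)) x) = 1 := by
    have := hc (a x) (by simpa using hf (a x))
    rw [← this, ← sum_range_reflect]
    refine sum_congr rfl fun j hj => ?_
    rw [mem_range] at hj
    rw [← Equiv.Perm.mul_apply, ← pow_succ]
    congr 3; omega
  simp only [LinearMap.comp_apply, LinearMap.sum_apply, Module.End.mul_apply, Finsupp.lsingle_apply,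
    TX_pow_single, Finsupp.lsum_single, LinearMap.smul_apply, map_smul, Module.End.one_apply]
  have h2 : ∀ j ∈ range q, c ((a ^ (q - j)) x) • Finsupp.single ((a ^ j) ((a ^ (q - j)) x)) (1 : ℤ)
      = c ((a ^ (q - j)) x) • Finsupp.single x (1 : ℤ) := by
    intro j hj
    rw [mem_range] at hj
    rw [← Equiv.Perm.mul_apply, ← pow_add, Nat.add_sub_cancel' hj.le, ha, Equiv.Perm.one_apply]
  rw [sum_congr rfl h2, ← sum_smul, h1, one_smul]

lemma fin_exact1 (q : ℕ) (hq : q.Prime) (a : Equiv.Perm X) (ha : a ^ q = 1) (hf : ∀ x, a x ≠ x)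
    (u : X →₀ ℤ) (hu : (TX a - 1) u = 0) : ∃ v, NX q a v = u := by
  obtain ⟨s, hs⟩ := fin_exists q hq a ha hf
  refine ⟨s u, ?_⟩
  rw [NX, norm_of_fixed q (TX a) s u (by simpa [sub_eq_zero] using hu), hs, Module.End.one_apply]

lemma fin_exact2 (q : ℕ) (hq : q.Prime) (a : Equiv.Perm X) (ha : a ^ q = 1) (hf : ∀ x, a x ≠ x)
    (u : X →₀ ℤ) (hu : NX q a u = 0) : ∃ v, (TX a - 1) v = u := by
  obtain ⟨s, hs⟩ := fin_exists q hq a ha hf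
  have := diff_of_norm_zero q (TX a) s u hu
  rwa [hs] at this

end fin

section fn
variable {Y : Type*}

/-- Precomposition operator. -/
def TY (σ : Equiv.Perm Y) : Module.End ℤ (Y → ℤ) := LinearMap.funLeft ℤ ℤ σ

@[simp] lemma TY_apply (σ : Equiv.Perm Y) (f : Y → ℤ) (y : Y) : TY σ f y = f (σ y) := rfl

@[simp] lemma TY_pow_apply (σ : Equiv.Perm Y) (j : ℕ) (f : Y → ℤ) (y : Y) :
    (TY σ ^ j) f y = f ((σ ^ j) y) := by
  induction j generalizing f y with
  | zero => simp
  | succ n ih => rw [pow_succ, Module.End.mul_apply, ih, TY_apply, pow_succ', Equiv.Perm.mul_apply]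

lemma TY_pow (q : ℕ) (a : Equiv.Perm Y) (ha : a ^ q = 1) : TY a ^ q = 1 := by
  ext f y
  simp [ha]

lemma fn_exists (q : ℕ) (hq : q.Prime) (σ : Equiv.Perm Y) (ha : σ ^ q = 1) :
    ∃ s : Module.End ℤ (Y → ℤ), ∀ (f : Y → ℤ) y, σ y ≠ y →
      (∑ j ∈ range q, TY σ ^ j * s * TY σ ^ (q - j)) f y = f y := by
  obtain ⟨c, hc⟩ := exists_weight q hq σ ha
  refine ⟨LinearMap.mulLeft ℤ c, fun f y hy => ?_⟩
  rw [LinearMap.sum_apply, Finset.sum_apply]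
  have h2 : ∀ j ∈ range q, (TY σ ^ j * LinearMap.mulLeft ℤ c * TY σ ^ (q - j)) f y =
      c ((σ ^ j) y) * f y := by
    intro j hj
    rw [mem_range] at hj
    simp only [Module.End.mul_apply, TY_pow_apply, LinearMap.mulLeft_apply, Pi.mul_apply]
    rw [← Equiv.Perm.mul_apply, ← pow_add, Nat.sub_add_cancel hj.le, ha, Equiv.Perm.one_apply]
  rw [sum_congr rfl h2, ← sum_mul, hc y hy, one_mul]

lemma pow_fix (σ : Equiv.Perm Y) (y : Y) (h : σ y = y) (j : ℕ) : (σ ^ j) y = y :=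
  (show Function.IsFixedPt σ y from h).perm_pow j

lemma fn_exact1 (q : ℕ) (hq : q.Prime) (σ : Equiv.Perm Y) (ha : σ ^ q = 1)
    (f : Y → ℤ) (hf : ∀ y, f (σ y) = f y) (hd : ∀ y, σ y = y → (q : ℤ) ∣ f y) :
    ∃ g : Y → ℤ, ∀ y, ∑ j ∈ range q, g ((σ ^ j) y) = f y := by
  classical
  obtain ⟨s, hs⟩ := fn_exists q hq σ ha
  have h := norm_of_fixed q (TY σ) s f (funext hf)
  refine ⟨fun y => if σ y = y then f y / q else s f y, fun y => ?_⟩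
  by_cases hy : σ y = y
  · simp only [pow_fix σ y hy, hy, if_true, sum_const, card_range, nsmul_eq_mul]
    exact Int.mul_ediv_cancel' (hd y hy)
  · have hj : ∀ j : ℕ, σ ((σ ^ j) y) ≠ (σ ^ j) y := by
      intro j hj
      rw [← Equiv.Perm.mul_apply, ← pow_succ', pow_succ, Equiv.Perm.mul_apply] at hj
      exact hy ((σ ^ j).injective hj)
    simp only [hj, if_false]
    rw [← hs f y hy, ← h]
    simp [LinearMap.sum_apply]

lemma fn_exact2 (q : ℕ) (hq : q.Prime) (σ : Equiv.Perm Y) (ha : σ ^ q = 1)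
    (f : Y → ℤ) (hf : ∀ y, ∑ j ∈ range q, f ((σ ^ j) y) = 0) :
    ∃ g : Y → ℤ, ∀ y, g (σ y) - g y = f y := by
  classical
  obtain ⟨s, hs⟩ := fn_exists q hq σ ha
  obtain ⟨v, hv⟩ := diff_of_norm_zero q (TY σ) s f
    (by ext y; simpa [LinearMap.sum_apply] using hf y)
  refine ⟨v, fun y => ?_⟩
  by_cases hy : σ y = y
  · have := hf y
    simp only [pow_fix σ y hy, sum_const, card_range, nsmul_eq_mul] at this
    rcases mul_eq_zero.1 this with h | h
    · exact absurd (by exact_mod_cast h) hq.ne_zero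
    · rw [hy, h, sub_self]
  · rw [← hs f y hy, ← hv]; rfl

end fn
set_option linter.unusedSimpArgs false
open CategoryTheory

/-- Input for the explicit resolution. -/
structure RD {G V : Type} [Group G] [AddCommGroup V] (ρ : Representation ℤ G V) where
  DA : V →ₗ[ℤ] V
  NA : V →ₗ[ℤ] V
  DB : V →ₗ[ℤ] V
  NB : V →ₗ[ℤ] V
  ε : V →ₗ[ℤ] ℤ
  hDA : ∀ g v, DA (ρ g v) = ρ g (DA v)
  hNA : ∀ g v, NA (ρ g v) = ρ g (NA v)
  hDB : ∀ g v, DB (ρ g v) = ρ g (DB v)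
  hNB : ∀ g v, NB (ρ g v) = ρ g (NB v)
  hε : ∀ g v, ε (ρ g v) = ε v
  DNA : ∀ v, DA (NA v) = 0
  NDA : ∀ v, NA (DA v) = 0
  DNB : ∀ v, DB (NB v) = 0
  NDB : ∀ v, NB (DB v) = 0
  εA : ∀ v, ε (DA v) = 0
  εB : ∀ v, ε (DB v) = 0
  surj : Function.Surjective ε
  ex0 : ∀ v, ε v = 0 → ∃ x y, DA x + DB y = v
  ex1 : ∀ v w, DA v + DB w = 0 → ∃ x y, NA x = v ∧ NB y = w
  exA : ∀ v, DA v = 0 → ∃ x, NA x = v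
  exB : ∀ v, DB v = 0 → ∃ x, NB x = v
  exA' : ∀ v, NA v = 0 → ∃ x, DA x = v
  exB' : ∀ v, NB v = 0 → ∃ x, DB x = v

lemma rep_ext {k G : Type} [CommRing k] [Group G] {A B : Rep.{0} k G} (f g : A ⟶ B)
    (h : ∀ x, f.hom x = g.hom x) : f = g := by
  apply ConcreteCategory.hom_ext
  exact h

lemma exact_of {k G : Type} [CommRing k] [Group G] (S : ShortComplex (Rep.{0} k G))
    (h : ∀ x, S.g.hom x = 0 → ∃ y, S.f.hom y = x) : S.Exact := by
  apply (forget₂ _ (ModuleCat k)).reflects_exact_of_faithful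
  rw [ShortComplex.moduleCat_exact_iff]
  intro x hx
  exact h x hx

namespace RD
variable {G V : Type} [Group G] [AddCommGroup V] {ρ : Representation ℤ G V} (R : RD ρ)

/-- Terms. -/
noncomputable def X (_ : RD ρ) : ℕ → Rep.{0} ℤ G
  | 0 => Rep.of ρ
  | _ + 1 => Rep.of (ρ.prod ρ)

/-- First differential. -/
noncomputable def d0 : Rep.of (ρ.prod ρ) ⟶ Rep.of ρ :=
  Rep.ofHom ⟨R.DA.coprod R.DB, by
    intro g; ext v <;> simp [R.hDA, R.hDB]⟩

/-- Norm differential. -/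
noncomputable def dN : Rep.of (ρ.prod ρ) ⟶ Rep.of (ρ.prod ρ) :=
  Rep.ofHom ⟨R.NA.prodMap R.NB, by
    intro g; ext v <;> simp [R.hNA, R.hNB]⟩

/-- Difference differential. -/
noncomputable def dD : Rep.of (ρ.prod ρ) ⟶ Rep.of (ρ.prod ρ) :=
  Rep.ofHom ⟨R.DA.prodMap R.DB, by
    intro g; ext v <;> simp [R.hDA, R.hDB]⟩

/-- Augmentation. -/
noncomputable def aug : Rep.of ρ ⟶ Rep.trivial ℤ G ℤ :=
  Rep.ofHom ⟨R.ε, by intro g; ext v; simp [R.hε]⟩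

/-- Differentials. -/
noncomputable def d : ∀ n, R.X (n + 1) ⟶ R.X n
  | 0 => R.d0
  | n + 1 => if Even n then R.dN else R.dD

lemma d0_apply (v w : V) : R.d0.hom (v, w) = R.DA v + R.DB w := by
  simp [d0]
lemma dN_apply (v w : V) : R.dN.hom (v, w) = (R.NA v, R.NB w) := rfl
lemma dD_apply (v w : V) : R.dD.hom (v, w) = (R.DA v, R.DB w) := rfl
lemma aug_apply (v : V) : R.aug.hom v = R.ε v := rfl

lemma N_0 : R.dN ≫ R.d0 = 0 := by
  refine rep_ext _ _ ?_
  rintro ⟨v, w⟩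
  change R.d0.hom (R.dN.hom (v, w)) = 0
  rw [dN_apply, d0_apply, R.DNA, R.DNB, add_zero]

lemma N_D : R.dN ≫ R.dD = 0 := by
  refine rep_ext _ _ ?_
  rintro ⟨v, w⟩
  change R.dD.hom (R.dN.hom (v, w)) = 0
  rw [dN_apply, dD_apply, R.DNA, R.DNB]; rfl

lemma D_N : R.dD ≫ R.dN = 0 := by
  refine rep_ext _ _ ?_
  rintro ⟨v, w⟩
  change R.dN.hom (R.dD.hom (v, w)) = 0
  rw [dD_apply, dN_apply, R.NDA, R.NDB]; rfl

lemma d_d (n : ℕ) : R.d (n + 1) ≫ R.d n = 0 := by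
  match n with
  | 0 => simp [d]; exact R.N_0
  | n + 1 =>
    by_cases h : Even n
    · simp only [d, h, if_true, Nat.even_add_one, not_true_eq_false, if_false]; exact R.D_N
    · simp only [d, h, if_true, Nat.even_add_one, not_false_eq_true, if_false]; exact R.N_D

/-- The complex. -/
noncomputable def cx : ChainComplex (Rep.{0} ℤ G) ℕ := ChainComplex.of R.X R.d R.d_d

lemma cx_d (n : ℕ) : R.cx.d (n + 1) n = R.d n := ChainComplex.of_d _ _ _

lemma zero_aug : R.d0 ≫ R.aug = 0 := by
  refine rep_ext _ _ ?_
  rintro ⟨v, w⟩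
  change R.aug.hom (R.d0.hom (v, w)) = 0
  rw [d0_apply, aug_apply, map_add, R.εA, R.εB, add_zero]

/-- Augmentation as chain map. -/
noncomputable def π : R.cx ⟶ (ChainComplex.single₀ (Rep.{0} ℤ G)).obj (Rep.trivial ℤ G ℤ) :=
  (R.cx.toSingle₀Equiv _).symm ⟨R.aug, by
    rw [cx_d]; exact R.zero_aug⟩

lemma π_zero : R.π.f 0 = R.aug := by
  exact ChainComplex.toSingle₀Equiv_symm_apply_f_zero _ _

lemma exact_succ (n : ℕ) : ∀ x, (R.d n).hom x = 0 → ∃ y, (R.d (n + 1)).hom y = x := by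
  match n with
  | 0 =>
    rintro ⟨v, w⟩ h
    replace h : R.d0.hom (v, w) = 0 := h
    rw [d0_apply] at h
    obtain ⟨x, y, h1, h2⟩ := R.ex1 v w h
    refine ⟨(x, y), ?_⟩
    simp only [d, Even.zero, if_true]
    exact Prod.ext h1 h2
  | n + 1 =>
    by_cases hn : Even n
    · simp only [d, hn, if_true, Nat.even_add_one, not_true_eq_false, if_false]
      rintro ⟨v, w⟩ h
      replace h : (R.NA v, R.NB w) = 0 := h
      obtain ⟨x, hx⟩ := R.exA' v (congrArg Prod.fst h)
      obtain ⟨y, hy⟩ := R.exB' w (congrArg Prod.snd h)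
      exact ⟨(x, y), Prod.ext hx hy⟩
    · simp only [d, hn, if_true, Nat.even_add_one, not_false_eq_true, if_false]
      rintro ⟨v, w⟩ h
      replace h : (R.DA v, R.DB w) = 0 := h
      obtain ⟨x, hx⟩ := R.exA v (congrArg Prod.fst h)
      obtain ⟨y, hy⟩ := R.exB w (congrArg Prod.snd h)
      exact ⟨(x, y), Prod.ext hx hy⟩

lemma quasiIso : QuasiIso R.π where
  quasiIsoAt m := by
    match m with
    | 0 =>
      rw [ChainComplex.quasiIsoAt₀_iff, ShortComplex.quasiIso_iff_of_zeros' _ rfl rfl rfl]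
      constructor
      · apply exact_of
        intro v hv
        have hv' : (R.π.f 0).hom v = 0 := hv
        rw [R.π_zero] at hv'
        obtain ⟨x, y, h⟩ := R.ex0 v hv'
        refine ⟨(x, y), ?_⟩
        change (R.cx.d (0 + 1) 0).hom (x, y) = v
        rw [R.cx_d]
        exact (R.d0_apply x y).trans h
      · rw [Rep.epi_iff_surjective]
        change Function.Surjective (R.π.f 0).hom
        rw [R.π_zero]
        exact R.surj
    | m + 1 =>
      rw [quasiIsoAt_iff_exactAt' (hL := ChainComplex.exactAt_succ_single_obj ..),
          HomologicalComplex.exactAt_iff' _ (m + 2) (m + 1) m (by simp) (by simp)]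
      apply exact_of
      intro x hx
      have hx' : (R.cx.d (m + 1) m).hom x = 0 := hx
      rw [cx_d] at hx'
      obtain ⟨y, hy⟩ := R.exact_succ m x hx'
      refine ⟨y, ?_⟩
      change (R.cx.d (m + 1 + 1) (m + 1)).hom y = x
      rw [cx_d]
      exact hy

lemma projective_prod (h : Projective (Rep.of ρ)) : Projective (Rep.of (ρ.prod ρ)) where
  factors {E B} f e he := by
    let i1 : Rep.of ρ ⟶ Rep.of (ρ.prod ρ) := Rep.ofHom ⟨LinearMap.inl ℤ V V, by intro g; ext v <;> simp⟩
    let i2 : Rep.of ρ ⟶ Rep.of (ρ.prod ρ) := Rep.ofHom ⟨LinearMap.inr ℤ V V, by intro g; ext v <;> simp⟩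
    let p1 : Rep.of (ρ.prod ρ) ⟶ Rep.of ρ := Rep.ofHom ⟨LinearMap.fst ℤ V V, by intro g; ext v <;> simp⟩
    let p2 : Rep.of (ρ.prod ρ) ⟶ Rep.of ρ := Rep.ofHom ⟨LinearMap.snd ℤ V V, by intro g; ext v <;> simp⟩
    refine ⟨p1 ≫ Projective.factorThru (i1 ≫ f) e + p2 ≫ Projective.factorThru (i2 ≫ f) e, ?_⟩
    have hid : p1 ≫ i1 + p2 ≫ i2 = 𝟙 _ := by
      refine rep_ext _ _ ?_
      rintro ⟨v, w⟩
      change (v, (0:V)) + ((0:V), w) = (v, w)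
      simp
    rw [Preadditive.add_comp, Category.assoc, Category.assoc, Projective.factorThru_comp,
      Projective.factorThru_comp, ← Category.assoc, ← Category.assoc, ← Preadditive.add_comp, hid,
      Category.id_comp]

/-- The resolution. -/
noncomputable def res (h : Projective (Rep.of ρ)) : ProjectiveResolution (Rep.trivial ℤ G ℤ) where
  complex := R.cx
  projective n := match n with
    | 0 => h
    | _ + 1 => projective_prod h
  π := R.π
  quasiIso := R.quasiIso

end RD

lemma homology_equiv {k : Type} [CommRing k] (C : CochainComplex (ModuleCat.{0} k) ℕ) (n : ℕ)
    {T : Type} [AddCommGroup T] [Module k T] (L : C.X (n + 1) →ₗ[k] T)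
    (hs : ∀ t, ∃ x, (C.d (n + 1) (n + 2)).hom x = 0 ∧ L x = t)
    (hk : ∀ x, (C.d (n + 1) (n + 2)).hom x = 0 → (L x = 0 ↔ ∃ y, (C.d n (n + 1)).hom y = x)) :
    Nonempty (C.homology (n + 1) ≃ₗ[k] T) := by
  let S := C.sc' n (n + 1) (n + 2)
  have e1 : C.homology (n + 1) ≅ S.homology :=
    ShortComplex.homologyMapIso (C.isoSc' n (n + 1) (n + 2) (by simp) (by simp))
  have e2 : C.homology (n + 1) ≅ S.moduleCatLeftHomologyData.H := e1 ≪≫ S.moduleCatHomologyIso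
  let e3 := e2.toLinearEquiv
  let φ : LinearMap.ker S.g.hom →ₗ[k] T := L ∘ₗ (LinearMap.ker S.g.hom).subtype
  have hφs : Function.Surjective φ := by
    intro t
    obtain ⟨x, hx, hL⟩ := hs t
    exact ⟨⟨x, hx⟩, hL⟩
  have hφk : LinearMap.range S.moduleCatToCycles = LinearMap.ker φ := by
    ext ⟨x, hx⟩
    have := hk x hx
    rw [LinearMap.mem_ker]
    change _ ↔ L x = 0
    rw [this]
    constructor
    · rintro ⟨y, hy⟩
      exact ⟨y, congrArg Subtype.val hy⟩
    · rintro ⟨y, hy⟩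
      exact ⟨y, Subtype.ext hy⟩
  exact ⟨e3.trans ((Submodule.quotEquivOfEq _ _ hφk).trans (φ.quotKerEquivOfSurjective hφs))⟩

section dual
variable {G V : Type} [Group G] [AddCommGroup V] {ρ : Representation ℤ G V} (R : RD ρ)

/-- Invariant functionals. -/
def Inv (ρ : Representation ℤ G V) (h : V →ₗ[ℤ] ℤ) : Prop := ∀ g v, h (ρ g v) = h v

/-- A pair of invariant functionals as a morphism. -/
noncomputable def mkHom (h1 h2 : V →ₗ[ℤ] ℤ) (i1 : Inv ρ h1) (i2 : Inv ρ h2) :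
    Rep.of (ρ.prod ρ) ⟶ Rep.trivial ℤ G ℤ :=
  Rep.ofHom ⟨h1.coprod h2, by
    intro g
    ext v
    · simpa using i1 g v
    · simpa using i2 g v⟩

lemma mkHom_apply (h1 h2 : V →ₗ[ℤ] ℤ) (i1 : Inv ρ h1) (i2 : Inv ρ h2) (v w : V) :
    (mkHom h1 h2 i1 i2).hom (v, w) = h1 v + h2 w := by
  exact LinearMap.coprod_apply _ _ _

/-- First component of a morphism. -/
noncomputable def c1 : (Rep.of (ρ.prod ρ) ⟶ Rep.trivial ℤ G ℤ) →ₗ[ℤ] (V →ₗ[ℤ] ℤ) where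
  toFun f := f.hom.toLinearMap ∘ₗ LinearMap.inl ℤ V V
  map_add' _ _ := rfl
  map_smul' _ _ := rfl

/-- Second component of a morphism. -/
noncomputable def c2 : (Rep.of (ρ.prod ρ) ⟶ Rep.trivial ℤ G ℤ) →ₗ[ℤ] (V →ₗ[ℤ] ℤ) where
  toFun f := f.hom.toLinearMap ∘ₗ LinearMap.inr ℤ V V
  map_add' _ _ := rfl
  map_smul' _ _ := rfl

lemma c1_inv (f : Rep.of (ρ.prod ρ) ⟶ Rep.trivial ℤ G ℤ) : Inv ρ (c1 f) := by
  intro g v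
  have := Rep.hom_comm_apply f g (v, 0)
  simpa [c1] using this

lemma c2_inv (f : Rep.of (ρ.prod ρ) ⟶ Rep.trivial ℤ G ℤ) : Inv ρ (c2 f) := by
  intro g v
  have := Rep.hom_comm_apply f g (0, v)
  simpa [c2] using this

lemma hom_apply (f : Rep.of (ρ.prod ρ) ⟶ Rep.trivial ℤ G ℤ) (v w : V) :
    f.hom (v, w) = c1 f v + c2 f w := by
  have : ((v, w) : V × V) = (v, 0) + (0, w) := by simp
  rw [this, map_add]; rfl

lemma c_ext (f f' : Rep.of (ρ.prod ρ) ⟶ Rep.trivial ℤ G ℤ) (h1 : c1 f = c1 f') (h2 : c2 f = c2 f') :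
    f = f' := by
  refine rep_ext _ _ ?_
  rintro ⟨v, w⟩
  rw [hom_apply, hom_apply, h1, h2]

@[simp] lemma c1_mk (h1 h2 : V →ₗ[ℤ] ℤ) (i1 : Inv ρ h1) (i2 : Inv ρ h2) :
    c1 (mkHom h1 h2 i1 i2) = h1 := by
  ext v
  exact (mkHom_apply h1 h2 i1 i2 v 0).trans (by simp)

@[simp] lemma c2_mk (h1 h2 : V →ₗ[ℤ] ℤ) (i1 : Inv ρ h1) (i2 : Inv ρ h2) :
    c2 (mkHom h1 h2 i1 i2) = h2 := by
  ext v
  exact (mkHom_apply h1 h2 i1 i2 0 v).trans (by simp)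

lemma c1_N (f : Rep.of (ρ.prod ρ) ⟶ Rep.trivial ℤ G ℤ) : c1 (R.dN ≫ f) = c1 f ∘ₗ R.NA := by
  ext v
  change f.hom (R.dN.hom (v, 0)) = c1 f (R.NA v)
  rw [R.dN_apply, hom_apply]; simp
lemma c2_N (f : Rep.of (ρ.prod ρ) ⟶ Rep.trivial ℤ G ℤ) : c2 (R.dN ≫ f) = c2 f ∘ₗ R.NB := by
  ext v
  change f.hom (R.dN.hom (0, v)) = c2 f (R.NB v)
  rw [R.dN_apply, hom_apply]; simp
lemma c1_D (f : Rep.of (ρ.prod ρ) ⟶ Rep.trivial ℤ G ℤ) : c1 (R.dD ≫ f) = c1 f ∘ₗ R.DA := by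
  ext v
  change f.hom (R.dD.hom (v, 0)) = c1 f (R.DA v)
  rw [R.dD_apply, hom_apply]; simp
lemma c2_D (f : Rep.of (ρ.prod ρ) ⟶ Rep.trivial ℤ G ℤ) : c2 (R.dD ≫ f) = c2 f ∘ₗ R.DB := by
  ext v
  change f.hom (R.dD.hom (0, v)) = c2 f (R.DB v)
  rw [R.dD_apply, hom_apply]; simp

/-- The Hom complex. -/
noncomputable abbrev HC : CochainComplex (ModuleCat.{0} ℤ) ℕ :=
  R.cx.linearYonedaObj ℤ (Rep.trivial ℤ G ℤ)

lemma HC_d_even (m : ℕ) (hm : Even m) (f : Rep.of (ρ.prod ρ) ⟶ Rep.trivial ℤ G ℤ) :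
    ((HC R).d (m + 1) (m + 2)).hom f = R.dN ≫ f := by
  change R.cx.d (m + 1 + 1) (m + 1) ≫ f = _
  rw [R.cx_d]
  simp only [RD.d, hm, if_true]
  rfl

lemma HC_d_odd (m : ℕ) (hm : ¬ Even m) (f : Rep.of (ρ.prod ρ) ⟶ Rep.trivial ℤ G ℤ) :
    ((HC R).d (m + 1) (m + 2)).hom f = R.dD ≫ f := by
  change R.cx.d (m + 1 + 1) (m + 1) ≫ f = _
  rw [R.cx_d]
  simp only [RD.d, hm, if_false]
  rfl

theorem cohom_even (hP : Projective (Rep.of ρ)) {TA TB : Type} [AddCommGroup TA] [AddCommGroup TB]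
    (LA : (V →ₗ[ℤ] ℤ) →+ TA) (LB : (V →ₗ[ℤ] ℤ) →+ TB)
    (hsA : ∀ t, ∃ h, Inv ρ h ∧ h ∘ₗ R.DA = 0 ∧ LA h = t)
    (hsB : ∀ t, ∃ h, Inv ρ h ∧ h ∘ₗ R.DB = 0 ∧ LB h = t)
    (hkA : ∀ h, Inv ρ h → h ∘ₗ R.DA = 0 → (LA h = 0 ↔ ∃ h', Inv ρ h' ∧ h' ∘ₗ R.NA = h))
    (hkB : ∀ h, Inv ρ h → h ∘ₗ R.DB = 0 → (LB h = 0 ↔ ∃ h', Inv ρ h' ∧ h' ∘ₗ R.NB = h))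
    (j : ℕ) :
    Nonempty (groupCohomology (Rep.trivial ℤ G ℤ) (2 * j + 1 + 1) ≃+ (TA × TB)) := by
  have e := (groupCohomologyIso (Rep.trivial ℤ G ℤ) (2 * j + 1 + 1) (R.res hP)).toLinearEquiv
  let L : (Rep.of (ρ.prod ρ) ⟶ Rep.trivial ℤ G ℤ) →ₗ[ℤ] (TA × TB) :=
    ((LA.comp c1.toAddMonoidHom).prod (LB.comp c2.toAddMonoidHom)).toIntLinearMap
  have he : Even (2 * j) := even_two_mul j
  have ho : ¬ Even (2 * j + 1) := by simp
  refine (homology_equiv (HC R) (2 * j + 1) (T := TA × TB) L ?_ ?_).elim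
    fun e' => ⟨(e.trans e').toAddEquiv⟩
  · rintro ⟨t, t'⟩
    obtain ⟨h, i1, h1, h2⟩ := hsA t
    obtain ⟨h', i1', h1', h2'⟩ := hsB t'
    refine ⟨mkHom h h' i1 i1', ?_, ?_⟩
    · refine (HC_d_odd R (2 * j + 1) ho _).trans ?_
      apply c_ext
      · rw [c1_D, c1_mk, h1]; rfl
      · rw [c2_D, c2_mk, h1']; rfl
    · change (LA (c1 _), LB (c2 _)) = _
      rw [c1_mk, c2_mk, h2, h2']
  · intro (f : Rep.of (ρ.prod ρ) ⟶ Rep.trivial ℤ G ℤ) hf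
    replace hf := (HC_d_odd R (2 * j + 1) ho f).symm.trans hf
    have f1 : c1 f ∘ₗ R.DA = 0 := by rw [← c1_D, hf]; rfl
    have f2 : c2 f ∘ₗ R.DB = 0 := by rw [← c2_D, hf]; rfl
    change (LA (c1 f), LB (c2 f)) = 0 ↔ _
    rw [Prod.mk_eq_zero, hkA _ (c1_inv f) f1, hkB _ (c2_inv f) f2]
    constructor
    · rintro ⟨⟨h, i, e1⟩, ⟨h', i', e2⟩⟩
      refine ⟨mkHom h h' i i', (HC_d_even R (2 * j) he _).trans ?_⟩
      apply c_ext
      · rw [c1_N, c1_mk, e1]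
      · rw [c2_N, c2_mk, e2]
    · rintro ⟨y, hy⟩
      have hy' := (HC_d_even R (2 * j) he y).symm.trans hy
      refine ⟨⟨c1 y, c1_inv y, ?_⟩, ⟨c2 y, c2_inv y, ?_⟩⟩
      · exact (c1_N R y).symm.trans (congrArg c1 hy')
      · exact (c2_N R y).symm.trans (congrArg c2 hy')

theorem cohom_odd (hP : Projective (Rep.of ρ))
    (hkA : ∀ h, Inv ρ h → h ∘ₗ R.NA = 0 → ∃ h', Inv ρ h' ∧ h' ∘ₗ R.DA = h)
    (hkB : ∀ h, Inv ρ h → h ∘ₗ R.NB = 0 → ∃ h', Inv ρ h' ∧ h' ∘ₗ R.DB = h)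
    (j : ℕ) :
    Subsingleton (groupCohomology (Rep.trivial ℤ G ℤ) (2 * j + 2 + 1)) := by
  have e := (groupCohomologyIso (Rep.trivial ℤ G ℤ) (2 * j + 2 + 1) (R.res hP)).toLinearEquiv
  have he : Even (2 * j + 2) := by simp [parity_simps]
  have ho : ¬ Even (2 * j + 1) := by simp
  refine (homology_equiv (HC R) (2 * j + 2) (T := PUnit.{1}) 0 ?_ ?_).elim
    fun e' => (e.trans e').toEquiv.subsingleton
  · intro t
    exact ⟨0, map_zero _, rfl⟩
  · intro (f : Rep.of (ρ.prod ρ) ⟶ Rep.trivial ℤ G ℤ) hf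
    replace hf := (HC_d_even R (2 * j + 2) he f).symm.trans hf
    have f1 : c1 f ∘ₗ R.NA = 0 := by rw [← c1_N, hf]; rfl
    have f2 : c2 f ∘ₗ R.NB = 0 := by rw [← c2_N, hf]; rfl
    obtain ⟨h, i, e1⟩ := hkA _ (c1_inv f) f1
    obtain ⟨h', i', e2⟩ := hkB _ (c2_inv f) f2
    refine ⟨fun _ => ⟨mkHom h h' i i', (HC_d_odd R (2 * j + 1) ho _).trans ?_⟩, fun _ => rfl⟩
    apply c_ext
    · rw [c1_D, c1_mk, e1]
    · rw [c2_D, c2_mk, e2]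
end dual

/-- The permutation representation on `k[X]`. -/
noncomputable def PR (k G X : Type) [CommRing k] [Group G] [MulAction G X] :
    Representation k G (X →₀ k) where
  toFun g := Finsupp.lmapDomain k k (g • ·)
  map_one' := by ext x : 2; simp
  map_mul' g h := by ext x : 2; simp [mul_smul]

@[simp] lemma PR_single {k G X : Type} [CommRing k] [Group G] [MulAction G X] (g : G) (x : X) (r : k) :
    PR k G X g (Finsupp.single x r) = Finsupp.single (g • x) r := by
  simp [PR]

open Finset in
lemma cov_lemma {G X : Type} [Group G] [MulAction G X] (q : ℕ) (a : Equiv.Perm X)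
    (ha : ∀ (g : G) x, a (g • x) = g • a x) (g : G) (v : X →₀ ℤ) :
    TX a (PR ℤ G X g v) = PR ℤ G X g (TX a v) ∧
    NX q a (PR ℤ G X g v) =
      PR ℤ G X g (NX q a v) := by
  have h1 : ∀ v, TX a (PR ℤ G X g v) =
      PR ℤ G X g (TX a v) := by
    intro v
    induction v using Finsupp.induction_linear with
    | zero => simp
    | add u v hu hv => simp only [map_add, hu, hv]
    | single x r => simp [ha]
  have h2 : ∀ j v, (TX a ^ j) (PR ℤ G X g v) =
      PR ℤ G X g ((TX a ^ j) v) := by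
    intro j
    induction j with
    | zero => intro v; simp
    | succ n ih => intro v; rw [pow_succ, Module.End.mul_apply, Module.End.mul_apply, h1, ih]
  refine ⟨h1 v, ?_⟩
  simp only [NX, LinearMap.sum_apply, map_sum, h2]

lemma free_projective {k G X : Type} [CommRing k] [Group G] [MulAction G X] (free : ∀ (g : G) (x : X), g • x = x → g = 1) :
    Projective (Rep.of (PR k G X)) := by
  constructor
  intro E' E f e he
  have hes : Function.Surjective e.hom := (Rep.epi_iff_surjective e).1 he
  choose l hl using fun x : X => hes (f.hom (Finsupp.single x (1 : k)))
  let s : X → X := fun x => (Quotient.mk (MulAction.orbitRel G X) x).out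
  have hs : ∀ (g : G) x, s (g • x) = s x := by
    intro g x
    have : Quotient.mk (MulAction.orbitRel G X) (g • x) = Quotient.mk (MulAction.orbitRel G X) x :=
      Quotient.sound ⟨g, rfl⟩
    simp only [s, this]
  have hγ : ∀ x, ∃ g : G, g • s x = x := by
    intro x
    have h1 : (MulAction.orbitRel G X).r (s x) x := Quotient.mk_out (s := MulAction.orbitRel G X) x
    obtain ⟨g, hg⟩ := (MulAction.orbitRel G X).symm h1
    exact ⟨g, hg⟩
  choose γ hγ using hγ
  have hγm : ∀ (g : G) x, γ (g • x) = g * γ x := by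
    intro g x
    have h1 := hγ (g • x)
    rw [hs] at h1
    have h2 : (g * γ x)⁻¹ • (γ (g • x) • s x) = s x := by
      rw [h1, mul_inv_rev, mul_smul, inv_smul_smul, inv_smul_eq_iff, hγ]
    rw [smul_smul] at h2
    exact (inv_mul_eq_one.1 (free _ _ h2)).symm
  let F : (X →₀ k) →ₗ[k] E'.V := Finsupp.lsum k fun x =>
    LinearMap.toSpanSingleton k E'.V (E'.ρ (γ x) (l (s x)))
  have hF : ∀ x r, F (Finsupp.single x r) = r • (E'.ρ (γ x) (l (s x))) := by
    intro x r; simp [F]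
  have hFi : ∀ g, F ∘ₗ (PR k G X) g = E'.ρ g ∘ₗ F := by
    intro g
    ext x
    simp [hF, hγm, hs]
  refine ⟨Rep.ofHom ⟨F, hFi⟩, ?_⟩
  refine rep_ext _ _ ?_
  intro v
  change e.hom (F v) = f.hom v
  induction v using Finsupp.induction_linear with
  | zero => simp
  | add u v hu hv => rw [map_add, map_add, hu, hv]; exact (map_add f.hom u v).symm
  | single x r =>
    rw [hF]
    have h1 := Rep.hom_comm_apply e (γ x) (l (s x))
    have h2 := Rep.hom_comm_apply f (γ x) (Finsupp.single (s x) (1 : k))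
    have h3 : (PR k G X (γ x)) (Finsupp.single (s x) (1 : k)) = Finsupp.single x 1 := by
      rw [PR_single, hγ]
    have h4 : Finsupp.single x r = r • Finsupp.single x (1 : k) := by simp
    have h5 : f.hom (r • Finsupp.single x (1 : k)) = r • f.hom (Finsupp.single x (1 : k)) :=
      map_smul f.hom _ _
    rw [map_smul, h4, h5]
    congr 1
    refine h1.trans ?_
    rw [hl]
    refine h2.symm.trans ?_
    exact congrArg f.hom h3

section funct
variable {G X Y : Type} [Group G] [MulAction G X] (pr : X → Y)

/-- The functional on `ℤ[X]` given by a function on the quotient. -/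
noncomputable def FY (f : Y → ℤ) : (X →₀ ℤ) →ₗ[ℤ] ℤ := Finsupp.linearCombination ℤ (f ∘ pr)

@[simp] lemma FY_single (f : Y → ℤ) (x : X) (r : ℤ) :
    FY pr f (Finsupp.single x r) = r * f (pr x) := by simp [FY]

lemma FY_inv (hpr : ∀ (g : G) x, pr (g • x) = pr x) (f : Y → ℤ) : Inv (PR ℤ G X) (FY pr f) := by
  intro g v
  induction v using Finsupp.induction_linear with
  | zero => simp
  | add u v hu hv => simp only [map_add, hu, hv]
  | single x r => simp [hpr]

lemma inv_eq_FY (sec : Y → X) (hfib : ∀ x, ∃ g : G, g • sec (pr x) = x)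
    (h : (X →₀ ℤ) →ₗ[ℤ] ℤ) (hi : Inv (PR ℤ G X) h) :
    h = FY pr (fun y => h (Finsupp.single (sec y) 1)) := by
  ext x
  obtain ⟨g, hg⟩ := hfib x
  have := hi g (Finsupp.single (sec (pr x)) 1)
  rw [PR_single, hg] at this
  simp [this]

variable (a : Equiv.Perm X) (σ : Equiv.Perm Y) (hσ : ∀ x, pr (a x) = σ (pr x))
include hσ

lemma pr_pow (j : ℕ) (x : X) : pr ((a ^ j) x) = (σ ^ j) (pr x) := by
  induction j with
  | zero => simp
  | succ n ih => rw [pow_succ', pow_succ', Equiv.Perm.mul_apply, Equiv.Perm.mul_apply, hσ, ih]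

lemma FY_D (f : Y → ℤ) : FY pr f ∘ₗ (TX a - 1) = FY pr (fun y => f (σ y) - f y) := by
  ext x
  simp [hσ]

lemma FY_N (q : ℕ) (f : Y → ℤ) :
    FY pr f ∘ₗ NX q a = FY pr (fun y => ∑ j ∈ range q, f ((σ ^ j) y)) := by
  ext x
  simp [NX, pr_pow pr a σ hσ]
omit hσ

lemma FY_inj (hsurj : Function.Surjective pr) (f g : Y → ℤ) (h : FY pr f = FY pr g) : f = g := by
  funext y
  obtain ⟨x, rfl⟩ := hsurj y
  have := congrArg (fun h => h (Finsupp.single x 1)) h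
  simpa using this

/-- Reduction modulo `q` at the fixed points. -/
noncomputable def LL (q : ℕ) (σ : Equiv.Perm Y) (sec : Y → X) :
    ((X →₀ ℤ) →ₗ[ℤ] ℤ) →+ ({y // σ y = y} → ZMod q) where
  toFun h := fun y => ((h (Finsupp.single (sec y) 1) : ℤ) : ZMod q)
  map_zero' := by ext; simp
  map_add' _ _ := by ext; simp

variable (sec : Y → X) (hsec : ∀ y, pr (sec y) = y) (hpr : ∀ (g : G) x, pr (g • x) = pr x)
  (hfib : ∀ x, ∃ g : G, g • sec (pr x) = x) (q : ℕ) (hq : q.Prime) (hσq : σ ^ q = 1)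

include hσ hsec hpr

lemma LL_surj (t : {y // σ y = y} → ZMod q) :
    ∃ h, Inv (PR ℤ G X) h ∧ h ∘ₗ (TX a - 1) = 0 ∧ LL q σ sec h = t := by
  classical
  refine ⟨FY pr (fun y => if hy : σ y = y then ((t ⟨y, hy⟩).cast : ℤ) else 0), FY_inv pr hpr _, ?_, ?_⟩
  · rw [FY_D pr a σ hσ]
    ext x
    simp only [LinearMap.comp_apply, Finsupp.lsingle_apply, FY_single, LinearMap.zero_apply]
    by_cases hy : σ (pr x) = pr x
    · simp [hy]
    · simp [hy]
  · funext y
    obtain ⟨y, hy⟩ := y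
    simp [LL, hsec, hy]

include hfib hq hσq

lemma LL_ker (h : (X →₀ ℤ) →ₗ[ℤ] ℤ) (hi : Inv (PR ℤ G X) h) (hD : h ∘ₗ (TX a - 1) = 0) :
    LL q σ sec h = 0 ↔ ∃ h', Inv (PR ℤ G X) h' ∧ h' ∘ₗ NX q a = h := by
  have hsurj : Function.Surjective pr := fun y => ⟨sec y, hsec y⟩
  have h0 := inv_eq_FY pr sec hfib h hi
  set f : Y → ℤ := fun y => h (Finsupp.single (sec y) 1) with hf
  rw [h0, FY_D pr a σ hσ] at hD
  have hz : FY pr (fun _ => 0) = 0 := by ext x; simp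
  have hD' : ∀ y, f (σ y) = f y := by
    have := FY_inj pr hsurj _ _ (hD.trans hz.symm)
    intro y
    have := congrFun this y
    simpa [sub_eq_zero] using this
  constructor
  · intro hL
    obtain ⟨g, hg⟩ := fn_exact1 q hq σ hσq f hD' (by
      intro y hy
      have := congrFun hL ⟨y, hy⟩
      exact (ZMod.intCast_zmod_eq_zero_iff_dvd _ q).1 this)
    refine ⟨FY pr g, FY_inv pr hpr g, ?_⟩
    rw [FY_N pr a σ hσ, h0]
    congr 1
    funext y
    exact hg y
  · rintro ⟨h', hi', e⟩
    rw [inv_eq_FY pr sec hfib h' hi', FY_N pr a σ hσ, h0] at e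
    have := FY_inj pr hsurj _ _ e
    funext y
    obtain ⟨y, hy⟩ := y
    change ((f y : ℤ) : ZMod q) = 0
    rw [← congrFun this y]
    simp [pow_fix σ y hy]

lemma LL_odd (h : (X →₀ ℤ) →ₗ[ℤ] ℤ) (hi : Inv (PR ℤ G X) h) (hN : h ∘ₗ NX q a = 0) :
    ∃ h', Inv (PR ℤ G X) h' ∧ h' ∘ₗ (TX a - 1) = h := by
  have hsurj : Function.Surjective pr := fun y => ⟨sec y, hsec y⟩
  have h0 := inv_eq_FY pr sec hfib h hi
  set f : Y → ℤ := fun y => h (Finsupp.single (sec y) 1) with hf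
  rw [h0, FY_N pr a σ hσ] at hN
  have hz : FY pr (fun _ => 0) = 0 := by ext x; simp
  have := FY_inj pr hsurj _ _ (hN.trans hz.symm)
  obtain ⟨g, hg⟩ := fn_exact2 q hq σ hσq f (fun y => congrFun this y)
  refine ⟨FY pr g, FY_inv pr hpr g, ?_⟩
  rw [FY_D pr a σ hσ, h0]
  congr 1
  funext y
  exact hg y
end funct

theorem main_abs {G X Y : Type} [Group G] [MulAction G X] [Nonempty X]
    (free : ∀ (g : G) (x : X), g • x = x → g = 1)
    (a b : Equiv.Perm X) (ha2 : a ^ 2 = 1) (hb3 : b ^ 3 = 1)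
    (haf : ∀ x, a x ≠ x) (hbf : ∀ x, b x ≠ x)
    (ha : ∀ (g : G) x, a (g • x) = g • a x) (hb : ∀ (g : G) x, b (g • x) = g • b x)
    (ex0 : ∀ u : X →₀ ℤ, Finsupp.linearCombination ℤ (fun _ => (1 : ℤ)) u = 0 →
      ∃ x y, (TX a - 1) x + (TX b - 1) y = u)
    (ex1 : ∀ v w : X →₀ ℤ, (TX a - 1) v + (TX b - 1) w = 0 →
      ∃ x y, NX 2 a x = v ∧ NX 3 b y = w)
    (pr : X → Y) (hsurj : Function.Surjective pr)
    (hfib : ∀ x x', pr x = pr x' ↔ ∃ g : G, g • x = x')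
    (σ τ : Equiv.Perm Y) (hσ : ∀ x, pr (a x) = σ (pr x)) (hτ : ∀ x, pr (b x) = τ (pr x)) (j : ℕ) :
    Nonempty (groupCohomology (Rep.trivial ℤ G ℤ) (2 * j + 1 + 1) ≃+
      (({y // σ y = y} → ZMod 2) × ({y // τ y = y} → ZMod 3))) ∧
    Subsingleton (groupCohomology (Rep.trivial ℤ G ℤ) (2 * j + 2 + 1)) := by
  have hpr : ∀ (g : G) x, pr (g • x) = pr x := fun g x => ((hfib x (g • x)).2 ⟨g, rfl⟩).symm
  choose sec hsec using hsurj
  have hfib' : ∀ x, ∃ g : G, g • sec (pr x) = x := fun x => (hfib _ _).1 (hsec (pr x))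
  have hσ2 : σ ^ 2 = 1 := by
    ext y
    have := pr_pow pr a σ hσ 2 (sec y)
    rw [ha2, hsec] at this
    rw [← this]; simp [hsec]
  have hτ3 : τ ^ 3 = 1 := by
    ext y
    have := pr_pow pr b τ hτ 3 (sec y)
    rw [hb3, hsec] at this
    rw [← this]; simp [hsec]
  have hDinv : ∀ (c : Equiv.Perm X), (∀ (g : G) x, c (g • x) = g • c x) → ∀ g v,
      (TX c - 1) (PR ℤ G X g v) = PR ℤ G X g ((TX c - 1) v) := by
    intro c hc g v
    simp [(cov_lemma 0 c hc g v).1]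
  have hε : ∀ (c : Equiv.Perm X) v,
      Finsupp.linearCombination ℤ (fun _ => (1 : ℤ)) ((TX c - 1) v) = 0 := by
    intro c v
    induction v using Finsupp.induction_linear with
    | zero => simp
    | add u v hu hv => simp only [map_add, hu, hv, add_zero]
    | single x r => simp
  let R : RD (PR ℤ G X) :=
    { DA := TX a - 1
      NA := NX 2 a
      DB := TX b - 1
      NB := NX 3 b
      ε := Finsupp.linearCombination ℤ (fun _ => (1 : ℤ))
      hDA := hDinv a ha
      hNA := fun g v => (cov_lemma 2 a ha g v).2
      hDB := hDinv b hb
      hNB := fun g v => (cov_lemma 3 b hb g v).2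
      hε := by
        intro g v
        induction v using Finsupp.induction_linear with
        | zero => simp
        | add u v hu hv => simp only [map_add, hu, hv]
        | single x r => simp
      DNA := fun v => LinearMap.congr_fun (diff_norm 2 (TX a) (TX_pow 2 a ha2)) v
      NDA := fun v => LinearMap.congr_fun (norm_diff 2 (TX a) (TX_pow 2 a ha2)) v
      DNB := fun v => LinearMap.congr_fun (diff_norm 3 (TX b) (TX_pow 3 b hb3)) v
      NDB := fun v => LinearMap.congr_fun (norm_diff 3 (TX b) (TX_pow 3 b hb3)) v
      εA := hε a
      εB := hε b
      surj := fun n => ⟨Finsupp.single (Classical.arbitrary X) n, by simp⟩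
      ex0 := ex0
      ex1 := ex1
      exA := fin_exact1 2 Nat.prime_two a ha2 haf
      exB := fin_exact1 3 Nat.prime_three b hb3 hbf
      exA' := fin_exact2 2 Nat.prime_two a ha2 haf
      exB' := fin_exact2 3 Nat.prime_three b hb3 hbf }
  have hP : Projective (Rep.of (PR ℤ G X)) := free_projective free
  constructor
  · exact cohom_even R hP (LL 2 σ sec) (LL 3 τ sec)
      (LL_surj pr a σ hσ sec hsec hpr 2)
      (LL_surj pr b τ hτ sec hsec hpr 3)
      (LL_ker pr a σ hσ sec hsec hpr hfib' 2 Nat.prime_two hσ2)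
      (LL_ker pr b τ hτ sec hsec hpr hfib' 3 Nat.prime_three hτ3) j
  · exact cohom_odd R hP
      (LL_odd pr a σ hσ sec hsec hpr hfib' 2 Nat.prime_two hσ2)
      (LL_odd pr b τ hτ sec hsec hpr hfib' 3 Nat.prime_three hτ3) j
section abstractGroup
variable {K : Type} [Group K] (s u : K) (hgen : Subgroup.closure {s, u} = ⊤)

include hgen in
lemma abs_ex0 (v : K →₀ ℤ) (hv : Finsupp.linearCombination ℤ (fun _ => (1 : ℤ)) v = 0) :
    ∃ x y, (TX (Equiv.mulRight s) - 1) x + (TX (Equiv.mulRight u) - 1) y = v := by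
  let M : Submodule ℤ (K →₀ ℤ) :=
    LinearMap.range (TX (Equiv.mulRight s) - 1) ⊔ LinearMap.range (TX (Equiv.mulRight u) - 1)
  have key : ∀ h : K, ∀ k : K, Finsupp.single (k * h) (1 : ℤ) - Finsupp.single k 1 ∈ M := by
    intro h
    have hh : h ∈ Subgroup.closure {s, u} := hgen ▸ Subgroup.mem_top h
    induction hh using Subgroup.closure_induction with
    | mem x hx =>
      intro k
      rcases hx with rfl | rfl
      · exact Submodule.mem_sup_left ⟨Finsupp.single k 1, by simp⟩
      · exact Submodule.mem_sup_right ⟨Finsupp.single k 1, by simp⟩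
    | one => intro k; simp
    | mul x y _ _ hx hy =>
      intro k
      have := M.add_mem (hy (k * x)) (hx k)
      rw [← mul_assoc]
      simpa using this
    | inv x _ hx =>
      intro k
      have := M.neg_mem (hx (k * x⁻¹))
      simpa using this
  have key2 : ∀ v : K →₀ ℤ,
      v - Finsupp.single 1 (Finsupp.linearCombination ℤ (fun _ => (1 : ℤ)) v) ∈ M := by
    intro v
    induction v using Finsupp.induction_linear with
    | zero => simp
    | add u v hu hv =>
      have := M.add_mem hu hv
      rw [map_add, Finsupp.single_add, add_sub_add_comm]
      exact this
    | single x r =>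
      have := M.smul_mem r (key x 1)
      simpa [smul_sub] using this
  have := key2 v
  rw [hv, Finsupp.single_zero, sub_zero] at this
  obtain ⟨p, ⟨x, hx⟩, q, ⟨y, hy⟩, h⟩ := Submodule.mem_sup.1 this
  exact ⟨x, y, by rw [hx, hy, h]⟩

/-- Translation permutation of `K × Q`. -/
def shear {Q : Type} [AddCommGroup Q] (s : K) (c : K → Q) : Equiv.Perm (K × Q) where
  toFun z := (z.1 * s, z.2 + c z.1)
  invFun z := (z.1 * s⁻¹, z.2 - c (z.1 * s⁻¹))
  left_inv z := by simp
  right_inv z := by simp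

include hgen in
lemma abs_ex1 (hs : s ^ 2 = 1) (hu : u ^ 3 = 1)
    (huniv : ∀ (P : Type) [Group P] (x y : P), x ^ 2 = 1 → y ^ 3 = 1 →
      ∃ Φ : K →* P, Φ s = x ∧ Φ u = y)
    (v w : K →₀ ℤ)
    (h : (TX (Equiv.mulRight s) - 1) v + (TX (Equiv.mulRight u) - 1) w = 0) :
    ∃ x y, NX 2 (Equiv.mulRight s) x = v ∧ NX 3 (Equiv.mulRight u) y = w := by
  let N : Submodule ℤ ((K →₀ ℤ) × (K →₀ ℤ)) :=
    (LinearMap.range (NX 2 (Equiv.mulRight s))).prod (LinearMap.range (NX 3 (Equiv.mulRight u)))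
  let Q := ((K →₀ ℤ) × (K →₀ ℤ)) ⧸ N
  let cs : K → Q := fun k => N.mkQ (Finsupp.single k 1, 0)
  let cu : K → Q := fun k => N.mkQ (0, Finsupp.single k 1)
  let A := shear s cs
  let B := shear u cu
  have hA : A ^ 2 = 1 := by
    ext1 ⟨k, q⟩
    have e1 : cs k + cs (k * s) = 0 := by
      simp only [cs, ← map_add]
      rw [Submodule.mkQ_apply, Submodule.Quotient.mk_eq_zero]
      refine ⟨⟨Finsupp.single k 1, ?_⟩, ⟨0, by simp⟩⟩
      simp [NX, Finset.sum_range_succ]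
    have e2 : s * s = 1 := by rw [← pow_two, hs]
    simp only [pow_two, Equiv.Perm.mul_apply, A, shear, Equiv.coe_fn_mk, Equiv.Perm.one_apply,
      mul_assoc, e2, mul_one, add_assoc, e1, add_zero]
  have hB : B ^ 3 = 1 := by
    ext1 ⟨k, q⟩
    have e1 : cu k + (cu (k * u) + cu (k * (u * u))) = 0 := by
      simp only [cu, ← map_add]
      rw [Submodule.mkQ_apply, Submodule.Quotient.mk_eq_zero]
      refine ⟨⟨0, by simp⟩, ⟨Finsupp.single k 1, ?_⟩⟩
      simp [NX, Finset.sum_range_succ, pow_two, add_assoc, mul_assoc]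
    have e2 : u * (u * u) = 1 := by rw [← hu, pow_succ', pow_two]
    simp only [pow_succ, pow_zero, one_mul, Equiv.Perm.mul_apply, B, shear, Equiv.coe_fn_mk,
      Equiv.Perm.one_apply, mul_assoc, e2, mul_one, add_assoc, e1, add_zero]
  obtain ⟨Φ, hΦs, hΦu⟩ := huniv (Equiv.Perm (K × Q)) A⁻¹ B⁻¹ (by rw [inv_pow, hA, inv_one])
    (by rw [inv_pow, hB, inv_one])
  have hΦs' : Φ s⁻¹ = A := by rw [map_inv, hΦs, inv_inv]
  have hΦu' : Φ u⁻¹ = B := by rw [map_inv, hΦu, inv_inv]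
  have fst : ∀ h : K, ∀ z, (Φ h⁻¹ z).1 = z.1 * h := by
    intro h
    have hh : h ∈ Subgroup.closure {s, u} := hgen ▸ Subgroup.mem_top h
    induction hh using Subgroup.closure_induction with
    | mem x hx =>
      intro z
      rcases hx with rfl | rfl
      · rw [hΦs']; rfl
      · rw [hΦu']; rfl
    | one => intro z; simp
    | mul x y _ _ hx hy =>
      intro z
      rw [mul_inv_rev, map_mul, Equiv.Perm.mul_apply, hy, hx, mul_assoc]
    | inv x _ hx =>
      intro z
      have := hx (Φ x z)
      have e0 : Φ x⁻¹ (Φ x z) = z := by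
        rw [← Equiv.Perm.mul_apply, ← map_mul, inv_mul_cancel, map_one, Equiv.Perm.one_apply]
      rw [e0] at this
      rw [inv_inv, this, mul_inv_cancel_right]
  let D : K → Q := fun k => (Φ k⁻¹ (1, 0)).2
  have hpair : ∀ k, Φ k⁻¹ (1, 0) = (k, D k) := by
    intro k
    refine Prod.ext ?_ rfl
    rw [fst]; simp
  have hDs : ∀ k, D (k * s) = D k + cs k := by
    intro k
    have : Φ (k * s)⁻¹ (1, 0) = A (k, D k) := by
      rw [mul_inv_rev, map_mul, Equiv.Perm.mul_apply, hΦs', hpair]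
    exact congrArg Prod.snd this
  have hDu : ∀ k, D (k * u) = D k + cu k := by
    intro k
    have : Φ (k * u)⁻¹ (1, 0) = B (k, D k) := by
      rw [mul_inv_rev, map_mul, Equiv.Perm.mul_apply, hΦu', hpair]
    exact congrArg Prod.snd this
  let L : (K →₀ ℤ) →ₗ[ℤ] Q := Finsupp.linearCombination ℤ D
  have hL1 : L ∘ₗ (TX (Equiv.mulRight s) - 1) = N.mkQ ∘ₗ LinearMap.inl ℤ _ _ := by
    ext k
    simp [L, hDs, cs]
  have hL2 : L ∘ₗ (TX (Equiv.mulRight u) - 1) = N.mkQ ∘ₗ LinearMap.inr ℤ _ _ := by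
    ext k
    simp [L, hDu, cu]
  have h1 := LinearMap.congr_fun hL1 v
  have h2 := LinearMap.congr_fun hL2 w
  have h3 := congrArg L h
  rw [map_add, map_zero] at h3
  simp only [LinearMap.comp_apply] at h1 h2
  rw [h1, h2, ← map_add] at h3
  simp only [LinearMap.inl_apply, LinearMap.inr_apply, Prod.mk_add_mk, add_zero, zero_add] at h3
  rw [Submodule.mkQ_apply, Submodule.Quotient.mk_eq_zero] at h3
  obtain ⟨⟨x, hx⟩, ⟨y, hy⟩⟩ := h3
  exact ⟨x, y, hx, hy⟩
end abstractGroup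

open scoped MatrixGroups
section PSL

/-- The subgroup `{1,-1}` of `SL(2, ℤ)`. -/
def ZZ : Subgroup SL(2, ℤ) where
  carrier := {g | g = 1 ∨ g = -1}
  mul_mem' := by
    rintro a b (rfl | rfl) (rfl | rfl) <;> simp
  one_mem' := Or.inl rfl
  inv_mem' := by
    rintro a (rfl | rfl)
    · simp
    · right
      rw [inv_eq_iff_mul_eq_one]; simp

lemma mem_ZZ (g : SL(2, ℤ)) : g ∈ ZZ ↔ g = 1 ∨ g = -1 := Iff.rfl

instance : ZZ.Normal where
  conj_mem := by
    rintro n (rfl | rfl) g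
    · left; simp
    · right; simp

/-- `PSL₂(ℤ)`. -/
abbrev KK := SL(2, ℤ) ⧸ ZZ

lemma mk_eq (g h : SL(2, ℤ)) : (g : KK) = (h : KK) ↔ h = g ∨ h = -g := by
  rw [QuotientGroup.eq, mem_ZZ, inv_mul_eq_iff_eq_mul, inv_mul_eq_iff_eq_mul]
  simp

/-- Order three element. -/
def UU : SL(2, ℤ) := ⟨!![0, -1; 1, -1], by simp [Matrix.det_fin_two]⟩

lemma coe_UU : (UU : Matrix (Fin 2) (Fin 2) ℤ) = !![0, -1; 1, -1] := rfl

/-- Class of `S`. -/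
def sK : KK := ((ModularGroup.S : SL(2, ℤ)) : KK)
/-- Class of `U`. -/
def uK : KK := ((UU : SL(2, ℤ)) : KK)

lemma sK_sq : sK ^ 2 = 1 := by
  change (((ModularGroup.S ^ 2 : SL(2, ℤ))) : KK) = ((1 : SL(2, ℤ)) : KK)
  rw [mk_eq]
  right
  ext i j; fin_cases i <;> fin_cases j <;> simp [ModularGroup.coe_S, pow_two]

lemma uK_cube : uK ^ 3 = 1 := by
  change (((UU ^ 3 : SL(2, ℤ))) : KK) = ((1 : SL(2, ℤ)) : KK)
  rw [mk_eq]
  left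
  ext i j; fin_cases i <;> fin_cases j <;> simp [coe_UU, pow_succ]

lemma sK_ne : sK ≠ 1 := by
  intro h
  rcases (mk_eq ModularGroup.S 1).1 h with h | h
  · have := congrArg (fun g : SL(2, ℤ) => g 0 0) h
    simp [ModularGroup.coe_S] at this
  · have := congrArg (fun g : SL(2, ℤ) => g 0 0) h
    simp [ModularGroup.coe_S] at this

lemma uK_ne : uK ≠ 1 := by
  intro h
  rcases (mk_eq UU 1).1 h with h | h
  · have := congrArg (fun g : SL(2, ℤ) => g 0 0) h
    simp [coe_UU] at this
  · have := congrArg (fun g : SL(2, ℤ) => g 0 0) h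
    simp [coe_UU] at this

lemma KK_gen : Subgroup.closure {sK, uK} = (⊤ : Subgroup KK) := by
  have hs : sK ∈ Subgroup.closure {sK, uK} := Subgroup.subset_closure (by simp)
  have hu : uK ∈ Subgroup.closure {sK, uK} := Subgroup.subset_closure (by simp)
  have hT : ((ModularGroup.T : SL(2, ℤ)) : KK) = (sK * uK)⁻¹ := by
    change _ = (((ModularGroup.S * UU)⁻¹ : SL(2, ℤ)) : KK)
    rw [mk_eq]
    right
    rw [inv_eq_iff_mul_eq_one]
    ext i j; fin_cases i <;> fin_cases j <;> simp [ModularGroup.coe_S, coe_UU, ModularGroup.coe_T]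
  have h1 : (⊤ : Subgroup SL(2, ℤ)) ≤
      (Subgroup.closure {sK, uK}).comap (QuotientGroup.mk' ZZ) := by
    rw [← SpecialLinearGroup.SL2Z_generators, Subgroup.closure_le]
    rintro x (rfl | rfl)
    · exact hs
    · change ((ModularGroup.T : SL(2, ℤ)) : KK) ∈ Subgroup.closure {sK, uK}
      rw [hT]
      exact inv_mem (mul_mem hs hu)
  rw [eq_top_iff]
  intro k _
  induction k using QuotientGroup.induction_on with
  | H g => exact h1 (Subgroup.mem_top g)

/-- A homomorphism out of a cyclic group. -/
def cyc {P : Type} [Group P] (n : ℕ) (x : P) (hx : x ^ n = 1) : Multiplicative (ZMod n) →* P :=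
  AddMonoidHom.toMultiplicativeLeft (ZMod.lift n ⟨zmultiplesHom (Additive P) (Additive.ofMul x), by
    simp [← ofMul_pow, hx]⟩)

lemma cyc_one {P : Type} [Group P] (n : ℕ) (x : P) (hx : x ^ n = 1) :
    cyc n x hx (Multiplicative.ofAdd 1) = x := by
  have := ZMod.lift_coe n (⟨zmultiplesHom (Additive P) (Additive.ofMul x), by
    simp [← ofMul_pow, hx]⟩ : {f : ℤ →+ Additive P // f n = 0}) 1
  simp only [Int.cast_one] at this
  simp [cyc, this]

/-- Orders. -/
def ords (b : Bool) : ℕ := if b then 2 else 3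

/-- Generators. -/
def gens {P : Type} (x y : P) (b : Bool) : P := if b then x else y

lemma gens_pow {P : Type} [Group P] (x y : P) (hx : x ^ 2 = 1) (hy : y ^ 3 = 1) (b : Bool) :
    gens x y b ^ ords b = 1 := by
  cases b
  · exact hy
  · exact hx

/-- The map from the free product. -/
noncomputable def FP {P : Type} [Group P] (x y : P) (hx : x ^ 2 = 1) (hy : y ^ 3 = 1) :
    Monoid.CoprodI (fun b : Bool => Multiplicative (ZMod (ords b))) →* P :=
  Monoid.CoprodI.lift fun b => cyc (ords b) (gens x y b) (gens_pow x y hx hy b)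

/-- Ping-pong sets. -/
def pps (b : Bool) : Set KK :=
  if b then {k | ∃ g : SL(2, ℤ), (g : KK) = k ∧ g 0 0 * g 1 0 < 0}
  else {k | ∃ g : SL(2, ℤ), (g : KK) = k ∧ 0 < g 0 0 * g 1 0}

open scoped Pointwise in
lemma FP_inj : Function.Injective (FP sK uK sK_sq uK_cube) := by
  refine Monoid.CoprodI.lift_injective_of_ping_pong (α := KK) _ ?_ pps ?_ ?_ ?_
  · right
    refine ⟨false, ?_⟩
    change 3 ≤ Cardinal.mk (ZMod 3)
    simp [ZMod]
  · intro b
    cases b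
    · exact ⟨_, ⟨⟨!![1, 0; 1, 1], by simp [Matrix.det_fin_two]⟩, rfl, by simp⟩⟩
    · exact ⟨_, ⟨⟨!![1, 0; -1, 1], by simp [Matrix.det_fin_two]⟩, rfl, by simp⟩⟩
  · have : Disjoint (pps true) (pps false) := by
      rw [Set.disjoint_left]
      rintro k ⟨g, rfl, hg⟩ ⟨h, e, hh⟩
      rw [mk_eq] at e
      rcases e with rfl | rfl
      · exact lt_asymm hg hh
      · simp at hg
        linarith
    intro b c hbc
    cases b <;> cases c
    · exact absurd rfl hbc
    · exact this.symm
    · exact this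
    · exact absurd rfl hbc
  · intro b c hbc h hh
    cases b <;> cases c
    · exact absurd rfl hbc
    · rintro _ ⟨_, ⟨g, rfl, hg⟩, rfl⟩
      have hc : h = Multiplicative.ofAdd 1 ∨
          h = Multiplicative.ofAdd 1 * Multiplicative.ofAdd 1 := by
        revert hh h
        change ∀ h : ZMod 3, h ≠ 0 → h = 1 ∨ h = 1 + 1
        decide
      rcases hc with rfl | rfl
      · rw [cyc_one]
        refine ⟨UU * g, rfl, ?_⟩
        simp [Matrix.mul_apply, coe_UU]
        nlinarith [sq_nonneg (g 1 0)]
      · rw [map_mul, cyc_one]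
        refine ⟨UU * UU * g, rfl, ?_⟩
        simp [Matrix.mul_apply, coe_UU]
        nlinarith [sq_nonneg (g 0 0)]
    · rintro _ ⟨_, ⟨g, rfl, hg⟩, rfl⟩
      have hc : h = Multiplicative.ofAdd 1 := by
        revert hh h
        change ∀ h : ZMod 2, h ≠ 0 → h = 1
        decide
      subst hc
      rw [cyc_one]
      refine ⟨ModularGroup.S * g, rfl, ?_⟩
      simp [Matrix.mul_apply, ModularGroup.coe_S]
      nlinarith
    · exact absurd rfl hbc

lemma FP_surj : Function.Surjective (FP sK uK sK_sq uK_cube) := by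
  rw [← MonoidHom.range_eq_top, eq_top_iff, ← KK_gen, Subgroup.closure_le]
  rintro x (rfl | rfl)
  · refine ⟨Monoid.CoprodI.of (i := true) (Multiplicative.ofAdd 1), ?_⟩
    rw [FP, Monoid.CoprodI.lift_of]
    exact cyc_one _ _ _
  · refine ⟨Monoid.CoprodI.of (i := false) (Multiplicative.ofAdd 1), ?_⟩
    rw [FP, Monoid.CoprodI.lift_of]
    exact cyc_one _ _ _

lemma KK_univ (P : Type) [Group P] (x y : P) (hx : x ^ 2 = 1) (hy : y ^ 3 = 1) :
    ∃ Φ : KK →* P, Φ sK = x ∧ Φ uK = y := by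
  obtain ⟨e, he⟩ : ∃ e : Monoid.CoprodI (fun b : Bool => Multiplicative (ZMod (ords b))) ≃* KK,
      ∀ x, e x = FP sK uK sK_sq uK_cube x :=
    ⟨MulEquiv.ofBijective (FP sK uK sK_sq uK_cube) ⟨FP_inj, FP_surj⟩, fun _ => rfl⟩
  have h : ∀ b, FP sK uK sK_sq uK_cube (Monoid.CoprodI.of (M := fun b : Bool => Multiplicative (ZMod (ords b)))
      (i := b) (Multiplicative.ofAdd (1 : ZMod (ords b)))) = gens sK uK b := by
    intro b
    rw [FP, Monoid.CoprodI.lift_of]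
    exact cyc_one _ _ _
  have h' : ∀ b, (FP x y hx hy) (e.symm (gens sK uK b)) = gens x y b := by
    intro b
    rw [(e.symm_apply_eq).2 ((he _).trans (h b)).symm, FP, Monoid.CoprodI.lift_of]
    exact cyc_one _ _ _
  exact ⟨(FP x y hx hy).comp e.symm.toMonoidHom, h' true, h' false⟩
end PSL
section line
variable {p : ℕ} [Fact p.Prime]

/-- Point of the projective line. -/
noncomputable def pt (c d : ZMod p) : Option (ZMod p) := if d = 0 then none else some (c / d)

lemma pt_eq (c d c' d' : ZMod p) (h : c ≠ 0 ∨ d ≠ 0) (h' : c' ≠ 0 ∨ d' ≠ 0) :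
    pt c d = pt c' d' ↔ c * d' = c' * d := by
  unfold pt
  by_cases hd : d = 0 <;> by_cases he : d' = 0
  · simp [hd, he]
  · have : c ≠ 0 := by tauto
    simp [hd, he, this]
  · have : c' ≠ 0 := by tauto
    simp [hd, he, this]
  · simp only [hd, he, if_false, Option.some.injEq]
    rw [div_eq_div_iff hd he]

/-- The involution `t ↦ -1/t`. -/
noncomputable def sg : Equiv.Perm (Option (ZMod p)) where
  toFun y := match y with
    | none => some 0
    | some t => if t = 0 then none else some (-t⁻¹)
  invFun y := match y with
    | none => some 0
    | some t => if t = 0 then none else some (-t⁻¹)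
  left_inv y := by
    rcases y with _ | t
    · simp
    · by_cases h : t = 0 <;> simp [h]
  right_inv y := by
    rcases y with _ | t
    · simp
    · by_cases h : t = 0 <;> simp [h]

/-- The order three map `t ↦ -1/(t+1)`. -/
noncomputable def ta : Equiv.Perm (Option (ZMod p)) where
  toFun y := match y with
    | none => some 0
    | some t => if t + 1 = 0 then none else some (-(t + 1)⁻¹)
  invFun y := match y with
    | none => some (-1)
    | some t => if t = 0 then none else some (-t⁻¹ - 1)
  left_inv y := by
    rcases y with _ | t
    · simp
    · by_cases h : t + 1 = 0
      · simp [eq_neg_of_add_eq_zero_left h]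
      · simp [h]
  right_inv y := by
    rcases y with _ | t
    · simp
    · by_cases h : t = 0 <;> simp [h]

lemma sg_pt (c d : ZMod p) (h : c ≠ 0 ∨ d ≠ 0) : pt d (-c) = sg (pt c d) := by
  unfold pt sg
  by_cases hd : d = 0
  · have : c ≠ 0 := by tauto
    simp [hd, this]
  · by_cases hc : c = 0
    · simp [hd, hc]
    · simp [hd, hc, div_neg]

lemma ta_pt (c d : ZMod p) (h : c ≠ 0 ∨ d ≠ 0) : pt d (-c - d) = ta (pt c d) := by
  unfold pt ta
  by_cases hd : d = 0
  · have : c ≠ 0 := by tauto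
    simp [hd, this]
  · have e : c / d + 1 = (c + d) / d := by field_simp
    have e' : -c - d = -(c + d) := by ring
    by_cases hc : c + d = 0
    · simp [hd, hc, e, e']
    · simp [hd, hc, e, e', div_neg, -neg_add_rev]

lemma sg_fix (y : Option (ZMod p)) : sg y = y ↔ ∃ t, y = some t ∧ t ^ 2 = -1 := by
  rcases y with _ | t
  · simp [sg]
  · by_cases h : t = 0
    · subst h; simp [sg]
    · simp only [sg, Equiv.coe_fn_mk, h, if_false, Option.some.injEq, exists_eq_left']
      constructor
      · intro e
        have : t * t = t * (-t⁻¹) := by rw [e]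
        rw [pow_two, this]; field_simp
      · intro e
        have : t * (-t⁻¹) = t * t := by rw [← pow_two, e]; field_simp
        exact mul_left_cancel₀ h this

lemma ta_fix (y : Option (ZMod p)) : ta y = y ↔ ∃ t, y = some t ∧ t ^ 2 + t + 1 = 0 := by
  rcases y with _ | t
  · simp [ta]
  · by_cases h : t + 1 = 0
    · simp only [ta, Equiv.coe_fn_mk, h, if_true, Option.some.injEq, exists_eq_left', reduceCtorEq, false_iff]
      rw [eq_neg_of_add_eq_zero_left h]; simp
    · simp only [ta, Equiv.coe_fn_mk, h, if_false, Option.some.injEq, exists_eq_left']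
      constructor
      · intro e
        have : (t + 1) * t = (t + 1) * (-(t + 1)⁻¹) := by rw [e]
        have h2 : (t + 1) * (-(t + 1)⁻¹) = -1 := by field_simp
        rw [h2] at this
        linear_combination this
      · intro e
        have h2 : (t + 1) * (-(t + 1)⁻¹) = -1 := by field_simp
        have : (t + 1) * (-(t + 1)⁻¹) = (t + 1) * t := by rw [h2]; linear_combination -e
        exact mul_left_cancel₀ h this

/-- Functions on a two-element subtype. -/
noncomputable def twoEquiv {Y A : Type} [AddCommGroup A] (P : Y → Prop) (y0 y1 : Y) (hne : y0 ≠ y1)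
    (h : ∀ y, P y ↔ y = y0 ∨ y = y1) : ({y // P y} → A) ≃+ A × A := by
  classical
  exact
  { toFun := fun f => (f ⟨y0, (h y0).2 (Or.inl rfl)⟩, f ⟨y1, (h y1).2 (Or.inr rfl)⟩)
    invFun := fun z y => if y.1 = y0 then z.1 else z.2
    left_inv := by
      intro f
      funext ⟨y, hy⟩
      rcases (h y).1 hy with rfl | rfl
      · simp
      · simp [hne.symm]
    right_inv := by
      intro z
      simp [hne.symm]
    map_add' := fun f g => rfl }

lemma two_ne (hp3 : 3 < p) : (2 : ZMod p) ≠ 0 := by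
  intro h
  have : ((2 : ℕ) : ZMod p) = 0 := by exact_mod_cast h
  rw [ZMod.natCast_eq_zero_iff] at this
  have := Nat.le_of_dvd (by norm_num) this
  omega

lemma three_ne (hp3 : 3 < p) : (3 : ZMod p) ≠ 0 := by
  intro h
  have : ((3 : ℕ) : ZMod p) = 0 := by exact_mod_cast h
  rw [ZMod.natCast_eq_zero_iff] at this
  have := Nat.le_of_dvd (by norm_num) this
  omega

lemma sg_two (hp3 : 3 < p) (h4 : p % 4 = 1) :
    Nonempty (({y : Option (ZMod p) // sg y = y} → ZMod 2) ≃+ ZMod 2 × ZMod 2) := by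
  obtain ⟨i, hi⟩ := (ZMod.exists_sq_eq_neg_one_iff (p := p)).2 (by omega)
  have hi0 : i ≠ 0 := by rintro rfl; simp at hi
  refine ⟨twoEquiv _ (some i) (some (-i)) ?_ ?_⟩
  · intro h
    have h1 : (2 : ZMod p) * i = 0 := by
      linear_combination Option.some.inj h
    rcases mul_eq_zero.1 h1 with h1 | h1
    · exact two_ne hp3 h1
    · exact hi0 h1
  · intro y
    rw [sg_fix]
    constructor
    · rintro ⟨t, rfl, ht⟩
      have : (t - i) * (t + i) = 0 := by linear_combination ht + hi
      rcases mul_eq_zero.1 this with h | h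
      · left; rw [sub_eq_zero.1 h]
      · right; rw [eq_neg_of_add_eq_zero_left h]
    · rintro (rfl | rfl)
      · exact ⟨i, rfl, by rw [pow_two, hi]⟩
      · exact ⟨-i, rfl, by rw [neg_sq, pow_two, hi]⟩

lemma sg_zero (h4 : p % 4 = 3) : IsEmpty {y : Option (ZMod p) // sg y = y} := by
  refine ⟨fun ⟨y, hy⟩ => ?_⟩
  obtain ⟨t, -, ht⟩ := (sg_fix y).1 hy
  exact (ZMod.exists_sq_eq_neg_one_iff (p := p)).1 ⟨t, by rw [← ht, pow_two]⟩ h4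

lemma ta_two (hp3 : 3 < p) (h4 : p % 3 = 1) :
    Nonempty (({y : Option (ZMod p) // ta y = y} → ZMod 3) ≃+ ZMod 3 × ZMod 3) := by
  have : Fact (Nat.Prime 3) := ⟨Nat.prime_three⟩
  obtain ⟨w, hw⟩ := exists_prime_orderOf_dvd_card (G := (ZMod p)ˣ) 3 (by
    rw [ZMod.card_units p]; omega)
  have hw3 : (w : ZMod p) ^ 3 = 1 := by
    rw [← Units.val_pow_eq_pow_val, ← hw, pow_orderOf_eq_one, Units.val_one]
  have hw1 : (w : ZMod p) ≠ 1 := by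
    intro h
    rw [Units.val_eq_one.1 h, orderOf_one] at hw
    omega
  set i : ZMod p := (w : ZMod p)
  have hi : i ^ 2 + i + 1 = 0 := by
    have : (i - 1) * (i ^ 2 + i + 1) = 0 := by linear_combination hw3
    rcases mul_eq_zero.1 this with h | h
    · exact absurd (sub_eq_zero.1 h) hw1
    · exact h
  refine ⟨twoEquiv _ (some i) (some (-1 - i)) ?_ ?_⟩
  · intro h
    have h1 := Option.some.inj h
    apply three_ne hp3
    linear_combination 4 * hi - (2 * i + 1) * h1
  · intro y
    rw [ta_fix]
    constructor
    · rintro ⟨t, rfl, ht⟩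
      have : (t - i) * (t + 1 + i) = 0 := by linear_combination ht - hi
      rcases mul_eq_zero.1 this with h | h
      · left; rw [sub_eq_zero.1 h]
      · right; congr 1; linear_combination h
    · rintro (rfl | rfl)
      · exact ⟨i, rfl, hi⟩
      · exact ⟨-1 - i, rfl, by linear_combination hi⟩

lemma ta_zero (hp3 : 3 < p) (h4 : p % 3 = 2) : IsEmpty {y : Option (ZMod p) // ta y = y} := by
  have : Fact (Nat.Prime 3) := ⟨Nat.prime_three⟩
  refine ⟨fun ⟨y, hy⟩ => ?_⟩
  obtain ⟨t, -, ht⟩ := (ta_fix y).1 hy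
  have h3 : t ^ 3 = 1 := by linear_combination (t - 1) * ht
  have h1 : t ≠ 1 := by
    rintro rfl
    apply three_ne hp3
    linear_combination ht
  have h0 : t ≠ 0 := by rintro rfl; simp at ht
  have ho : orderOf t = 3 := orderOf_eq_prime h3 h1
  have := ZMod.orderOf_dvd_card_sub_one h0
  rw [ho] at this
  omega
end line
section final
variable (p : ℕ) [hpf : Fact p.Prime]

/-- Map to `PSL₂(ℤ)`. -/
def phi (p : ℕ) : PGamma0 p →* KK :=
  QuotientGroup.map (pmOne p) ZZ (CongruenceSubgroup.Gamma0 p).subtype (by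
    rw [pmOne, Subgroup.zpowers_le]
    exact Or.inr rfl)

lemma phi_mk (p : ℕ) (g : CongruenceSubgroup.Gamma0 p) :
    phi p (g : PGamma0 p) = ((g : SL(2, ℤ)) : KK) := rfl

lemma phi_inj (p : ℕ) (x : PGamma0 p) (h : phi p x = 1) : x = 1 := by
  induction x using QuotientGroup.induction_on with
  | H g =>
    rw [phi_mk, QuotientGroup.eq_one_iff, mem_ZZ] at h
    rw [QuotientGroup.eq_one_iff]
    rcases h with h | h
    · have : g = 1 := Subtype.ext h
      rw [this]; exact one_mem _
    · have : g = negIGamma0 p := Subtype.ext h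
      rw [this]; exact Subgroup.mem_zpowers _

/-- Action on `PSL₂(ℤ)`. -/
abbrev act (p : ℕ) : MulAction (PGamma0 p) KK := MulAction.compHom KK (phi p)

/-- Point of a matrix. -/
noncomputable def ptM (g : SL(2, ℤ)) : Option (ZMod p) := pt ((g 1 0 : ℤ) : ZMod p) ((g 1 1 : ℤ) : ZMod p)

lemma row_ne (g : SL(2, ℤ)) : ((g 1 0 : ℤ) : ZMod p) ≠ 0 ∨ ((g 1 1 : ℤ) : ZMod p) ≠ 0 := by
  by_contra! h
  have h1 := g.det_coe
  rw [Matrix.det_fin_two] at h1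
  have h2 := congrArg (Int.cast : ℤ → ZMod p) h1
  push_cast at h2
  rw [h.1, h.2] at h2
  simp at h2

lemma ptM_eq (g h : SL(2, ℤ)) : ptM p g = ptM p h ↔ h * g⁻¹ ∈ CongruenceSubgroup.Gamma0 p := by
  rw [ptM, ptM, pt_eq _ _ _ _ (row_ne p g) (row_ne p h), CongruenceSubgroup.Gamma0_mem]
  rw [Matrix.SpecialLinearGroup.coe_mul, Matrix.SpecialLinearGroup.coe_inv, Matrix.adjugate_fin_two, Matrix.mul_apply]
  simp only [Fin.sum_univ_two, Matrix.of_apply, Matrix.cons_val', Matrix.cons_val_zero, Matrix.cons_val_one,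
    Matrix.cons_val_fin_one, Int.cast_add, Int.cast_mul, Int.cast_neg]
  constructor
  · intro e; linear_combination -e
  · intro e; linear_combination -e

/-- Projection to the projective line. -/
noncomputable def prK : KK → Option (ZMod p) := Quotient.lift (ptM p) (by
  intro g h hgh
  have := (mk_eq g h).1 (Quotient.sound hgh)
  rw [ptM_eq, CongruenceSubgroup.Gamma0_mem]
  rcases this with rfl | rfl
  · simp
  · simp)

lemma prK_mk (g : SL(2, ℤ)) : prK p (g : KK) = ptM p g := rfl

theorem cohom (j : ℕ) :
    Nonempty (groupCohomology (Rep.trivial ℤ (PGamma0 p) ℤ) (2 * j + 1 + 1) ≃+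
      (({y : Option (ZMod p) // sg y = y} → ZMod 2) × ({y : Option (ZMod p) // ta y = y} → ZMod 3))) ∧
    Subsingleton (groupCohomology (Rep.trivial ℤ (PGamma0 p) ℤ) (2 * j + 2 + 1)) := by
  let _ := act p
  have hsm : ∀ (g : PGamma0 p) (k : KK), g • k = phi p g * k := fun _ _ => rfl
  refine main_abs (X := KK) ?_ (Equiv.mulRight sK) (Equiv.mulRight uK) ?_ ?_ ?_ ?_ ?_ ?_
    (abs_ex0 sK uK KK_gen) (abs_ex1 sK uK KK_gen sK_sq uK_cube KK_univ) (prK p) ?_ ?_ sg ta ?_ ?_ j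
  · intro g x h
    rw [hsm] at h
    exact phi_inj p g (mul_eq_right.1 h)
  · ext1 x
    simp [pow_two]
    rw [mul_assoc, ← pow_two, sK_sq, mul_one]
  · ext1 x
    have : x * uK * uK * uK = x := by
      rw [mul_assoc, mul_assoc, ← pow_two, ← pow_succ', uK_cube, mul_one]
    simpa [pow_succ, mul_assoc] using this
  · intro x h
    exact sK_ne (mul_eq_left.1 h)
  · intro x h
    exact uK_ne (mul_eq_left.1 h)
  · intro g x
    exact mul_assoc _ _ _
  · intro g x
    exact mul_assoc _ _ _
  · intro y
    rcases y with _ | t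
    · refine ⟨((ModularGroup.S : SL(2, ℤ)) : KK), ?_⟩
      rw [prK_mk]
      simp [ptM, pt, ModularGroup.coe_S]
    · obtain ⟨n, rfl⟩ := ZMod.intCast_surjective t
      let g : SL(2, ℤ) := ⟨!![1, 0; n, 1], by simp [Matrix.det_fin_two]⟩
      refine ⟨(g : KK), ?_⟩
      rw [prK_mk]
      simp [ptM, pt, g]
  · intro x x'
    induction x using QuotientGroup.induction_on with
    | H g =>
    induction x' using QuotientGroup.induction_on with
    | H h =>
    rw [prK_mk, prK_mk, ptM_eq]
    constructor
    · intro e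
      refine ⟨((⟨h * g⁻¹, e⟩ : CongruenceSubgroup.Gamma0 p) : PGamma0 p), ?_⟩
      rw [hsm, phi_mk]
      change ((h * g⁻¹ * g : SL(2, ℤ)) : KK) = _
      rw [inv_mul_cancel_right]
    · rintro ⟨k, hk⟩
      induction k using QuotientGroup.induction_on with
      | H k =>
      rw [hsm, phi_mk] at hk
      have hk' := (mk_eq (k * g : SL(2, ℤ)) h).1 hk
      rcases hk' with rfl | rfl
      · rw [mul_inv_cancel_right]; exact k.2
      · have := k.2
        rw [neg_mul_eq_neg_mul, mul_inv_cancel_right]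
        rw [CongruenceSubgroup.Gamma0_mem] at this ⊢
        simpa using this
  · intro x
    induction x using QuotientGroup.induction_on with
    | H g =>
    change ptM p (g * ModularGroup.S) = sg (ptM p g)
    rw [ptM, ptM, ← sg_pt _ _ (row_ne p g)]
    simp [Matrix.mul_apply, ModularGroup.coe_S]
  · intro x
    induction x using QuotientGroup.induction_on with
    | H g =>
    change ptM p (g * UU) = ta (ptM p g)
    rw [ptM, ptM, ← ta_pt _ _ (row_ne p g)]
    simp [Matrix.mul_apply, coe_UU, sub_eq_add_neg]

/-- Additive equivalences are linear over the integers. -/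
def toLin {M N : Type} [AddCommGroup M] [AddCommGroup N] [Module ℤ M] [Module ℤ N] (e : M ≃+ N) :
    M ≃ₗ[ℤ] N :=
  { e with
    map_smul' := fun n x => by
      have := map_intCast_smul e ℤ ℤ n x
      simpa using this }

/-- Chinese remainder. -/
noncomputable def crt : (ZMod 2 × ZMod 2) × (ZMod 3 × ZMod 3) ≃+ ZMod 6 × ZMod 6 :=
  (AddEquiv.prodProdProdComm (ZMod 2) (ZMod 2) (ZMod 3) (ZMod 3)).trans
    (AddEquiv.prodCongr
      (ZMod.chineseRemainder (m := 2) (n := 3) (by norm_num)).symm.toAddEquiv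
      (ZMod.chineseRemainder (m := 2) (n := 3) (by norm_num)).symm.toAddEquiv)
end final

end PG

/-- For a prime `p > 3` and any `i ≥ 1`, the integral cohomology of `PΓ₀(p)` in
even degrees `2i` is as computed by Adem–Naffah (depending on `p mod 12`), and it
vanishes in odd degrees `2i+1`. -/
theorem cohomology_PGamma0 (p : ℕ) (hp : p.Prime) (hp3 : 3 < p) (i : ℕ) (hi : 1 ≤ i) :
    (p % 12 = 1 → Nonempty ((groupCohomology (Rep.trivial ℤ (PGamma0 p) ℤ) (2 * i)) ≃ₗ[ℤ]
      (ZMod 6 × ZMod 6))) ∧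
    (p % 12 = 5 → Nonempty ((groupCohomology (Rep.trivial ℤ (PGamma0 p) ℤ) (2 * i)) ≃ₗ[ℤ]
      (ZMod 2 × ZMod 2))) ∧
    (p % 12 = 7 → Nonempty ((groupCohomology (Rep.trivial ℤ (PGamma0 p) ℤ) (2 * i)) ≃ₗ[ℤ]
      (ZMod 3 × ZMod 3))) ∧
    (p % 12 = 11 → Subsingleton (groupCohomology (Rep.trivial ℤ (PGamma0 p) ℤ) (2 * i))) ∧
    Subsingleton (groupCohomology (Rep.trivial ℤ (PGamma0 p) ℤ) (2 * i + 1)) := by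
  have : Fact p.Prime := ⟨hp⟩
  obtain ⟨j, rfl⟩ : ∃ j, i = j + 1 := ⟨i - 1, by omega⟩
  obtain ⟨⟨e⟩, hodd⟩ := PG.cohom p j
  refine ⟨fun h => ?_, fun h => ?_, fun h => ?_, fun h => ?_, hodd⟩
  · obtain ⟨e2⟩ := PG.sg_two (p := p) hp3 (by omega)
    obtain ⟨e3⟩ := PG.ta_two (p := p) hp3 (by omega)
    exact ⟨PG.toLin (e.trans ((AddEquiv.prodCongr e2 e3).trans PG.crt))⟩
  · obtain ⟨e2⟩ := PG.sg_two (p := p) hp3 (by omega)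
    have := PG.ta_zero (p := p) hp3 (by omega)
    exact ⟨PG.toLin (e.trans (AddEquiv.prodUnique.trans e2))⟩
  · have := PG.sg_zero (p := p) (by omega)
    obtain ⟨e3⟩ := PG.ta_two (p := p) hp3 (by omega)
    exact ⟨PG.toLin (e.trans (AddEquiv.uniqueProd.trans e3))⟩
  · have := PG.sg_zero (p := p) (by omega)
    have := PG.ta_zero (p := p) hp3 (by omega)
    exact e.toEquiv.subsingleton
end

section
/- Let p > 3 be a prime. Then for every integer i ≥ 1: H^{2i}(Γ₀(p), ℤ) ≅ ℤ/12 ⊕ ℤ/6 if p ≡ 1 (mod 12), ℤ/4 ⊕ ℤ/2 if p ≡ 5 (mod 12), ℤ/3 ⊕ ℤ/6 if p ≡ 7 (mod 12), and ℤ/2 if p ≡ 11 (mod 12). -/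
namespace G0

section cyc
open MonoidAlgebra

variable {G : Type} [Group G]

/-- The group element `g` as an element of the group ring. -/
noncomputable abbrev el (g : G) : MonoidAlgebra ℤ G := MonoidAlgebra.single g 1

lemma el_mul (g h : G) : el (g * h) = el g * el h := by simp [el]

lemma el_one : el (1 : G) = 1 := rfl

lemma el_pow (g : G) (n : ℕ) : el (g ^ n) = el g ^ n := by simp [el]

/-- The norm element of the cyclic group of order `n` generated by `t`. -/
noncomputable def nrm (t : G) (n : ℕ) : MonoidAlgebra ℤ G := ∑ i ∈ Finset.range n, el (t ^ i)

/-- Chosen coset representative. -/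
noncomputable def rp (t : G) (g : G) : G := ((g : G ⧸ Subgroup.zpowers t)).out

lemma rp_mul (t g : G) : rp t (g * t) = rp t g := by
  unfold rp
  congr 1
  rw [QuotientGroup.eq]
  simp

lemma rp_mul_pow (t g : G) (i : ℕ) : rp t (g * t ^ i) = rp t g := by
  induction i with
  | zero => simp
  | succ n ih => rw [pow_succ, ← mul_assoc, rp_mul, ih]

lemma rp_rp (t g : G) : rp t (rp t g) = rp t g := by
  unfold rp
  simp

lemma rp_spec (t g : G) (n : ℕ) (hn : 0 < n) (ht : orderOf t = n) :
    ∃ i < n, g = rp t g * t ^ i := by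
  classical
  have h : (rp t g)⁻¹ * g ∈ Subgroup.zpowers t := by
    rw [← QuotientGroup.eq]
    unfold rp
    simp
  have hf : IsOfFinOrder t := by rw [← orderOf_pos_iff]; omega
  rw [← hf.mem_powers_iff_mem_zpowers, hf.mem_powers_iff_mem_range_orderOf, ht] at h
  simp only [Finset.mem_image, Finset.mem_range] at h
  obtain ⟨i, hi, h⟩ := h
  exact ⟨i, hi, by rw [h]; simp⟩

lemma coeff_mul_el (a : MonoidAlgebra ℤ G) (t g : G) :
    (a * el t).coeff g = a.coeff (g * t⁻¹) := by
  simp [el]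

lemma coeff_mul_nrm (a : MonoidAlgebra ℤ G) (t g : G) (n : ℕ) :
    (a * nrm t n).coeff g = ∑ i ∈ Finset.range n, a.coeff (g * (t ^ i)⁻¹) := by
  simp only [nrm, Finset.mul_sum, MonoidAlgebra.coeff_sum, Finsupp.finsetSum_apply, coeff_mul_el]

/-- if `c` is supported on representatives then coefficient of `c * N`. -/
lemma coeff_nrm_supp (c : MonoidAlgebra ℤ G) (t : G) (n : ℕ) (hn : 0 < n) (ht : orderOf t = n)
    (hc : ∀ g, rp t g ≠ g → c.coeff g = 0) (g : G) :
    (c * nrm t n).coeff g = c.coeff (rp t g) := by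
  rw [coeff_mul_nrm]
  obtain ⟨i, hi, h⟩ := rp_spec t g n hn ht
  have h2 : ∀ j, rp t (g * (t ^ j)⁻¹) = rp t g := by
    intro j
    have := rp_mul_pow t (g * (t ^ j)⁻¹) j
    rw [← this]; simp
  rw [Finset.sum_eq_single i]
  · congr 1
    rw [mul_inv_eq_iff_eq_mul]; exact h
  · intro j hj hji
    apply hc
    rw [h2]
    intro h3
    apply hji
    rw [eq_mul_inv_iff_mul_eq] at h3
    have h4 : t ^ j = t ^ i := by
      have := h3.trans h
      exact mul_left_cancel this
    have hj' : j < orderOf t := by rw [ht]; exact Finset.mem_range.1 hj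
    exact pow_injOn_Iio_orderOf hj' (by rw [Set.mem_Iio, ht]; exact hi) h4
  · intro h; exact absurd (Finset.mem_range.2 hi) h

lemma cyc1 (a : MonoidAlgebra ℤ G) (t : G) (n : ℕ) (hn : 0 < n) (ht : orderOf t = n)
    (h : a * (el t - 1) = 0) : ∃ c, a = c * nrm t n := by
  classical
  refine ⟨ofCoeff (a.coeff.filter (fun g => rp t g = g)), ?_⟩
  ext g
  rw [coeff_nrm_supp _ t n hn ht]
  · rw [coeff_ofCoeff, Finsupp.filter_apply, if_pos (rp_rp t g)]
    have h1 : ∀ g, a.coeff (g * t) = a.coeff g := by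
      intro g
      have h2 : a * el t = a := by rwa [mul_sub, mul_one, sub_eq_zero] at h
      conv_lhs => rw [← h2]
      rw [coeff_mul_el]; simp
    have h3 : ∀ g (i : ℕ), a.coeff (g * t ^ i) = a.coeff g := by
      intro g i
      induction i with
      | zero => simp
      | succ n ih => rw [pow_succ, ← mul_assoc, h1, ih]
    obtain ⟨i, hi, h⟩ := rp_spec t g n hn ht
    conv_lhs => rw [h]
    rw [h3]
  · intro g hg
    rw [coeff_ofCoeff, Finsupp.filter_apply, if_neg hg]

lemma el_mul_nrm (t : G) (n : ℕ) (ht : orderOf t = n) : el t * nrm t n = nrm t n := by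
  have h : t ^ n = 1 := by rw [← ht]; exact pow_orderOf_eq_one t
  have := Finset.sum_range_succ' (fun i => el (t ^ i)) n
  rw [Finset.sum_range_succ, h, pow_zero] at this
  unfold nrm
  rw [Finset.mul_sum, add_right_cancel this]
  apply Finset.sum_congr rfl
  intro i _
  rw [pow_succ', el_mul]

lemma cyc2 (a : MonoidAlgebra ℤ G) (t : G) (n : ℕ) (hn : 0 < n) (ht : orderOf t = n)
    (h : a * nrm t n = 0) : ∃ c, a = c * (el t - 1) := by
  classical
  have key : ∀ a : MonoidAlgebra ℤ G, ∃ b c : MonoidAlgebra ℤ G, a = b + c * (el t - 1) ∧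
      (∀ g, rp t g ≠ g → b.coeff g = 0) := by
    intro a
    induction a using MonoidAlgebra.induction_linear with
    | zero => exact ⟨0, 0, by simp, by simp⟩
    | add x y hx hy =>
      obtain ⟨b, c, h1, h2⟩ := hx
      obtain ⟨b', c', h1', h2'⟩ := hy
      refine ⟨b + b', c + c', by rw [h1, h1']; noncomm_ring, ?_⟩
      intro g hg
      simp [h2 g hg, h2' g hg]
    | single g r =>
      obtain ⟨i, hi, h⟩ := rp_spec t g n hn ht
      have : ∃ c : MonoidAlgebra ℤ G, el (t ^ i) - 1 = c * (el t - 1) := by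
        refine ⟨∑ j ∈ Finset.range i, el t ^ j, ?_⟩
        rw [geom_sum_mul, el_pow]
      obtain ⟨c, hc⟩ := this
      refine ⟨MonoidAlgebra.single (rp t g) r, MonoidAlgebra.single (rp t g) r * c, ?_, ?_⟩
      · rw [mul_assoc, ← hc, mul_sub, el, MonoidAlgebra.single_mul_single, ← h]
        simp
      · intro g' hg'
        rw [MonoidAlgebra.coeff_single, Finsupp.single_apply, if_neg]
        rintro rfl
        exact hg' (rp_rp t g)
  obtain ⟨b, c, h1, h2⟩ := key a
  refine ⟨c, ?_⟩
  have hb : b * nrm t n = 0 := by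
    have h3 : (el t - 1) * nrm t n = 0 := by rw [sub_mul, el_mul_nrm t n ht, one_mul, sub_self]
    rw [h1, add_mul, mul_assoc, h3, mul_zero, add_zero] at h
    exact h
  have hb0 : b = 0 := by
    ext g
    by_cases hg : rp t g = g
    · have := coeff_nrm_supp b t n hn ht h2 g
      rw [hb, hg] at this
      rw [← this]
    · rw [h2 g hg]; rfl
  rw [h1, hb0, zero_add]

end cyc

section tree
open ModularGroup Matrix MatrixGroups

/-- The element of order six. -/
def U : SL(2, ℤ) := S * T

lemma S_sq : S ^ 2 = (-1 : SL(2, ℤ)) := by decide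
lemma U_cube : U ^ 3 = (-1 : SL(2, ℤ)) := by decide
lemma order_S : orderOf S = 4 := by
  have := orderOf_eq_prime_pow (x := S) (p := 2) (n := 1) (by decide) (by decide)
  simpa using this
lemma order_Z : orderOf (-1 : SL(2, ℤ)) = 2 :=
  orderOf_eq_prime (by decide) (by decide)
lemma order_U : orderOf U = 6 := by
  rw [orderOf_eq_iff (by norm_num)]
  refine ⟨by decide, ?_⟩
  intro m hm hm0
  interval_cases m <;> decide

/-- Sum of absolute values of entries. -/
def ht (g : SL(2, ℤ)) : ℤ := |g 0 0| + |g 0 1| + |g 1 0| + |g 1 1|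

lemma abs_sub_of_mul_nonpos {x y : ℤ} (h : x * y ≤ 0) : |y - x| = |x| + |y| := by
  rcases abs_cases x with ⟨h1, h2⟩ | ⟨h1, h2⟩ <;> rcases abs_cases y with ⟨h3, h4⟩ | ⟨h3, h4⟩ <;>
  rcases abs_cases (y - x) with ⟨h5, h6⟩ | ⟨h5, h6⟩ <;> rw [h1, h3, h5] <;> nlinarith

lemma mulS (g : SL(2, ℤ)) : (g * S) 0 0 = g 0 1 ∧ (g * S) 0 1 = - g 0 0 ∧
    (g * S) 1 0 = g 1 1 ∧ (g * S) 1 1 = - g 1 0 := by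
  have h : (g * S).1 = g.1 * !![0, -1; 1, 0] := rfl
  refine ⟨?_, ?_, ?_, ?_⟩ <;> rw [h] <;> simp [Matrix.mul_apply, Fin.sum_univ_two]

lemma mulU (g : SL(2, ℤ)) : (g * U) 0 0 = g 0 1 ∧ (g * U) 0 1 = g 0 1 - g 0 0 ∧
    (g * U) 1 0 = g 1 1 ∧ (g * U) 1 1 = g 1 1 - g 1 0 := by
  have h : (g * U).1 = g.1 * (!![0, -1; 1, 0] * !![1, 1; 0, 1]) := rfl
  refine ⟨?_, ?_, ?_, ?_⟩ <;> rw [h] <;> simp [Matrix.mul_apply, Fin.sum_univ_two] <;> ring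

lemma tree_aux (w : SL(2, ℤ) →₀ ℤ) (h1 : ∀ g, w g + w (g * S) = 0)
    (h2 : ∀ g, w g + w (g * U) + w (g * U ^ 2) = 0) : w = 0 := by
  by_contra hw
  have hne : w.support.Nonempty := Finsupp.support_nonempty_iff.2 hw
  obtain ⟨g, hg, hmax⟩ := Finset.exists_max_image w.support ht hne
  have hdet : ∀ g : SL(2, ℤ), g 0 0 * g 1 1 - g 0 1 * g 1 0 = 1 := by
    intro g
    have := g.det_coe
    rwa [Matrix.det_fin_two] at this
  have key : ∀ g ∈ w.support, (∀ g' ∈ w.support, ht g' ≤ ht g) → g 0 0 * g 0 1 ≤ 0 →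
      g 1 0 * g 1 1 ≤ 0 → False := by
    intro g hg hmax ha hc
    have hd := hdet g
    have e1 := abs_sub_of_mul_nonpos ha
    have e2 := abs_sub_of_mul_nonpos hc
    obtain ⟨u1, u2, u3, u4⟩ := mulU g
    obtain ⟨v1, v2, v3, v4⟩ := mulU (g * U)
    rw [mul_assoc, ← pow_two] at v1 v2 v3 v4
    rw [u2] at v1
    rw [u1, u2] at v2
    rw [u4] at v3
    rw [u3, u4] at v4
    have p1 : 0 < |g 0 0| + |g 1 0| := by
      by_contra hcon
      have a1 := abs_nonneg (g 0 0)
      have a2 := abs_nonneg (g 1 0)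
      have b1 : g 0 0 = 0 := abs_eq_zero.1 (by linarith)
      have b2 : g 1 0 = 0 := abs_eq_zero.1 (by linarith)
      rw [b1, b2] at hd
      simp at hd
    have p2 : 0 < |g 0 1| + |g 1 1| := by
      by_contra hcon
      have a1 := abs_nonneg (g 0 1)
      have a2 := abs_nonneg (g 1 1)
      have b1 : g 0 1 = 0 := abs_eq_zero.1 (by linarith)
      have b2 : g 1 1 = 0 := abs_eq_zero.1 (by linarith)
      rw [b1, b2] at hd
      simp at hd
    have z1 : w (g * U) = 0 := by
      by_contra hcon
      have := hmax _ (Finsupp.mem_support_iff.2 hcon)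
      unfold ht at this
      rw [u1, u2, u3, u4] at this
      linarith
    have z2 : w (g * U ^ 2) = 0 := by
      by_contra hcon
      have := hmax _ (Finsupp.mem_support_iff.2 hcon)
      unfold ht at this
      rw [v1, v2, v3, v4] at this
      simp only [sub_sub_cancel_left, abs_neg] at this
      linarith
    have := h2 g
    rw [z1, z2] at this
    exact (Finsupp.mem_support_iff.1 hg) (by linarith)
  have hd := hdet g
  obtain ⟨s1, s2, s3, s4⟩ := mulS g
  have hprod : (g 0 0 * g 0 1) * (g 1 0 * g 1 1) = (g 0 1 * g 1 0) * (g 0 1 * g 1 0 + 1) := by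
    linear_combination (g 0 1 * g 1 0) * hd
  have hpos : 0 ≤ (g 0 0 * g 0 1) * (g 1 0 * g 1 1) := by
    rw [hprod]
    rcases le_or_gt 0 (g 0 1 * g 1 0) with h | h
    · positivity
    · nlinarith
  have hcase : (g 0 0 * g 0 1 ≤ 0 ∧ g 1 0 * g 1 1 ≤ 0) ∨
      (0 ≤ g 0 0 * g 0 1 ∧ 0 ≤ g 1 0 * g 1 1) := by
    rcases mul_nonneg_iff.1 hpos with h | h
    · exact Or.inr h
    · exact Or.inl h
  rcases hcase with ⟨ha, hc⟩ | ⟨ha, hc⟩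
  · exact key g hg hmax ha hc
  · refine key (g * S) ?_ ?_ ?_ ?_
    · rw [Finsupp.mem_support_iff] at hg ⊢
      intro h
      have := h1 g
      rw [h] at this
      exact hg (by linarith)
    · intro g' hg'
      have := hmax g' hg'
      unfold ht at this ⊢
      rw [s1, s2, s3, s4, abs_neg, abs_neg]
      linarith
    · rw [s1, s2]; linarith
    · rw [s3, s4]; linarith

lemma gen_induction (P : SL(2, ℤ) → Prop) (h1 : P 1) (hS : ∀ g, P g ↔ P (g * S))
    (hU : ∀ g, P g ↔ P (g * U)) (g : SL(2, ℤ)) : P g := by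
  have hg : g ∈ Subgroup.closure {S, T} := by simp [SpecialLinearGroup.SL2Z_generators]
  have hT : ∀ g, P g ↔ P (g * T) := by
    intro g
    have := hU (g * S⁻¹)
    rw [U, ← mul_assoc, inv_mul_cancel_right] at this
    rw [← this, hS (g * S⁻¹), inv_mul_cancel_right]
  induction hg using Subgroup.closure_induction_right with
  | one => exact h1
  | mul_right x hx y hy ih =>
    rcases hy with rfl | rfl
    · exact (hS _).1 ih
    · exact (hT _).1 ih
  | mul_inv_cancel x hx y hy ih =>
    rcases hy with rfl | rfl
    · rw [hS]; simpa using ih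
    · rw [hT]; simpa using ih

end tree

section exact
open ModularGroup Matrix MatrixGroups MonoidAlgebra

/-- The group ring. -/
abbrev R := MonoidAlgebra ℤ SL(2, ℤ)

/-- `S` in the group ring. -/
noncomputable def s : R := el S
/-- `U` in the group ring. -/
noncomputable def u : R := el U
/-- `-1` in the group ring. -/
noncomputable def z : R := el (-1)

lemma s_sq : s ^ 2 = z := by rw [s, ← el_pow, S_sq, z]
lemma u_cube : u ^ 3 = z := by rw [u, ← el_pow, U_cube, z]
lemma z_sq : z ^ 2 = 1 := by rw [z, ← el_pow, ← el_one]; congr 1; decide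
lemma s_four : s ^ 4 = 1 := by rw [← z_sq, ← s_sq, ← pow_mul]

lemma nrm_S : nrm S 4 = (1 + s) * (1 + z) := by
  simp only [nrm, Finset.sum_range_succ, Finset.sum_range_zero, el_pow, ← s_sq]
  change 0 + s ^ 0 + s ^ 1 + s ^ 2 + s ^ 3 = _
  noncomm_ring

lemma nrm_U : nrm U 6 = (1 + z) * (1 + u + u ^ 2) := by
  simp only [nrm, Finset.sum_range_succ, Finset.sum_range_zero, el_pow, ← u_cube]
  change 0 + u ^ 0 + u ^ 1 + u ^ 2 + u ^ 3 + u ^ 4 + u ^ 5 = _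
  noncomm_ring

lemma nrm_Z : nrm (-1 : SL(2, ℤ)) 2 = 1 + z := by
  simp only [nrm, Finset.sum_range_succ, Finset.sum_range_zero, el_pow]
  change 0 + z ^ 0 + z ^ 1 = _
  noncomm_ring

lemma s_rel : (1 + s) * (s - 1) = z - 1 := by rw [← s_sq]; noncomm_ring
lemma u_rel : (1 + u + u ^ 2) * (u - 1) = z - 1 := by rw [← u_cube]; noncomm_ring
lemma z_rel : (z - 1) * (1 + z) = 0 := by
  have : (z - 1) * (1 + z) = z ^ 2 - 1 := by noncomm_ring
  rw [this, z_sq, sub_self]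
lemma z_rel' : (1 + z) * (z - 1) = 0 := by
  have : (1 + z) * (z - 1) = z ^ 2 - 1 := by noncomm_ring
  rw [this, z_sq, sub_self]
lemma comm_sz : (1 + z) * (1 + s) = (1 + s) * (1 + z) := by rw [← s_sq]; noncomm_ring
lemma comm_sz' : (1 + z) * (s - 1) = (s - 1) * (1 + z) := by rw [← s_sq]; noncomm_ring
lemma s_rel' : (s - 1) * (1 + s) = z - 1 := by rw [← s_sq]; noncomm_ring
lemma un : (u - 1) * nrm U 6 = 0 := by
  rw [sub_mul, u, el_mul_nrm U 6 order_U, one_mul, sub_self]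
lemma nu : nrm U 6 * (u - 1) = 0 := by
  rw [nrm_U, mul_assoc, u_rel, z_rel']

lemma coeff_one_add_z (w : R) (g : SL(2, ℤ)) :
    (w * (1 + z)).coeff g = w.coeff g + w.coeff (-g) := by
  have : ((-1 : SL(2, ℤ)))⁻¹ = -1 := by decide
  rw [mul_add, mul_one, MonoidAlgebra.coeff_add, Finsupp.add_apply, z, coeff_mul_el, this]
  simp

lemma sum_s (a : R) (g : SL(2, ℤ)) : (a * (s - 1) * (1 + z)).coeff g +
    (a * (s - 1) * (1 + z)).coeff (g * S) = 0 := by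
  have h0 : a * (s - 1) * (1 + z) * (1 + s) = 0 := by
    rw [mul_assoc, mul_assoc, comm_sz, ← mul_assoc (s - 1), s_rel', z_rel, mul_zero]
  have h := congrArg (fun x : R => x.coeff (g * S)) h0
  generalize a * (s - 1) * (1 + z) = w at h ⊢
  simp only [mul_add w, mul_one, MonoidAlgebra.coeff_add,
    Finsupp.add_apply, s, MonoidAlgebra.coeff_zero, Finsupp.zero_apply] at h
  rw [coeff_mul_el, mul_inv_cancel_right] at h
  rw [add_comm]
  exact h

lemma sum_u (a : R) (g : SL(2, ℤ)) : (a * (u - 1) * (1 + z)).coeff g +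
    (a * (u - 1) * (1 + z)).coeff (g * U) + (a * (u - 1) * (1 + z)).coeff (g * U ^ 2) = 0 := by
  have h0 : a * (u - 1) * (1 + z) * (1 + u + u ^ 2) = 0 := by
    rw [mul_assoc, ← nrm_U, mul_assoc, un, mul_zero]
  have h := congrArg (fun x : R => x.coeff (g * U ^ 2)) h0
  generalize a * (u - 1) * (1 + z) = w at h ⊢
  simp only [mul_add w, mul_one, MonoidAlgebra.coeff_add,
    Finsupp.add_apply, u, ← el_pow] at h
  rw [coeff_mul_el, coeff_mul_el, mul_inv_cancel_right] at h
  have h3 : g * U ^ 2 * U⁻¹ = g * U := by rw [pow_two]; group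
  rw [h3] at h
  simp only [MonoidAlgebra.coeff_zero, Finsupp.zero_apply] at h
  linarith

lemma exact1 (a b : R) (h : a * (s - 1) + b * (u - 1) = 0) :
    ∃ b' e : R, a = e * (1 + s) ∧ b = b' * nrm U 6 - e * (1 + u + u ^ 2) := by
  have hw : a * (s - 1) = (-b) * (u - 1) := by rw [neg_mul]; exact eq_neg_of_add_eq_zero_left h
  have h0 : a * (s - 1) * (1 + z) = 0 := by
    have := tree_aux (a * (s - 1) * (1 + z)).coeff (sum_s a) (by
      rw [hw]; exact sum_u (-b))
    ext g
    rw [this]; rfl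
  rw [← nrm_Z] at h0
  obtain ⟨e, he⟩ := cyc2 _ _ 2 (by norm_num) order_Z h0
  change _ = e * (z - 1) at he
  have h1 : (a - e * (1 + s)) * (s - 1) = 0 := by
    rw [sub_mul, mul_assoc e, s_rel, he, sub_self]
  obtain ⟨c, hc⟩ := cyc1 _ S 4 (by norm_num) order_S h1
  have ha : a = (e + c * (1 + z)) * (1 + s) := by
    rw [nrm_S, sub_eq_iff_eq_add] at hc
    rw [hc, add_mul e, mul_assoc c, comm_sz, add_comm]
  have he2 : (e + c * (1 + z)) * (z - 1) = e * (z - 1) := by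
    rw [add_mul, mul_assoc c, z_rel', mul_zero, add_zero]
  generalize e + c * (1 + z) = e' at ha he2
  have h2 : (b + e' * (1 + u + u ^ 2)) * (u - 1) = 0 := by
    rw [add_mul, mul_assoc, u_rel, he2, ← he, add_comm]; exact h
  obtain ⟨b', hb⟩ := cyc1 _ U 6 (by norm_num) order_U h2
  exact ⟨b', e', ha, by rw [← hb]; noncomm_ring⟩

lemma exact2 (b e : R) (h1 : e * (1 + s) = 0) (h2 : b * nrm U 6 - e * (1 + u + u ^ 2) = 0) :
    ∃ a b' : R, b = a * (s - 1) + b' * (u - 1) ∧ e = a * (s - 1) * (1 + z) := by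
  have h3 : e * nrm S 4 = 0 := by rw [nrm_S, ← mul_assoc, h1, zero_mul]
  obtain ⟨c, hc⟩ := cyc2 _ S 4 (by norm_num) order_S h3
  change _ = c * (s - 1) at hc
  have h4 : c * (z - 1) = 0 := by rw [← s_rel', ← mul_assoc, ← hc, h1]
  obtain ⟨a, ha⟩ := cyc1 c (-1) 2 (by norm_num) order_Z h4
  rw [nrm_Z] at ha
  have he : e = a * (s - 1) * (1 + z) := by
    rw [hc, ha, mul_assoc, comm_sz', mul_assoc]
  have h5 : (b - a * (s - 1)) * nrm U 6 = 0 := by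
    rw [sub_mul, ← h2, he, nrm_U, sub_right_inj]
    simp only [mul_assoc]
  obtain ⟨b', hb⟩ := cyc2 _ U 6 (by norm_num) order_U h5
  exact ⟨a, b', by rw [sub_eq_iff_eq_add] at hb; rw [hb, add_comm]; rfl, he⟩

/-- The augmentation. -/
noncomputable def aug : R →ₗ[ℤ] ℤ :=
  (Finsupp.linearCombination ℤ (fun _ => (1 : ℤ))) ∘ₗ
        (MonoidAlgebra.coeffLinearEquiv ℤ).toLinearMap

lemma aug_single (g : SL(2, ℤ)) (r : ℤ) : aug (MonoidAlgebra.single g r) = r := by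
  simp [aug]

lemma aug_el_mul (g : SL(2, ℤ)) (x : R) : aug (el g * x) = aug x := by
  induction x using MonoidAlgebra.induction_linear with
  | zero => simp
  | add x y hx hy => rw [mul_add, map_add, hx, hy, map_add]
  | single h r => rw [el, MonoidAlgebra.single_mul_single, aug_single, aug_single, one_mul]

lemma aug_mul_el (g : SL(2, ℤ)) (x : R) : aug (x * el g) = aug x := by
  induction x using MonoidAlgebra.induction_linear with
  | zero => simp
  | add x y hx hy => rw [add_mul, map_add, hx, hy, map_add]
  | single h r => rw [el, MonoidAlgebra.single_mul_single, aug_single, aug_single, mul_one]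

lemma exact0 (x : R) (h : aug x = 0) : ∃ a b : R, x = a * (s - 1) + b * (u - 1) := by
  have h1 : ∀ g : SL(2, ℤ), ∃ a b : R, el g - 1 = a * (s - 1) + b * (u - 1) := by
    intro g
    refine gen_induction (fun g => ∃ a b : R, el g - 1 = a * (s - 1) + b * (u - 1)) ?_ ?_ ?_ g
    · exact ⟨0, 0, by simp [el_one]⟩
    · intro g
      constructor
      · rintro ⟨a, b, h⟩
        refine ⟨a + el g, b, ?_⟩
        rw [el_mul, add_mul, add_right_comm, ← h, s]; noncomm_ring
      · rintro ⟨a, b, h⟩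
        refine ⟨a - el g, b, ?_⟩
        rw [el_mul] at h
        rw [sub_mul, sub_add_eq_add_sub, ← h, s]; noncomm_ring
    · intro g
      constructor
      · rintro ⟨a, b, h⟩
        refine ⟨a, b + el g, ?_⟩
        rw [el_mul, add_mul, ← add_assoc, ← h, u]; noncomm_ring
      · rintro ⟨a, b, h⟩
        refine ⟨a, b - el g, ?_⟩
        rw [el_mul] at h
        rw [sub_mul, ← add_sub_assoc, ← h, u]; noncomm_ring
  have h2 : ∀ x : R, ∃ a b : R, x = a * (s - 1) + b * (u - 1) + MonoidAlgebra.single 1 (aug x) := by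
    intro x
    induction x using MonoidAlgebra.induction_linear with
    | zero => exact ⟨0, 0, by simp⟩
    | add x y hx hy =>
      obtain ⟨a, b, h⟩ := hx
      obtain ⟨a', b', h'⟩ := hy
      refine ⟨a + a', b + b', ?_⟩
      rw [map_add, MonoidAlgebra.single_add]
      nth_rewrite 1 [h, h']
      noncomm_ring
    | single g r =>
      obtain ⟨a, b, h⟩ := h1 g
      refine ⟨r • a, r • b, ?_⟩
      rw [aug_single, smul_mul_assoc, smul_mul_assoc, ← smul_add, ← h, ← el_one, smul_sub]
      simp [el]
  obtain ⟨a, b, hab⟩ := h2 x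
  exact ⟨a, b, by rw [h] at hab; simpa using hab⟩

end exact

section resolution
open CategoryTheory ModularGroup Matrix MatrixGroups MonoidAlgebra

section generic
universe w
variable {k G : Type w} [CommRing k] [Group G]

/-- The left regular representation. -/
noncomputable def rep1 (k G : Type w) [CommRing k] [Group G] :
    Representation k G (MonoidAlgebra k G) where
  toFun g := LinearMap.mulLeft k (MonoidAlgebra.single g 1)
  map_one' := by
    refine LinearMap.ext fun x => ?_
    exact one_mul x
  map_mul' g h := by
    refine LinearMap.ext fun x => ?_
    change MonoidAlgebra.single (g * h) (1 : k) * x =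
      MonoidAlgebra.single g 1 * (MonoidAlgebra.single h 1 * x)
    rw [← mul_assoc, MonoidAlgebra.single_mul_single, one_mul]

/-- Two copies of the left regular representation. -/
noncomputable def rep2 (k G : Type w) [CommRing k] [Group G] :
    Representation k G (MonoidAlgebra k G × MonoidAlgebra k G) where
  toFun g := (rep1 k G g).prodMap (rep1 k G g)
  map_one' := by
    refine LinearMap.ext fun x => ?_
    simp
  map_mul' g h := by
    refine LinearMap.ext fun x => ?_
    simp

lemma rep1_apply (g : G) (x : MonoidAlgebra k G) : rep1 k G g x = MonoidAlgebra.single g 1 * x :=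
  rfl
lemma rep2_apply (g : G) (x : MonoidAlgebra k G × MonoidAlgebra k G) : rep2 k G g x =
  (MonoidAlgebra.single g 1 * x.1, MonoidAlgebra.single g 1 * x.2) := rfl

/-- The representation `rep1` as an object. -/
noncomputable abbrev R1 (k G : Type w) [CommRing k] [Group G] : Rep.{w} k G := Rep.of (rep1 k G)
/-- The representation `rep2` as an object. -/
noncomputable abbrev R2 (k G : Type w) [CommRing k] [Group G] : Rep.{w} k G := Rep.of (rep2 k G)

variable {A : Rep.{w} k G}

lemma rhom_ext {A B : Rep.{w} k G} {f g : A ⟶ B} (h : ∀ x : A, f.hom x = g.hom x) : f = g :=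
  Rep.hom_ext (Representation.IntertwiningMap.ext (LinearMap.ext h))

/-- The action of the group ring. -/
noncomputable def act (A : Rep.{w} k G) (x : MonoidAlgebra k G) (a : A) : A :=
  A.ρ.asAlgebraHom x a

lemma act_single (g : G) (a : A) : act A (MonoidAlgebra.single g 1) a = A.ρ g a := by
  simp [act]

lemma act_single' (g : G) (r : k) (a : A) :
    act A (MonoidAlgebra.single g r) a = r • A.ρ g a := by
  simp [act]

lemma act_mul (x y : MonoidAlgebra k G) (a : A) : act A (x * y) a = act A x (act A y a) := by
  simp [act]

lemma act_add (x y : MonoidAlgebra k G) (a : A) : act A (x + y) a = act A x a + act A y a := by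
  simp [act]

lemma act_sub (x y : MonoidAlgebra k G) (a : A) : act A (x - y) a = act A x a - act A y a := by
  simp [act]

lemma act_neg (x : MonoidAlgebra k G) (a : A) : act A (- x) a = - act A x a := by
  simp [act]

lemma act_zero (a : A) : act A 0 a = 0 := by
  simp [act]

lemma act_one (a : A) : act A 1 a = a := by
  simp [act]

lemma act_smul (r : k) (x : MonoidAlgebra k G) (a : A) : act A (r • x) a = r • act A x a := by
  simp [act]

/-- The action as a linear map in the group ring variable. -/
noncomputable def actL (a : A) : MonoidAlgebra k G →ₗ[k] A where
  toFun x := act A x a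
  map_add' x y := act_add x y a
  map_smul' r x := act_smul r x a

lemma single_mul_eq (g : G) (r : k) (y : MonoidAlgebra k G) :
    MonoidAlgebra.single g r * y = r • (MonoidAlgebra.single g 1 * y) := by
  rw [← smul_mul_assoc, MonoidAlgebra.smul_single, smul_eq_mul, mul_one]

lemma act_R1 (x y : MonoidAlgebra k G) : act (R1 k G) x y = x * y := by
  induction x using MonoidAlgebra.induction_linear with
  | zero => rw [act_zero, zero_mul]
  | add a b ha hb => rw [act_add, ha, hb, add_mul]
  | single g r => rw [single_mul_eq]; exact act_single' g r _

lemma act_R2 (x : MonoidAlgebra k G) (y : MonoidAlgebra k G × MonoidAlgebra k G) :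
    act (R2 k G) x y = (x * y.1, x * y.2) := by
  induction x using MonoidAlgebra.induction_linear with
  | zero => rw [act_zero, zero_mul, zero_mul]; rfl
  | add a b ha hb => rw [act_add, ha, hb, add_mul, add_mul]; rfl
  | single g r => rw [single_mul_eq, single_mul_eq g r y.2]; exact act_single' g r _

lemma hom_act {B : Rep.{w} k G} (f : A ⟶ B) (x : MonoidAlgebra k G) (a : A) :
    f.hom (act A x a) = act B x (f.hom a) := by
  induction x using MonoidAlgebra.induction_linear with
  | zero => simp [act]
  | add x y hx hy => rw [act_add, act_add, map_add, hx, hy]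
  | single g r =>
    simp only [act, Representation.asAlgebraHom_single, LinearMap.smul_apply, map_smul]
    rw [Rep.hom_comm_apply]

lemma actL_rep1 (a : A) (g : G) (x : MonoidAlgebra k G) :
    actL a (rep1 k G g x) = A.ρ g (actL a x) :=
  (act_mul (MonoidAlgebra.single g 1) x a).trans (act_single g _)

lemma actL_rep2 (a b : A) (g : G) (x : MonoidAlgebra k G × MonoidAlgebra k G) :
    (actL a).coprod (actL b) (rep2 k G g x) = A.ρ g ((actL a).coprod (actL b) x) := by
  rw [LinearMap.coprod_apply, LinearMap.coprod_apply, map_add, ← actL_rep1, ← actL_rep1]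
  rfl

/-- Maps out of `R1`, intertwining version. -/
noncomputable def im1 (a : A) : (rep1 k G).IntertwiningMap A.ρ :=
  ⟨actL a, fun g => LinearMap.ext fun x => actL_rep1 a g x⟩

/-- Maps out of `R2`, intertwining version. -/
noncomputable def im2 (a b : A) : (rep2 k G).IntertwiningMap A.ρ :=
  ⟨(actL a).coprod (actL b), fun g => LinearMap.ext fun x => actL_rep2 a b g x⟩

/-- Maps out of `R1`. -/
noncomputable def mk1 (a : A) : R1 k G ⟶ A := Rep.ofHom (im1 a)

/-- Maps out of `R2`. -/
noncomputable def mk2 (a b : A) : R2 k G ⟶ A := Rep.ofHom (im2 a b)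

lemma mk1_apply (a : A) (x : MonoidAlgebra k G) : (mk1 a).hom x = act A x a := rfl
lemma mk2_apply (a b : A) (x : MonoidAlgebra k G × MonoidAlgebra k G) :
    (mk2 a b).hom x = act A x.1 a + act A x.2 b := rfl

/-- First basis vector. -/
noncomputable def e1 (k G : Type w) [CommRing k] [Group G] : R2 k G :=
  ((1, 0) : MonoidAlgebra k G × MonoidAlgebra k G)
/-- Second basis vector. -/
noncomputable def e2 (k G : Type w) [CommRing k] [Group G] : R2 k G :=
  ((0, 1) : MonoidAlgebra k G × MonoidAlgebra k G)

lemma hom_formula (f : R2 k G ⟶ A) (x : MonoidAlgebra k G × MonoidAlgebra k G) :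
    f.hom x = act A x.1 (f.hom (e1 k G)) + act A x.2 (f.hom (e2 k G)) := by
  have hx : x = act (R2 k G) x.1 (e1 k G) + act (R2 k G) x.2 (e2 k G) := by
    refine Eq.trans ?_ (congrArg₂ (· + ·) (act_R2 x.1 (1, 0)).symm (act_R2 x.2 (0, 1)).symm)
    ext : 1 <;> simp
  refine (congrArg f.hom hx).trans ?_
  rw [map_add, hom_act, hom_act]

lemma hom_ext2 {f g : R2 k G ⟶ A} (h1 : f.hom (e1 k G) = g.hom (e1 k G))
    (h2 : f.hom (e2 k G) = g.hom (e2 k G)) : f = g := by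
  apply rhom_ext
  intro x
  rw [hom_formula, hom_formula g, h1, h2]

lemma hom_ext1 {f g : R1 k G ⟶ A}
    (h1 : f.hom (1 : MonoidAlgebra k G) = g.hom (1 : MonoidAlgebra k G)) : f = g := by
  apply rhom_ext
  intro x
  have hx : x = act (R1 k G) x (1 : MonoidAlgebra k G) := ((act_R1 x 1).trans (mul_one x)).symm
  rw [hx, hom_act, hom_act, h1]

lemma mk2_e1 (a b : A) : (mk2 a b).hom (e1 k G) = a := by
  refine (mk2_apply a b (1, 0)).trans ?_
  rw [act_one, act_zero, add_zero]

lemma mk2_e2 (a b : A) : (mk2 a b).hom (e2 k G) = b := by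
  refine (mk2_apply a b (0, 1)).trans ?_
  rw [act_one, act_zero, zero_add]

lemma mk1_hom (a : A) : (mk1 a).hom (1 : MonoidAlgebra k G) = a := by
  rw [mk1_apply, act_one]

instance : Projective (R1 k G) where
  factors {E X} f e _ := by
    obtain ⟨a, ha⟩ := (Rep.epi_iff_surjective e).1 inferInstance (f.hom (1 : MonoidAlgebra k G))
    refine ⟨mk1 a, hom_ext1 ?_⟩
    exact (congrArg e.hom (mk1_hom a)).trans ha

instance : Projective (R2 k G) where
  factors {E X} f e _ := by
    obtain ⟨a, ha⟩ := (Rep.epi_iff_surjective e).1 inferInstance (f.hom (e1 k G))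
    obtain ⟨b, hb⟩ := (Rep.epi_iff_surjective e).1 inferInstance (f.hom (e2 k G))
    refine ⟨mk2 a b, hom_ext2 ?_ ?_⟩
    · exact (congrArg e.hom (mk2_e1 a b)).trans ha
    · exact (congrArg e.hom (mk2_e2 a b)).trans hb

lemma rep_exact {X Y Z : Rep.{w} k G} (f : X ⟶ Y) (g : Y ⟶ Z) (w : f ≫ g = 0)
    (h : ∀ y : Y, g.hom y = 0 → ∃ x : X, f.hom x = y) : (ShortComplex.mk f g w).Exact := by
  apply (forget₂ _ (ModuleCat k)).reflects_exact_of_faithful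
  rw [ShortComplex.moduleCat_exact_iff]
  exact h

end generic

/-- Degree zero. -/
noncomputable abbrev Q1 : Rep.{0} ℤ SL(2, ℤ) := R1 ℤ SL(2, ℤ)
/-- Positive degrees. -/
noncomputable abbrev Q2 : Rep.{0} ℤ SL(2, ℤ) := R2 ℤ SL(2, ℤ)

/-- The first differential. -/
noncomputable def dOne : Q2 ⟶ Q1 := mk2 (A := Q1) (s - 1) (u - 1)
/-- The differential out of even positive degrees. -/
noncomputable def dEven : Q2 ⟶ Q2 :=
  mk2 (A := Q2) ((0, nrm U 6) : R × R) ((1 + s, -(1 + u + u ^ 2)) : R × R)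
/-- The differential out of odd degrees at least three. -/
noncomputable def dOdd : Q2 ⟶ Q2 :=
  mk2 (A := Q2) ((s - 1, (s - 1) * (1 + z)) : R × R) ((u - 1, 0) : R × R)

lemma dOne_apply (x : R × R) : dOne.hom x = (x.1 * (s - 1) + x.2 * (u - 1) : R) := by
  refine (mk2_apply _ _ _).trans ?_
  exact congrArg₂ (· + ·) (act_R1 _ _) (act_R1 _ _)

lemma dEven_apply (x : R × R) : dEven.hom x =
    ((x.2 * (1 + s), x.1 * nrm U 6 - x.2 * (1 + u + u ^ 2)) : R × R) := by
  refine (mk2_apply _ _ _).trans ?_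
  refine (congrArg₂ (· + ·) (act_R2 _ _) (act_R2 _ _)).trans ?_
  ext : 1
  · simp
  · change x.1 * nrm U 6 + x.2 * -(1 + u + u ^ 2) = _
    rw [mul_neg, sub_eq_add_neg]

lemma dOdd_apply (x : R × R) : dOdd.hom x =
    ((x.1 * (s - 1) + x.2 * (u - 1), x.1 * (s - 1) * (1 + z)) : R × R) := by
  refine (mk2_apply _ _ _).trans ?_
  refine (congrArg₂ (· + ·) (act_R2 _ _) (act_R2 _ _)).trans ?_
  ext : 1
  · simp
  · simp [mul_assoc]

lemma even_rel1 (x : R × R) : x.2 * (1 + s) * (s - 1) +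
    (x.1 * nrm U 6 - x.2 * (1 + u + u ^ 2)) * (u - 1) = 0 := by
  rw [sub_mul, mul_assoc, s_rel, mul_assoc, nu, mul_assoc, u_rel]; simp

lemma dEven_dOne : dEven ≫ dOne = 0 := by
  refine rhom_ext fun x => ?_
  change dOne.hom (dEven.hom x) = (0 : R)
  rw [dEven_apply, dOne_apply, even_rel1]

lemma dEven_dOdd : dEven ≫ dOdd = 0 := by
  refine rhom_ext fun x => ?_
  change dOdd.hom (dEven.hom x) = (0 : R × R)
  rw [dEven_apply, dOdd_apply, even_rel1, mul_assoc x.2, s_rel, mul_assoc, z_rel, mul_zero]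
  rfl

lemma dOdd_dEven : dOdd ≫ dEven = 0 := by
  refine rhom_ext fun x => ?_
  change dEven.hom (dOdd.hom x) = (0 : R × R)
  rw [dOdd_apply, dEven_apply]
  have h1 : x.1 * (s - 1) * (1 + z) * (1 + s) = 0 := by
    rw [mul_assoc, mul_assoc, comm_sz, ← mul_assoc (s - 1), s_rel', z_rel, mul_zero]
  have h2 : (x.1 * (s - 1) + x.2 * (u - 1)) * nrm U 6 -
      x.1 * (s - 1) * (1 + z) * (1 + u + u ^ 2) = 0 := by
    rw [add_mul, mul_assoc x.2, un, mul_assoc _ (1 + z), ← nrm_U]; simp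
  rw [h1, h2]; rfl

/-- The objects of the resolution. -/
noncomputable def resX : ℕ → Rep.{0} ℤ SL(2, ℤ)
  | 0 => Q1
  | _ + 1 => Q2

/-- The differentials of the resolution. -/
noncomputable def resd : (n : ℕ) → (resX (n + 1) ⟶ resX n)
  | 0 => dOne
  | n + 1 => if Even n then dEven else dOdd

lemma resd_sq (n : ℕ) : resd (n + 1) ≫ resd n = 0 := by
  cases n with
  | zero => exact dEven_dOne
  | succ n =>
    change (if Even (n + 1) then dEven else dOdd) ≫ (if Even n then dEven else dOdd) = 0
    by_cases h : Even n
    · rw [if_pos h, if_neg (by grind)]; exact dOdd_dEven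
    · rw [if_neg h, if_pos (by grind)]; exact dEven_dOdd

/-- The complex underlying the resolution. -/
noncomputable def resC : ChainComplex (Rep.{0} ℤ SL(2, ℤ)) ℕ := ChainComplex.of resX resd resd_sq

lemma resC_d (n : ℕ) : resC.d (n + 1) n = resd n := ChainComplex.of_d _ _ _ 

/-- The augmentation as a morphism. -/
noncomputable def augHom : Q1 ⟶ Rep.trivial ℤ SL(2, ℤ) ℤ := Rep.ofHom ⟨aug, fun g => by
  refine LinearMap.ext fun x => ?_
  exact aug_el_mul g x⟩

lemma dOne_aug : dOne ≫ augHom = 0 := by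
  refine rhom_ext fun x => ?_
  change aug (dOne.hom x) = (0 : ℤ)
  rw [dOne_apply]
  simp [mul_sub, s, u, aug_mul_el]

/-- The augmentation as a chain map. -/
noncomputable def resπ : resC ⟶ (ChainComplex.single₀ _).obj (Rep.trivial ℤ SL(2, ℤ) ℤ) :=
  (resC.toSingle₀Equiv _).symm ⟨augHom, by rw [resC_d]; exact dOne_aug⟩

lemma resπ_f : resπ.f 0 = augHom := ChainComplex.toSingle₀Equiv_symm_apply_f_zero _ _

lemma exact_even_one : (ShortComplex.mk _ _ dEven_dOne).Exact := by
  refine rep_exact _ _ _ fun y hy => ?_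
  rw [dOne_apply] at hy
  obtain ⟨b, e, h1, h2⟩ := exact1 y.1 y.2 hy
  refine ⟨((b, e) : R × R), ?_⟩
  rw [dEven_apply]
  exact Prod.ext h1.symm h2.symm

lemma exact_even_odd : (ShortComplex.mk _ _ dEven_dOdd).Exact := by
  refine rep_exact _ _ _ fun y hy => ?_
  rw [dOdd_apply] at hy
  obtain ⟨b, e, h1, h2⟩ := exact1 y.1 y.2 (congrArg Prod.fst hy)
  refine ⟨((b, e) : R × R), ?_⟩
  rw [dEven_apply]
  exact Prod.ext h1.symm h2.symm

lemma exact_odd_even : (ShortComplex.mk _ _ dOdd_dEven).Exact := by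
  refine rep_exact _ _ _ fun y hy => ?_
  rw [dEven_apply] at hy
  obtain ⟨b, e, h1, h2⟩ := exact2 y.1 y.2 (congrArg Prod.fst hy) (congrArg Prod.snd hy)
  refine ⟨((b, e) : R × R), ?_⟩
  rw [dOdd_apply]
  exact Prod.ext h1.symm h2.symm

lemma exact_one_aug : (ShortComplex.mk _ _ dOne_aug).Exact := by
  refine rep_exact _ _ _ fun y hy => ?_
  obtain ⟨a, b, h⟩ := exact0 y hy
  refine ⟨((a, b) : R × R), ?_⟩
  rw [dOne_apply]
  exact h.symm

lemma resd_exact (n : ℕ) : (ShortComplex.mk _ _ (resd_sq n)).Exact := by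
  cases n with
  | zero => exact exact_even_one
  | succ n =>
    by_cases h : Even n
    · have h1 : resd (n + 1) = dEven := if_pos h
      have h2 : resd (n + 2) = dOdd := if_neg (by grind)
      simp only [h1, h2]
      exact exact_odd_even
    · have h1 : resd (n + 1) = dOdd := if_neg h
      have h2 : resd (n + 2) = dEven := if_pos (by grind)
      simp only [h1, h2]
      exact exact_even_odd

lemma exact_congr {X Y Z : Rep.{0} ℤ SL(2, ℤ)} {f f' : X ⟶ Y} {g g' : Y ⟶ Z} (hf : f = f')
    (hg : g = g') (w : f ≫ g = 0) {w' : f' ≫ g' = 0} (h : (ShortComplex.mk f' g' w').Exact) :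
    (ShortComplex.mk f g w).Exact := by
  subst hf; subst hg; exact h

lemma resπ_quasiIso : QuasiIso resπ where
  quasiIsoAt m := by
    cases m with
    | zero =>
      rw [ChainComplex.quasiIsoAt₀_iff, ShortComplex.quasiIso_iff_of_zeros' _ rfl rfl rfl]
      constructor
      · exact exact_congr (X := Q2) (Y := Q1) (Z := Rep.trivial ℤ SL(2, ℤ) ℤ)
          (resC_d 0) resπ_f _ exact_one_aug
      · rw [Rep.epi_iff_surjective]
        intro x
        refine ⟨(MonoidAlgebra.single 1 x : R), ?_⟩
        change (resπ.f 0).hom (MonoidAlgebra.single 1 x : R) = x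
        rw [resπ_f]
        exact aug_single 1 x
    | succ m =>
      rw [quasiIsoAt_iff_exactAt' (hL := ChainComplex.exactAt_succ_single_obj ..),
          HomologicalComplex.exactAt_iff' _ (m + 2) (m + 1) m (by simp) (by simp)]
      exact exact_congr (X := resX (m + 2)) (Y := resX (m + 1)) (Z := resX m)
          (resC_d (m + 1)) (resC_d m) _ (resd_exact m)

/-- The resolution. -/
noncomputable def res : ProjectiveResolution (Rep.trivial ℤ SL(2, ℤ) ℤ) where
  complex := resC
  projective n := by
    cases n with
    | zero => exact inferInstanceAs (Projective Q1)
    | succ n => exact inferInstanceAs (Projective Q2)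
  π := resπ
  quasiIso := resπ_quasiIso

end resolution

section cohomology
open CategoryTheory ModularGroup Matrix MatrixGroups MonoidAlgebra

lemma sc_equiv {k : Type*} [CommRing k] (C : ShortComplex (ModuleCat k)) {T : Type*}
    [AddCommGroup T] [Module k T] (φ : LinearMap.ker C.g.hom →ₗ[k] T)
    (hφ : Function.Surjective φ)
    (hk : ∀ x : LinearMap.ker C.g.hom, φ x = 0 ↔ ∃ y, C.f.hom y = x.1) :
    Nonempty (C.homology ≃ₗ[k] T) := by
  have hr : LinearMap.range C.moduleCatToCycles = LinearMap.ker φ := by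
    ext x
    rw [LinearMap.mem_ker, hk, LinearMap.mem_range]
    constructor
    · rintro ⟨y, hy⟩
      exact ⟨y, congrArg Subtype.val hy⟩
    · rintro ⟨y, hy⟩
      exact ⟨y, Subtype.ext hy⟩
  exact ⟨C.moduleCatHomologyIso.toLinearEquiv ≪≫ₗ Submodule.quotEquivOfEq _ _ hr ≪≫ₗ
    φ.quotKerEquivOfSurjective hφ⟩

/-- An additive map as a linear map over the integers, for arbitrary module structures. -/
def toLin {M N : Type*} [AddCommGroup M] [AddCommGroup N] {i1 : Module ℤ M} {i2 : Module ℤ N}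
    (f : M →+ N) : M →ₗ[ℤ] N where
  toFun := f
  map_add' := map_add f
  map_smul' := fun c x => map_intCast_smul f ℤ ℤ c x

/-- The cochain complex of maps into `A`. -/
noncomputable abbrev LY {k G : Type} [CommRing k] [Group G] (P : ChainComplex (Rep.{0} k G) ℕ)
    (A : Rep.{0} k G) : CochainComplex (ModuleCat k) ℕ := P.linearYonedaObj k A

variable (A : Rep.{0} ℤ SL(2, ℤ))

lemma dEven_comp (f : Q2 ⟶ A) : (dEven ≫ f).hom (e1 _ _) = act A (nrm U 6) (f.hom (e2 _ _)) ∧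
    (dEven ≫ f).hom (e2 _ _) = act A (1 + s) (f.hom (e1 _ _)) -
      act A (1 + u + u ^ 2) (f.hom (e2 _ _)) := by
  constructor
  · refine (congrArg f.hom (dEven_apply (1, 0))).trans ?_
    rw [hom_formula]
    simp [act_zero]
  · refine (congrArg f.hom (dEven_apply (0, 1))).trans ?_
    rw [hom_formula]
    simp only [one_mul, zero_mul, zero_sub]
    rw [act_neg, ← sub_eq_add_neg]

lemma dOdd_comp (f : Q2 ⟶ A) : (dOdd ≫ f).hom (e1 _ _) = act A (s - 1) (f.hom (e1 _ _)) +
      act A ((s - 1) * (1 + z)) (f.hom (e2 _ _)) ∧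
    (dOdd ≫ f).hom (e2 _ _) = act A (u - 1) (f.hom (e1 _ _)) := by
  constructor
  · refine (congrArg f.hom (dOdd_apply (1, 0))).trans ?_
    rw [hom_formula]
    simp only [one_mul, zero_mul, add_zero]
  · refine (congrArg f.hom (dOdd_apply (0, 1))).trans ?_
    rw [hom_formula]
    simp only [one_mul, zero_mul, zero_add, act_zero, add_zero]

theorem H_even (j : ℕ) {T : Type} [AddCommGroup T] (Z : AddSubgroup (A × A))
    (hZ : ∀ y e, (y, e) ∈ Z ↔ act A (u - 1) y = 0 ∧
      act A (s - 1) y + act A ((s - 1) * (1 + z)) e = 0)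
    (φ : Z →+ T) (hφ : Function.Surjective φ)
    (hk : ∀ x : Z, φ x = 0 ↔ ∃ x' y', x.1.1 = act A (nrm U 6) y' ∧
      x.1.2 = act A (1 + s) x' - act A (1 + u + u ^ 2) y') :
    Nonempty (groupCohomology A (2 * j + 2) ≃+ T) := by
  have h1 : resC.d (2 * j + 2) (2 * j + 1) = dEven := (resC_d _).trans (if_pos (by simp))
  have h2 : resC.d (2 * j + 3) (2 * j + 2) = dOdd :=
    (resC_d _).trans (if_neg (by simp))
  let C : ShortComplex (ModuleCat ℤ) := (LY res.complex A).sc' (2 * j + 1) (2 * j + 2) (2 * j + 3)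
  have hg : ∀ f : Q2 ⟶ A, C.g.hom f = (dOdd ≫ f : Q2 ⟶ A) := fun f => by
    rw [← h2]; rfl
  have hf : ∀ f : Q2 ⟶ A, C.f.hom f = (dEven ≫ f : Q2 ⟶ A) := fun f => by
    rw [← h1]; rfl
  have hmem : ∀ f : Q2 ⟶ A, C.g.hom f = (0 : Q2 ⟶ A) ↔ (f.hom (e1 _ _), f.hom (e2 _ _)) ∈ Z := by
    intro f
    rw [hg, hZ]
    obtain ⟨ha, hb⟩ := dOdd_comp A f
    constructor
    · intro h
      rw [← ha, ← hb, h]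
      exact ⟨rfl, rfl⟩
    · rintro ⟨h, h'⟩
      rw [← hb] at h
      rw [← ha] at h'
      exact hom_ext2 h' h
  let Ψ : LinearMap.ker C.g.hom →+ T :=
    { toFun := fun f => φ ⟨((show Q2 ⟶ A from f.1).hom (e1 _ _),
        (show Q2 ⟶ A from f.1).hom (e2 _ _)), (hmem f.1).1 f.2⟩
      map_zero' := map_zero φ
      map_add' := fun f g => map_add φ ⟨((show Q2 ⟶ A from f.1).hom (e1 _ _),
        (show Q2 ⟶ A from f.1).hom (e2 _ _)), (hmem f.1).1 f.2⟩ ⟨((show Q2 ⟶ A from g.1).hom (e1 _ _),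
        (show Q2 ⟶ A from g.1).hom (e2 _ _)), (hmem g.1).1 g.2⟩ }
  obtain ⟨E⟩ := sc_equiv C (T := T)
    (toLin Ψ)
    (by
      intro t
      obtain ⟨⟨⟨a, b⟩, hx⟩, rfl⟩ := hφ t
      refine ⟨⟨mk2 a b, (hmem _).2 ?_⟩, ?_⟩
      · rw [mk2_e1, mk2_e2]; exact hx
      · change φ _ = _
        congr 1
        exact Subtype.ext (Prod.ext (mk2_e1 a b) (mk2_e2 a b)))
    (by
      intro x
      refine (hk _).trans ?_
      constructor
      · rintro ⟨x', y', hx, hy⟩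
        refine ⟨mk2 x' y', ?_⟩
        rw [hf]
        obtain ⟨ha, hb⟩ := dEven_comp A (mk2 x' y')
        rw [mk2_e1, mk2_e2] at *
        refine hom_ext2 (ha.trans hx.symm) (hb.trans hy.symm)
      · rintro ⟨f, hf1⟩
        have hf2 := hf1.symm.trans (hf f)
        obtain ⟨ha, hb⟩ := dEven_comp A f
        refine ⟨_, _, Eq.trans ?_ ha, Eq.trans ?_ hb⟩
        · exact congrArg (fun f : Q2 ⟶ A => f.hom (e1 _ _)) hf2
        · exact congrArg (fun f : Q2 ⟶ A => f.hom (e2 _ _)) hf2)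
  have E1 : groupCohomology A (2 * j + 2) ≅
      ((LY res.complex A).sc' (2 * j + 1) (2 * j + 2) (2 * j + 3)).homology :=
    groupCohomologyIso A (2 * j + 2) res ≪≫
      HomologicalComplex.homologyIsoSc' (LY res.complex A)
        (2 * j + 1) (2 * j + 2) (2 * j + 3)
        (CochainComplex.prev_nat_succ (2 * j + 1)) (CochainComplex.next ℕ (2 * j + 2))
  exact ⟨E1.toLinearEquiv.toAddEquiv.trans E.toAddEquiv⟩

end cohomology

section shapiro
open CategoryTheory ModularGroup Matrix MatrixGroups MonoidAlgebra

variable (Γ : Subgroup SL(2, ℤ))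

/-- The coinduced representation. -/
noncomputable def CI : Rep.{0} ℤ SL(2, ℤ) := Rep.coind Γ.subtype (Rep.trivial ℤ Γ ℤ)

/-- Underlying function. -/
def fn (a : CI Γ) : SL(2, ℤ) → ℤ :=
  (show Representation.coindV Γ.subtype (Rep.trivial ℤ Γ ℤ).ρ from a).1

variable {Γ}
lemma fn_inj {a b : CI Γ} (h : ∀ g, fn Γ a g = fn Γ b g) : a = b := Subtype.ext (funext h)
lemma fn_inv (a : CI Γ) (γ : SL(2, ℤ)) (hγ : γ ∈ Γ) (g : SL(2, ℤ)) : fn Γ a (γ * g) = fn Γ a g :=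
  (show Representation.coindV Γ.subtype (Rep.trivial ℤ Γ ℤ).ρ from a).2 ⟨γ, hγ⟩ g
lemma fn_add (a b : CI Γ) (g) : fn Γ (a + b) g = fn Γ a g + fn Γ b g := rfl
lemma fn_sub (a b : CI Γ) (g) : fn Γ (a - b) g = fn Γ a g - fn Γ b g := rfl
lemma fn_zero (g) : fn Γ 0 g = 0 := rfl
lemma fn_el (h : SL(2, ℤ)) (a : CI Γ) (g) : fn Γ (act (CI Γ) (el h) a) g = fn Γ a (g * h) := by
  rw [act_single]; rfl
lemma fn_s (a : CI Γ) (g) : fn Γ (act (CI Γ) s a) g = fn Γ a (g * S) := fn_el _ _ _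
lemma fn_u (a : CI Γ) (g) : fn Γ (act (CI Γ) u a) g = fn Γ a (g * U) := fn_el _ _ _
lemma fn_z (h : -1 ∈ Γ) (a : CI Γ) (g) : fn Γ (act (CI Γ) z a) g = fn Γ a g := by
  rw [z, fn_el, ← fn_inv a (-1) h g]; congr 1; simp
lemma fn_u2 (a : CI Γ) (g) : fn Γ (act (CI Γ) (u ^ 2) a) g = fn Γ a (g * U * U) := by
  rw [pow_two, act_mul, fn_u, fn_u]

/-- Make an element from an invariant function. -/
def mkf (f : SL(2, ℤ) → ℤ) (hf : ∀ γ ∈ Γ, ∀ g, f (γ * g) = f g) : CI Γ :=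
  show Representation.coindV Γ.subtype (Rep.trivial ℤ Γ ℤ).ρ from ⟨f, fun γ g => hf γ.1 γ.2 g⟩
lemma fn_mkf (f : SL(2, ℤ) → ℤ) (hf : ∀ γ ∈ Γ, ∀ g, f (γ * g) = f g) (g) :
    fn Γ (mkf f hf) g = f g := rfl

variable (Γ)
/-- The cocycles. -/
structure IsW (x y : SL(2, ℤ) → ℤ) : Prop where
  x_inv : ∀ γ ∈ Γ, ∀ g, x (γ * g) = x g
  y_inv : ∀ γ ∈ Γ, ∀ g, y (γ * g) = y g
  x_S : ∀ g, x (g * S) = x g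
  y_U : ∀ g, y (g * U) = y g
  par : ∀ g, 2 ∣ x g - y g

/-- The group of cocycles. -/
def W : AddSubgroup ((SL(2, ℤ) → ℤ) × (SL(2, ℤ) → ℤ)) where
  carrier := {w | IsW Γ w.1 w.2}
  add_mem' := by
    rintro ⟨a, b⟩ ⟨c, d⟩ h h'
    replace h : IsW Γ a b := h
    replace h' : IsW Γ c d := h'
    refine ⟨fun γ hγ g => ?_, fun γ hγ g => ?_, fun g => ?_, fun g => ?_, fun g => ?_⟩
    · simp [h.x_inv γ hγ g, h'.x_inv γ hγ g]
    · simp [h.y_inv γ hγ g, h'.y_inv γ hγ g]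
    · simp [h.x_S g, h'.x_S g]
    · simp [h.y_U g, h'.y_U g]
    · have := h.par g
      have := h'.par g
      simp only [Pi.add_apply, Prod.mk_add_mk] at *
      omega
  zero_mem' := by constructor <;> simp
  neg_mem' := by
    rintro ⟨a, b⟩ h
    replace h : IsW Γ a b := h
    refine ⟨fun γ hγ g => ?_, fun γ hγ g => ?_, fun g => ?_, fun g => ?_, fun g => ?_⟩
    · simp [h.x_inv γ hγ g]
    · simp [h.y_inv γ hγ g]
    · simp [h.x_S g]
    · simp [h.y_U g]
    · have := h.par g
      simp only [Pi.neg_apply, Prod.neg_mk] at *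
      omega

/-- Coboundaries. -/
def IsB (x y : SL(2, ℤ) → ℤ) : Prop := ∃ x' y' : SL(2, ℤ) → ℤ,
  (∀ γ ∈ Γ, ∀ g, x' (γ * g) = x' g) ∧ (∀ γ ∈ Γ, ∀ g, y' (γ * g) = y' g) ∧
  (∀ g, x g = 2 * (x' g + x' (g * S))) ∧ (∀ g, y g = 2 * (y' g + y' (g * U) + y' (g * U * U)))

theorem H_inv (hΓ : -1 ∈ Γ) (j : ℕ) {T : Type} [AddCommGroup T] (φ : W Γ →+ T)
    (hφ : Function.Surjective φ) (hk : ∀ w : W Γ, φ w = 0 ↔ IsB Γ w.1.1 w.1.2) :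
    Nonempty (groupCohomology (Rep.trivial ℤ Γ ℤ) (2 * j + 2) ≃+ T) := by
  let toW : (CI Γ × CI Γ) →+ ((SL(2, ℤ) → ℤ) × (SL(2, ℤ) → ℤ)) :=
    { toFun := fun a => (fun g => fn Γ a.1 g + 2 * fn Γ a.2 g, fn Γ a.1)
      map_zero' := rfl
      map_add' := by
        intro a b
        refine Prod.ext (funext fun g => ?_) rfl
        simp [fn_add]
        ring }
  let Z : AddSubgroup (CI Γ × CI Γ) := (W Γ).comap toW
  have hZ : ∀ y e, (y, e) ∈ Z ↔ act (CI Γ) (u - 1) y = 0 ∧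
      act (CI Γ) (s - 1) y + act (CI Γ) ((s - 1) * (1 + z)) e = 0 := by
    intro y e
    constructor
    · intro h
      have h : IsW Γ (fun g => fn Γ y g + 2 * fn Γ e g) (fn Γ y) := h
      refine ⟨fn_inj fun g => ?_, fn_inj fun g => ?_⟩
      · rw [act_sub, fn_sub, act_one, fn_u, fn_zero, h.y_U, sub_self]
      · have := h.x_S g
        simp only [act_mul, act_add, act_sub, fn_sub, act_one, fn_s, fn_zero, fn_add, fn_z hΓ] at *
        linarith
    · rintro ⟨h1, h2⟩
      have h1 : ∀ g, fn Γ (act (CI Γ) (u - 1) y) g = 0 := fun g => by rw [h1]; rfl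
      have h2 : ∀ g, fn Γ (act (CI Γ) (s - 1) y + act (CI Γ) ((s - 1) * (1 + z)) e) g = 0 :=
        fun g => by rw [h2]; rfl
      simp only [act_mul, act_add, act_sub, fn_sub, act_one, fn_s, fn_u, fn_zero, fn_add,
        fn_z hΓ] at h1 h2
      change IsW Γ (fun g => fn Γ y g + 2 * fn Γ e g) (fn Γ y)
      refine ⟨fun γ hγ g => ?_, fun γ hγ g => ?_, fun g => ?_, fun g => ?_, fun g => ?_⟩
      · simp [fn_inv _ γ hγ]
      · simp [fn_inv _ γ hγ]
      · have := h2 g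
        show fn Γ y (g * S) + 2 * fn Γ e (g * S) = fn Γ y g + 2 * fn Γ e g
        linarith
      · have := h1 g
        linarith
      · simp
  let phiZ : Z →+ T := φ.comp (toW.addSubgroupComap (W Γ))
  have hs : Function.Surjective phiZ := by
    refine hφ.comp ?_
    rintro ⟨⟨x, y⟩, h⟩
    have h0 : IsW Γ x y := h
    choose e he using h0.par
    have hinv : ∀ γ ∈ Γ, ∀ g, e (γ * g) = e g := fun γ hγ g => by
      have h1 := he (γ * g)
      have h2 := he g
      rw [h0.x_inv γ hγ, h0.y_inv γ hγ] at h1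
      linarith
    have h3 : toW (mkf y h0.y_inv, mkf e hinv) = (x, y) := by
      refine Prod.ext (funext fun g => ?_) rfl
      change y g + 2 * e g = x g
      linarith [he g]
    refine ⟨⟨(mkf y h0.y_inv, mkf e hinv), ?_⟩, ?_⟩
    · change toW _ ∈ W Γ
      rw [h3]; exact h
    · exact Subtype.ext h3
  obtain ⟨E⟩ := H_even (CI Γ) j Z hZ phiZ hs (by
    rintro ⟨⟨y, e⟩, h⟩
    refine (hk _).trans ?_
    change IsB Γ (fun g => fn Γ y g + 2 * fn Γ e g) (fn Γ y) ↔ _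
    constructor
    · rintro ⟨x', y', h1, h2, h3, h4⟩
      refine ⟨mkf x' h1, mkf y' h2, fn_inj fun g => ?_, fn_inj fun g => ?_⟩
      · rw [nrm_U]
        simp only [act_mul, act_add, act_sub, fn_sub, act_one, fn_s, fn_u, fn_zero, fn_add,
          fn_z hΓ, fn_u2, fn_mkf]
        linarith [h4 g]
      · simp only [act_mul, act_add, act_sub, fn_sub, act_one, fn_s, fn_u, fn_zero, fn_add,
          fn_z hΓ, fn_u2, fn_mkf]
        linarith [h4 g, h3 g]
    · rintro ⟨x', y', h1, h2⟩
      have h1 : y = _ := h1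
      have h2 : e = _ := h2
      have h3 : ∀ g, fn Γ y g = 2 * (fn Γ y' g + fn Γ y' (g * U) + fn Γ y' (g * U * U)) := by
        intro g
        rw [h1, nrm_U]
        simp only [act_mul, act_add, act_sub, fn_sub, act_one, fn_s, fn_u, fn_zero, fn_add,
          fn_z hΓ, fn_u2, fn_mkf]
        ring
      refine ⟨fn Γ x', fn Γ y', fn_inv _, fn_inv _, fun g => ?_, h3⟩
      beta_reduce
      rw [h3, h2]
      simp only [act_mul, act_add, act_sub, fn_sub, act_one, fn_s, fn_u, fn_zero, fn_add,
          fn_z hΓ, fn_u2, fn_mkf]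
      ring)
  exact ⟨(groupCohomology.coindIso (S := Γ) (Rep.trivial ℤ Γ ℤ) (2 * j + 2)).symm.toLinearEquiv.toAddEquiv.trans E⟩

end shapiro

section comb
open ModularGroup Matrix MatrixGroups

variable (Γ : Subgroup SL(2, ℤ))

/-- The coset of an element. -/
def q (g : SL(2, ℤ)) : Quotient (QuotientGroup.rightRel Γ) := Quotient.mk _ g

variable {Γ}

lemma q_eq {g h : SL(2, ℤ)} : q Γ g = q Γ h ↔ h * g⁻¹ ∈ Γ := by
  unfold q
  rw [Quotient.eq, QuotientGroup.rightRel_apply]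

lemma q_mul (g h k : SL(2, ℤ)) : q Γ (g * k) = q Γ (h * k) ↔ q Γ g = q Γ h := by
  rw [q_eq, q_eq]
  simp [mul_assoc]

lemma q_inv (γ : SL(2, ℤ)) (hγ : γ ∈ Γ) (g : SL(2, ℤ)) : q Γ (γ * g) = q Γ g := by
  rw [q_eq]
  simpa using hγ

lemma inv_q {x : SL(2, ℤ) → ℤ} (hx : ∀ γ ∈ Γ, ∀ g, x (γ * g) = x g) {g h : SL(2, ℤ)}
    (e : q Γ g = q Γ h) : x g = x h := by
  have := hx _ (q_eq.1 e) g
  simpa using this.symm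

lemma q_SS (hΓ : -1 ∈ Γ) (g : SL(2, ℤ)) : q Γ (g * S * S) = q Γ g := by
  rw [mul_assoc, ← pow_two, S_sq, ← q_inv (-1) hΓ g]
  congr 1; simp

lemma q_UUU (hΓ : -1 ∈ Γ) (g : SL(2, ℤ)) : q Γ (g * U * U * U) = q Γ g := by
  rw [mul_assoc, mul_assoc, ← pow_two, ← pow_succ', U_cube, ← q_inv (-1) hΓ g]
  congr 1; simp

lemma solve_x (hΓ : -1 ∈ Γ) (x : SL(2, ℤ) → ℤ) (hx : ∀ γ ∈ Γ, ∀ g, x (γ * g) = x g)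
    (hS : ∀ g, x (g * S) = x g) (h2 : ∀ g, 2 ∣ x g) (h4 : ∀ g, q Γ (g * S) = q Γ g → 4 ∣ x g) :
    ∃ x' : SL(2, ℤ) → ℤ, (∀ γ ∈ Γ, ∀ g, x' (γ * g) = x' g) ∧
      ∀ g, x g = 2 * (x' g + x' (g * S)) := by
  classical
  letI : LinearOrder (Quotient (QuotientGroup.rightRel Γ)) := WellOrderingRel.isWellOrder.linearOrder
  refine ⟨fun g => if q Γ (g * S) = q Γ g then x g / 4 else
    if q Γ (g * S) < q Γ g then x g / 2 else 0, fun γ hγ g => ?_, fun g => ?_⟩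
  · simp only [mul_assoc, q_inv γ hγ, hx γ hγ]
  · simp only [q_SS hΓ, hS]
    have a := h2 g
    by_cases h : q Γ (g * S) = q Γ g
    · have := h4 g h
      simp only [h, if_true]
      omega
    · rcases lt_or_gt_of_ne h with h' | h'
      · simp only [h, Ne.symm h, h', not_lt_of_gt h', if_true, if_false]
        omega
      · simp only [h, Ne.symm h, h', not_lt_of_gt h', if_true, if_false]
        omega

lemma solve_y (hΓ : -1 ∈ Γ) (x : SL(2, ℤ) → ℤ) (hx : ∀ γ ∈ Γ, ∀ g, x (γ * g) = x g)
    (hU : ∀ g, x (g * U) = x g) (h2 : ∀ g, 2 ∣ x g) (h4 : ∀ g, q Γ (g * U) = q Γ g → 3 ∣ x g) :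
    ∃ x' : SL(2, ℤ) → ℤ, (∀ γ ∈ Γ, ∀ g, x' (γ * g) = x' g) ∧
      ∀ g, x g = 2 * (x' g + x' (g * U) + x' (g * U * U)) := by
  classical
  letI : LinearOrder (Quotient (QuotientGroup.rightRel Γ)) := WellOrderingRel.isWellOrder.linearOrder
  refine ⟨fun g => if q Γ (g * U) = q Γ g then x g / 6 else
    if q Γ g < q Γ (g * U) ∧ q Γ g < q Γ (g * U * U) then x g / 2 else 0,
    fun γ hγ g => ?_, fun g => ?_⟩
  · simp only [mul_assoc, q_inv γ hγ, hx γ hγ]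
  · have e : q Γ (g * U * U * U * U) = q Γ (g * U) := (q_mul _ _ _).2 (q_UUU hΓ g)
    have a := h2 g
    have e1 : q Γ (g * U * U) = q Γ (g * U) ↔ q Γ (g * U) = q Γ g := q_mul _ _ _
    have e2 : q Γ g = q Γ (g * U * U) ↔ q Γ (g * U) = q Γ g := by
      rw [← e1, ← q_mul _ _ U, ← q_mul _ _ U, q_UUU hΓ, ← q_mul _ _ U, q_UUU hΓ]
    simp only [q_UUU hΓ, hU, e, e1, e2]
    by_cases h : q Γ (g * U) = q Γ g
    · have := h4 g h
      simp only [h, if_true]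
      omega
    · simp only [h, if_false]
      have h1 : q Γ (g * U * U) ≠ q Γ (g * U) := fun h' => h (e1.1 h')
      have h3 : q Γ g ≠ q Γ (g * U * U) := fun h' => h (e2.1 h')
      generalize q Γ (g * U * U) = A at *
      generalize q Γ (g * U) = B at *
      generalize q Γ g = C at *
      rcases lt_or_gt_of_ne h with h' | h' <;> rcases lt_or_gt_of_ne h1 with h1' | h1' <;>
      rcases lt_or_gt_of_ne h3 with h3' | h3' <;>
      simp only [h', h1', h3', not_lt_of_gt h', not_lt_of_gt h1', not_lt_of_gt h3',
        and_self, and_true, and_false, if_true, if_false] <;> first | omega | skip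
      · exact absurd (h3'.trans (h1'.trans h')) (lt_irrefl _)
      · exact absurd (h3'.trans (h'.trans h1')) (lt_irrefl _)

lemma isB_iff (hΓ : -1 ∈ Γ) {x y : SL(2, ℤ) → ℤ} (h : IsW Γ x y) : IsB Γ x y ↔
    ((∀ g, 2 ∣ x g) ∧ (∀ g, q Γ (g * S) = q Γ g → 4 ∣ x g)) ∧
      (∀ g, q Γ (g * U) = q Γ g → 3 ∣ y g) := by
  constructor
  · rintro ⟨x', y', hx, hy, h1, h2⟩
    refine ⟨⟨fun g => ⟨_, h1 g⟩, fun g hg => ?_⟩, fun g hg => ?_⟩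
    · have := inv_q hx hg
      have := h1 g
      omega
    · have a := inv_q hy hg
      have b := inv_q hy ((q_mul _ _ U).2 hg)
      have := h2 g
      omega
  · rintro ⟨⟨h1, h2⟩, h3⟩
    obtain ⟨x', a, b⟩ := solve_x hΓ x h.x_inv h.x_S h1 h2
    obtain ⟨y', c, d⟩ := solve_y hΓ y h.y_inv h.y_U (fun g => by
      have := h.par g
      have := h1 g
      omega) h3
    exact ⟨x', y', a, c, b, d⟩

lemma par_const {x y : SL(2, ℤ) → ℤ} (h : IsW Γ x y) (g : SL(2, ℤ)) : 2 ∣ x g - x 1 := by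
  refine gen_induction (fun g => 2 ∣ x g - x 1) (by simp) (fun g => ?_) (fun g => ?_) g
  · rw [h.x_S]
  · have a := h.par g
    have b := h.par (g * U)
    rw [h.y_U] at b
    omega

/-- combine the two- and three-primary parts. -/
theorem H_comb (hΓ : -1 ∈ Γ) (j : ℕ) {K L : Type} [AddCommGroup K] [AddCommGroup L]
    (φ : W Γ →+ K) (ψ : W Γ →+ L) (hφ : Function.Surjective φ) (hψ : Function.Surjective ψ)
    (hK : ∀ k : K, 4 • k = 0) (hL : ∀ k : L, 3 • k = 0)
    (h1 : ∀ w : W Γ, φ w = 0 ↔ (∀ g, 2 ∣ w.1.1 g) ∧ (∀ g, q Γ (g * S) = q Γ g → 4 ∣ w.1.1 g))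
    (h2 : ∀ w : W Γ, ψ w = 0 ↔ ∀ g, q Γ (g * U) = q Γ g → 3 ∣ w.1.2 g) :
    Nonempty (groupCohomology (Rep.trivial ℤ Γ ℤ) (2 * j + 2) ≃+ K × L) := by
  refine H_inv Γ hΓ j (φ.prod ψ) ?_ ?_
  · rintro ⟨k, l⟩
    obtain ⟨a, ha⟩ := hφ k
    obtain ⟨b, hb⟩ := hψ l
    refine ⟨9 • a + 4 • b, Prod.ext ?_ ?_⟩
    · simp only [map_add, map_nsmul, AddMonoidHom.prod_apply, Prod.fst_add, Prod.smul_fst]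
      rw [hK, ha, add_zero, show 9 = 4 * 2 + 1 from rfl, add_nsmul, mul_nsmul, hK]
      simp
    · simp only [map_add, map_nsmul, AddMonoidHom.prod_apply, Prod.snd_add, Prod.smul_snd]
      rw [hb, show 9 = 3 * 3 from rfl, mul_nsmul, hL, show 4 = 3 + 1 from rfl, add_nsmul, hL]
      simp
  · intro w
    rw [isB_iff hΓ w.2, ← h1, ← h2]
    simp [Prod.ext_iff]

/-- Evaluation of first component. -/
def evx (g : SL(2, ℤ)) : W Γ →+ ℤ where
  toFun w := w.1.1 g
  map_zero' := rfl
  map_add' _ _ := rfl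

/-- Evaluation of second component. -/
def evy (g : SL(2, ℤ)) : W Γ →+ ℤ where
  toFun w := w.1.2 g
  map_zero' := rfl
  map_add' _ _ := rfl

/-- Half the difference. -/
def hd (g h : SL(2, ℤ)) : W Γ →+ ℤ where
  toFun w := (w.1.1 g - w.1.1 h) / 2
  map_zero' := rfl
  map_add' v w := by
    have a := par_const v.2 g
    have b := par_const v.2 h
    have c := par_const w.2 g
    have d := par_const w.2 h
    have e : (v + w).1.1 g = v.1.1 g + w.1.1 g := rfl
    have f : (v + w).1.1 h = v.1.1 h + w.1.1 h := rfl
    rw [e, f]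
    omega

/-- The reduction map. -/
abbrev cst (n : ℕ) : ℤ →+ ZMod n := Int.castAddHom (ZMod n)

lemma cst_zero (n : ℕ) (a : ℤ) : cst n a = 0 ↔ (n : ℤ) ∣ a := ZMod.intCast_zmod_eq_zero_iff_dvd _ _

/-- A step function. -/
noncomputable def stp (α β : SL(2, ℤ)) (a b c : ℤ) (g : SL(2, ℤ)) : ℤ :=
  open Classical in if q Γ g = q Γ α then a else if q Γ g = q Γ β then b else c

lemma stp_inv (α β : SL(2, ℤ)) (a b c : ℤ) : ∀ γ ∈ Γ, ∀ g,
    stp (Γ := Γ) α β a b c (γ * g) = stp (Γ := Γ) α β a b c g := by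
  intro γ hγ g
  unfold stp
  rw [q_inv γ hγ]

lemma stp_mul (α β k : SL(2, ℤ)) (a b c : ℤ) (hα : q Γ (α * k) = q Γ α)
    (hβ : q Γ (β * k) = q Γ β) (g) :
    stp (Γ := Γ) α β a b c (g * k) = stp (Γ := Γ) α β a b c g := by
  have h1 : q Γ (g * k) = q Γ α ↔ q Γ g = q Γ α := by rw [← hα, q_mul, hα]
  have h2 : q Γ (g * k) = q Γ β ↔ q Γ g = q Γ β := by rw [← hβ, q_mul, hβ]
  unfold stp
  split_ifs <;> first | rfl | (exfalso; tauto)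

lemma stp_l (α β : SL(2, ℤ)) (a b c : ℤ) : stp (Γ := Γ) α β a b c α = a := by simp [stp]
lemma stp_r (α β : SL(2, ℤ)) (a b c : ℤ) (h : q Γ α ≠ q Γ β) :
    stp (Γ := Γ) α β a b c β = b := by simp [stp, Ne.symm h]
lemma stp_dvd (α β : SL(2, ℤ)) (a b c n : ℤ) (ha : 2 ∣ a - n) (hb : 2 ∣ b - n) (hc : 2 ∣ c - n) (g) :
    2 ∣ stp (Γ := Γ) α β a b c g - n := by
  unfold stp; split_ifs <;> assumption

/-- exactly two fixed cosets for right multiplication by `k`. -/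
def Two (Γ : Subgroup SL(2, ℤ)) (k : SL(2, ℤ)) : Prop := ∃ α β, q Γ α ≠ q Γ β ∧
  q Γ (α * k) = q Γ α ∧ q Γ (β * k) = q Γ β ∧ ∀ g, q Γ (g * k) = q Γ g → q Γ g = q Γ α ∨ q Γ g = q Γ β

lemma two_S (h : Two Γ S) : ∃ φ : W Γ →+ ZMod 4 × ZMod 2, Function.Surjective φ ∧
    ∀ w : W Γ, φ w = 0 ↔ (∀ g, 2 ∣ w.1.1 g) ∧ (∀ g, q Γ (g * S) = q Γ g → 4 ∣ w.1.1 g) := by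
  obtain ⟨α, β, hne, hα, hβ, hf⟩ := h
  refine ⟨((cst 4).comp (evx α)).prod ((cst 2).comp (hd α β)), ?_, fun w => ?_⟩
  · rintro ⟨k, l⟩
    obtain ⟨k, rfl⟩ := ZMod.intCast_surjective k
    obtain ⟨l, rfl⟩ := ZMod.intCast_surjective l
    refine ⟨⟨(stp (Γ := Γ) α β k (k - 2 * l) k, fun _ => k), stp_inv _ _ _ _ _, fun _ _ _ => rfl,
      stp_mul _ _ _ _ _ _ hα hβ, fun _ => rfl,
      stp_dvd _ _ _ _ _ _ (by simp) (by simp) (by simp)⟩, Prod.ext ?_ ?_⟩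
    · change ((stp (Γ := Γ) α β k (k - 2 * l) k α : ℤ) : ZMod 4) = k
      rw [stp_l]
    · change (((stp (Γ := Γ) α β k (k - 2 * l) k α - stp (Γ := Γ) α β k (k - 2 * l) k β) / 2 : ℤ) :
        ZMod 2) = l
      rw [stp_l, stp_r _ _ _ _ _ hne]
      congr 1
      omega
  · have a := par_const w.2
    have b := a α
    have c := a β
    rw [Prod.ext_iff]
    change cst 4 (w.1.1 α) = 0 ∧ cst 2 ((w.1.1 α - w.1.1 β) / 2) = 0 ↔ _
    rw [cst_zero, cst_zero]
    push_cast
    constructor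
    · rintro ⟨h1, h2⟩
      refine ⟨fun g => ?_, fun g hg => ?_⟩
      · have := a g
        omega
      · rcases hf g hg with h | h
        · rw [inv_q w.2.x_inv h]; exact h1
        · rw [inv_q w.2.x_inv h]
          omega
    · rintro ⟨h1, h2⟩
      have := h2 _ hα
      have := h2 _ hβ
      constructor <;> omega

lemma none_S (h : ∀ g, q Γ (g * S) ≠ q Γ g) : ∃ φ : W Γ →+ ZMod 2, Function.Surjective φ ∧
    ∀ w : W Γ, φ w = 0 ↔ (∀ g, 2 ∣ w.1.1 g) ∧ (∀ g, q Γ (g * S) = q Γ g → 4 ∣ w.1.1 g) := by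
  refine ⟨(cst 2).comp (evx 1), ?_, fun w => ?_⟩
  · intro k
    obtain ⟨k, rfl⟩ := ZMod.intCast_surjective k
    exact ⟨⟨(fun _ => k, fun _ => k), fun _ _ _ => rfl, fun _ _ _ => rfl,
      fun _ => rfl, fun _ => rfl, fun _ => by simp⟩, rfl⟩
  · have a := par_const w.2
    change cst 2 (w.1.1 1) = 0 ↔ _
    rw [cst_zero]
    push_cast
    constructor
    · intro h1
      refine ⟨fun g => ?_, fun g hg => absurd hg (h g)⟩
      have := a g
      omega
    · rintro ⟨h1, h2⟩
      exact h1 1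

lemma two_U (h : Two Γ U) : ∃ φ : W Γ →+ ZMod 3 × ZMod 3, Function.Surjective φ ∧
    ∀ w : W Γ, φ w = 0 ↔ ∀ g, q Γ (g * U) = q Γ g → 3 ∣ w.1.2 g := by
  obtain ⟨α, β, hne, hα, hβ, hf⟩ := h
  refine ⟨((cst 3).comp (evy α)).prod ((cst 3).comp (evy β)), ?_, fun w => ?_⟩
  · rintro ⟨k, l⟩
    obtain ⟨k, rfl⟩ := ZMod.intCast_surjective k
    obtain ⟨l, rfl⟩ := ZMod.intCast_surjective l
    have e : (4 : ZMod 3) = 1 := rfl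
    refine ⟨⟨(fun _ => 0, stp (Γ := Γ) α β (4 * k) (4 * l) 0), fun _ _ _ => rfl, stp_inv _ _ _ _ _,
      fun _ => rfl, stp_mul _ _ _ _ _ _ hα hβ, fun g => ?_⟩, Prod.ext ?_ ?_⟩
    · have := stp_dvd (Γ := Γ) α β (4 * k) (4 * l) 0 0 (by omega) (by omega) (by simp) g
      simp only
      omega
    · change ((stp (Γ := Γ) α β (4 * k) (4 * l) 0 α : ℤ) : ZMod 3) = k
      rw [stp_l]
      push_cast
      rw [e, one_mul]
    · change ((stp (Γ := Γ) α β (4 * k) (4 * l) 0 β : ℤ) : ZMod 3) = l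
      rw [stp_r _ _ _ _ _ hne]
      push_cast
      rw [e, one_mul]
  · rw [Prod.ext_iff]
    change cst 3 (w.1.2 α) = 0 ∧ cst 3 (w.1.2 β) = 0 ↔ _
    rw [cst_zero, cst_zero]
    push_cast
    constructor
    · rintro ⟨h1, h2⟩ g hg
      rcases hf g hg with h | h
      · rw [inv_q w.2.y_inv h]; exact h1
      · rw [inv_q w.2.y_inv h]; exact h2
    · intro h2
      exact ⟨h2 _ hα, h2 _ hβ⟩

lemma none_U (h : ∀ g, q Γ (g * U) ≠ q Γ g) : ∃ φ : W Γ →+ Unit, Function.Surjective φ ∧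
    ∀ w : W Γ, φ w = 0 ↔ ∀ g, q Γ (g * U) = q Γ g → 3 ∣ w.1.2 g :=
  ⟨0, fun _ => ⟨0, rfl⟩, fun _ => ⟨fun _ g hg => absurd hg (h g), fun _ => rfl⟩⟩

end comb

section fixed
open ModularGroup Matrix MatrixGroups CongruenceSubgroup

variable {p : ℕ} [Fact p.Prime]

lemma q_gamma (g h : SL(2, ℤ)) : q (Gamma0 p) g = q (Gamma0 p) h ↔
    ((h 1 0 : ℤ) : ZMod p) * (g 1 1 : ℤ) - ((h 1 1 : ℤ) : ZMod p) * (g 1 0 : ℤ) = 0 := by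
  rw [q_eq, Gamma0_mem]
  have : (h * g⁻¹) 1 0 = h 1 0 * g 1 1 - h 1 1 * g 1 0 := by
    have e : (h * g⁻¹).1 = h.1 * g.1.adjugate := rfl
    change (h * g⁻¹).1 1 0 = h.1 1 0 * g.1 1 1 - h.1 1 1 * g.1 1 0
    rw [e, Matrix.adjugate_fin_two]
    simp [Matrix.mul_apply, Fin.sum_univ_two]
    ring
  rw [this]
  push_cast
  rfl

lemma q_S (g : SL(2, ℤ)) : q (Gamma0 p) (g * S) = q (Gamma0 p) g ↔
    ((g 1 1 : ℤ) : ZMod p) ^ 2 + ((g 1 0 : ℤ) : ZMod p) ^ 2 = 0 := by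
  obtain ⟨-, -, h1, h2⟩ := mulS g
  rw [q_gamma, h1, h2, ← neg_eq_zero]
  push_cast
  ring_nf

lemma q_U (g : SL(2, ℤ)) : q (Gamma0 p) (g * U) = q (Gamma0 p) g ↔
    ((g 1 1 : ℤ) : ZMod p) ^ 2 - (g 1 1 : ℤ) * (g 1 0 : ℤ) + ((g 1 0 : ℤ) : ZMod p) ^ 2 = 0 := by
  obtain ⟨-, -, h1, h2⟩ := mulU g
  rw [q_gamma, h1, h2, ← neg_eq_zero]
  push_cast
  ring_nf

lemma ne_zero (g : SL(2, ℤ)) (h0 : ((g 1 0 : ℤ) : ZMod p) = 0) (h1 : ((g 1 1 : ℤ) : ZMod p) = 0) :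
    False := by
  have h := g.det_coe
  rw [Matrix.det_fin_two] at h
  have h' := congrArg (Int.cast : ℤ → ZMod p) h
  push_cast at h'
  rw [show ((g.1 1 0 : ℤ) : ZMod p) = 0 from h0, show ((g.1 1 1 : ℤ) : ZMod p) = 0 from h1] at h'
  simp at h'

/-- Representatives. -/
def rep (l : ℤ) : SL(2, ℤ) := ⟨!![0, -1; 1, l], by simp [Matrix.det_fin_two]⟩
lemma rep_10 (l : ℤ) : rep l 1 0 = 1 := rfl
lemma rep_11 (l : ℤ) : rep l 1 1 = l := rfl

lemma q_rep (g : SL(2, ℤ)) (l : ℤ) : q (Gamma0 p) g = q (Gamma0 p) (rep l) ↔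
    ((g 1 1 : ℤ) : ZMod p) - l * (g 1 0 : ℤ) = 0 := by
  rw [q_gamma, rep_10, rep_11]; simp

lemma S_two (hp3 : 3 < p) (h : p % 4 = 1) : Two (Gamma0 p) S := by
  have h' : IsSquare (-1 : ZMod p) := ZMod.exists_sq_eq_neg_one_iff.2 (by omega)
  obtain ⟨l, hl⟩ := h'
  obtain ⟨l, rfl⟩ := ZMod.intCast_surjective l
  have h2 : (2 : ZMod p) ≠ 0 := by
    intro h
    have : ((2 : ℕ) : ZMod p) = 0 := by exact_mod_cast h
    rw [ZMod.natCast_eq_zero_iff] at this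
    have := Nat.le_of_dvd (by norm_num) this
    omega
  refine ⟨rep l, rep (-l), ?_, ?_, ?_, ?_⟩
  · rw [Ne, q_rep, rep_10, rep_11]
    push_cast
    intro h
    have h3 : (2 : ZMod p) * l = 0 := by linear_combination h
    rcases mul_eq_zero.1 h3 with h3 | h3
    · exact h2 h3
    · rw [h3] at hl
      simp at hl
  · rw [q_S, rep_10, rep_11]
    push_cast
    linear_combination -hl
  · rw [q_S, rep_10, rep_11]
    push_cast
    linear_combination -hl
  · intro g hg
    rw [q_rep, q_rep]
    rw [q_S] at hg
    rw [← mul_eq_zero]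
    push_cast
    linear_combination hg + hl * ((g 1 0 : ℤ) : ZMod p) ^ 2

lemma S_none (h : p % 4 = 3) (g : SL(2, ℤ)) : q (Gamma0 p) (g * S) ≠ q (Gamma0 p) g := by
  intro hg
  rw [q_S] at hg
  by_cases h0 : ((g 1 0 : ℤ) : ZMod p) = 0
  · refine ne_zero g h0 ?_
    rw [h0] at hg
    simpa using hg
  · have : IsSquare (-1 : ZMod p) := by
      refine ⟨((g 1 1 : ℤ) : ZMod p) / ((g 1 0 : ℤ) : ZMod p), ?_⟩
      field_simp
      linear_combination -hg
    exact ZMod.exists_sq_eq_neg_one_iff.1 this h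

lemma three_ne (hp3 : 3 < p) : (3 : ZMod p) ≠ 0 := by
  intro h
  have : ((3 : ℕ) : ZMod p) = 0 := by exact_mod_cast h
  rw [ZMod.natCast_eq_zero_iff] at this
  have := Nat.le_of_dvd (by norm_num) this
  omega

lemma U_two (hp3 : 3 < p) (h : p % 3 = 1) : Two (Gamma0 p) U := by
  obtain ⟨l, hl⟩ : ∃ l : ZMod p, l ^ 2 - l + 1 = 0 := by
    have : Fact (Nat.Prime 3) := ⟨Nat.prime_three⟩
    obtain ⟨w, hw⟩ := exists_prime_orderOf_dvd_card (G := (ZMod p)ˣ) 3 (by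
      rw [ZMod.card_units_eq_totient, Nat.totient_prime Fact.out]; omega)
    have h1 : w ≠ 1 := by
      rintro rfl
      simp at hw
    have h2 : w ^ 3 = 1 := by rw [← hw]; exact pow_orderOf_eq_one w
    refine ⟨-w, ?_⟩
    have h3 : (w : ZMod p) ^ 3 = 1 := by
      rw [← Units.val_pow_eq_pow_val, h2, Units.val_one]
    have h4 : (w : ZMod p) - 1 ≠ 0 := by
      rw [sub_ne_zero]
      exact fun h => h1 (Units.ext h)
    apply mul_left_cancel₀ h4
    linear_combination h3
  obtain ⟨l, rfl⟩ := ZMod.intCast_surjective l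
  refine ⟨rep l, rep (1 - l), ?_, ?_, ?_, ?_⟩
  · rw [Ne, q_rep, rep_10, rep_11]
    push_cast
    intro h
    apply three_ne hp3
    linear_combination 4 * hl - (2 * (l : ZMod p) - 1) * h
  · rw [q_U, rep_10, rep_11]
    push_cast
    linear_combination hl
  · rw [q_U, rep_10, rep_11]
    push_cast
    linear_combination hl
  · intro g hg
    rw [q_rep, q_rep]
    rw [q_U] at hg
    rw [← mul_eq_zero]
    push_cast
    linear_combination hg - hl * ((g 1 0 : ℤ) : ZMod p) ^ 2

lemma U_none (hp3 : 3 < p) (h : p % 3 = 2) (g : SL(2, ℤ)) :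
    q (Gamma0 p) (g * U) ≠ q (Gamma0 p) g := by
  intro hg
  rw [q_U] at hg
  by_cases h0 : ((g 1 0 : ℤ) : ZMod p) = 0
  · refine ne_zero g h0 ?_
    rw [h0] at hg
    simpa using hg
  · obtain ⟨w, hw⟩ : ∃ w : ZMod p, w ^ 2 + w + 1 = 0 := by
      refine ⟨-(((g 1 1 : ℤ) : ZMod p) / ((g 1 0 : ℤ) : ZMod p)), ?_⟩
      field_simp
      linear_combination hg
    have h3 : w ^ 3 = 1 := by linear_combination (w - 1) * hw
    have h1 : w ≠ 1 := by
      rintro rfl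
      apply three_ne hp3
      linear_combination hw
    have : Fact (Nat.Prime 3) := ⟨Nat.prime_three⟩
    have ho : orderOf w = 3 := orderOf_eq_prime h3 h1
    have hw0 : w ≠ 0 := by
      rintro rfl
      simp at hw
    have := ZMod.orderOf_dvd_card_sub_one hw0
    rw [ho] at this
    omega

lemma neg_mem : (-1 : SL(2, ℤ)) ∈ Gamma0 p := by
  rw [Gamma0_mem]
  simp

/-- An additive equivalence as a linear equivalence over the integers. -/
def toLinE {M N : Type*} [AddCommGroup M] [AddCommGroup N] {i1 : Module ℤ M} {i2 : Module ℤ N}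
    (f : M ≃+ N) : M ≃ₗ[ℤ] N :=
  { f with map_smul' := fun c x => map_intCast_smul f ℤ ℤ c x }

end fixed

section final
open CongruenceSubgroup ModularGroup

lemma zmod_four (k : ZMod 4 × ZMod 2) : 4 • k = 0 := by revert k; decide
lemma zmod_two (k : ZMod 2) : 4 • k = 0 := by revert k; decide
lemma zmod_three (k : ZMod 3 × ZMod 3) : 3 • k = 0 := by revert k; decide

/-- Chinese remainder for twelve. -/
def crt12 : ZMod 12 ≃+ ZMod 4 × ZMod 3 :=
  (ZMod.chineseRemainder (m := 4) (n := 3) (by norm_num)).toAddEquiv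
/-- Chinese remainder for six. -/
def crt6 : ZMod 6 ≃+ ZMod 2 × ZMod 3 :=
  (ZMod.chineseRemainder (m := 2) (n := 3) (by norm_num)).toAddEquiv

/-- Regrouping. -/
def regroup_one : (ZMod 4 × ZMod 2) × (ZMod 3 × ZMod 3) ≃+ ZMod 12 × ZMod 6 :=
  (AddEquiv.prodProdProdComm _ _ _ _).trans (crt12.symm.prodCongr crt6.symm)
/-- Regrouping. -/
def regroup_seven : ZMod 2 × (ZMod 3 × ZMod 3) ≃+ ZMod 3 × ZMod 6 :=
  ((AddEquiv.prodAssoc.symm).trans (crt6.symm.prodCongr (AddEquiv.refl _))).trans AddEquiv.prodComm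

theorem main (p : ℕ) (hp : p.Prime) (hp3 : 3 < p) (j : ℕ) :
    (p % 12 = 1 → Nonempty ((groupCohomology (Rep.trivial ℤ (Gamma0 p) ℤ) (2 * j + 2)) ≃+
      (ZMod 12 × ZMod 6))) ∧
    (p % 12 = 5 → Nonempty ((groupCohomology (Rep.trivial ℤ (Gamma0 p) ℤ) (2 * j + 2)) ≃+
      (ZMod 4 × ZMod 2))) ∧
    (p % 12 = 7 → Nonempty ((groupCohomology (Rep.trivial ℤ (Gamma0 p) ℤ) (2 * j + 2)) ≃+
      (ZMod 3 × ZMod 6))) ∧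
    (p % 12 = 11 → Nonempty ((groupCohomology (Rep.trivial ℤ (Gamma0 p) ℤ) (2 * j + 2)) ≃+
      ZMod 2)) := by
  have : Fact p.Prime := ⟨hp⟩
  refine ⟨fun h => ?_, fun h => ?_, fun h => ?_, fun h => ?_⟩
  · obtain ⟨φ, h1, h2⟩ := two_S (S_two hp3 (by omega))
    obtain ⟨ψ, h3, h4⟩ := two_U (U_two hp3 (by omega))
    obtain ⟨E⟩ := H_comb neg_mem j φ ψ h1 h3 zmod_four zmod_three h2 h4
    exact ⟨E.trans regroup_one⟩
  · obtain ⟨φ, h1, h2⟩ := two_S (S_two hp3 (by omega))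
    obtain ⟨ψ, h3, h4⟩ := none_U (U_none (p := p) hp3 (by omega))
    obtain ⟨E⟩ := H_comb neg_mem j φ ψ h1 h3 zmod_four (fun _ => rfl) h2 h4
    exact ⟨E.trans AddEquiv.prodUnique⟩
  · obtain ⟨φ, h1, h2⟩ := none_S (S_none (p := p) (by omega))
    obtain ⟨ψ, h3, h4⟩ := two_U (U_two hp3 (by omega))
    obtain ⟨E⟩ := H_comb neg_mem j φ ψ h1 h3 zmod_two zmod_three h2 h4
    exact ⟨E.trans regroup_seven⟩
  · obtain ⟨φ, h1, h2⟩ := none_S (S_none (p := p) (by omega))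
    obtain ⟨ψ, h3, h4⟩ := none_U (U_none (p := p) hp3 (by omega))
    obtain ⟨E⟩ := H_comb neg_mem j φ ψ h1 h3 zmod_two (fun _ => rfl) h2 h4
    exact ⟨E.trans AddEquiv.prodUnique⟩

end final
end G0

open CongruenceSubgroup

/-- For a prime `p > 3` and any `i ≥ 1`, the even-dimensional integral cohomology
of `Γ₀(p)` is as computed by Adem–Naffah, depending on `p mod 12`. -/
theorem even_cohomology_Gamma0 (p : ℕ) (hp : p.Prime) (hp3 : 3 < p) (i : ℕ) (hi : 1 ≤ i) :
    (p % 12 = 1 → Nonempty ((groupCohomology (Rep.trivial ℤ (Gamma0 p) ℤ) (2 * i)) ≃ₗ[ℤ]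
      (ZMod 12 × ZMod 6))) ∧
    (p % 12 = 5 → Nonempty ((groupCohomology (Rep.trivial ℤ (Gamma0 p) ℤ) (2 * i)) ≃ₗ[ℤ]
      (ZMod 4 × ZMod 2))) ∧
    (p % 12 = 7 → Nonempty ((groupCohomology (Rep.trivial ℤ (Gamma0 p) ℤ) (2 * i)) ≃ₗ[ℤ]
      (ZMod 3 × ZMod 6))) ∧
    (p % 12 = 11 → Nonempty ((groupCohomology (Rep.trivial ℤ (Gamma0 p) ℤ) (2 * i)) ≃ₗ[ℤ]
      ZMod 2)) := by
  obtain ⟨j, rfl⟩ : ∃ j, i = j + 1 := ⟨i - 1, by omega⟩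
  obtain ⟨h1, h2, h3, h4⟩ := G0.main p hp hp3 j
  exact ⟨fun h => (h1 h).map G0.toLinE, fun h => (h2 h).map G0.toLinE,
    fun h => (h3 h).map G0.toLinE, fun h => (h4 h).map G0.toLinE⟩
end
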